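/- Let f : (M,h) → (N,g) be a pluri-harmonic map from a Hermitian manifold (M,h) to a Riemannian manifold (N,g), and set u = |∂f|². Then Δ_h u = |∂_F ∂f|² + (h^{αβ̄} R^M_{αβ̄γδ̄}) h^{γν̄} h^{μδ̄} g_{ij} f^i_μ f^j_{ν̄} − R^N_{iℓkj} (h^{αβ̄} f^i_α f^j_{β̄})(h^{γδ̄} f^k_γ f^ℓ_{δ̄}), where Δ_h u = h^{αβ̄} ∂²u/∂z^α∂z̄^β. -/

import Mathlib

/- Common local-coordinate framework for harmonic maps from Hermitian manifolds
to Riemannian manifolds, following Wang-Yang, "RC-positivity and rigidity of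
harmonic maps into Riemannian manifolds".

A Riemannian manifold `(N, g)` is encoded as a smooth manifold `N` modelled on
`EuclideanSpace ℝ (Fin n)` together with a `RiemannData`, i.e. the matrix of the
metric in each preferred chart `chartAt _ p`, required to be smooth, symmetric,
positive definite and compatible with the change of charts.  Christoffel symbols
and the Riemann curvature tensor are *defined* from the metric by the usual
coordinate formulas.  Similarly a Hermitian manifold `(M, h)` is encoded as a
complex manifold modelled on `EuclideanSpace ℂ (Fin m)` together with an
`HermitianData`; the Chern connection and Chern curvature are defined from `h`
by the usual formulas, using Wirtinger derivatives.  All differential-geometric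
conditions (harmonic, Hermitian harmonic, pluri-harmonic, Kähler,
astheno-Kähler, RC-positivity, complex sectional curvature ...) are then
expressed by their coordinate formulas, evaluated in the chart `chartAt _ p`
at the point `basePt p = chartAt _ p p` (every point of the manifold is of this
form). -/

open scoped Manifold ComplexOrder
open Complex Finset

noncomputable section

/-- Partial derivative ∂/∂y^i of a real-valued function on ℝ^n. -/
def rDeriv {n : ℕ} (i : Fin n) (F : EuclideanSpace ℝ (Fin n) → ℝ)
    (y : EuclideanSpace ℝ (Fin n)) : ℝ :=
  fderiv ℝ F y (EuclideanSpace.single i 1)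

/-- Wirtinger derivative ∂/∂z^α of a complex-valued function on ℂ^m. -/
def wDeriv {m : ℕ} (α : Fin m) (F : EuclideanSpace ℂ (Fin m) → ℂ)
    (z : EuclideanSpace ℂ (Fin m)) : ℂ :=
  (1 / 2) * (fderiv ℝ F z (EuclideanSpace.single α 1)
    - Complex.I * fderiv ℝ F z (EuclideanSpace.single α Complex.I))

/-- Conjugate Wirtinger derivative ∂/∂z̄^α of a complex-valued function on ℂ^m. -/
def wDerivBar {m : ℕ} (α : Fin m) (F : EuclideanSpace ℂ (Fin m) → ℂ)
    (z : EuclideanSpace ℂ (Fin m)) : ℂ :=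
  (1 / 2) * (fderiv ℝ F z (EuclideanSpace.single α 1)
    + Complex.I * fderiv ℝ F z (EuclideanSpace.single α Complex.I))

/-- Christoffel symbols Γ^i_{jk} of the Levi-Civita connection of a Riemannian
metric, given by the matrix of its coefficients in a local coordinate system:
Γ^i_{jk} = ½ g^{il}(∂_j g_{kl} + ∂_k g_{jl} - ∂_l g_{jk}). -/
def christoffel {n : ℕ} (g : EuclideanSpace ℝ (Fin n) → Matrix (Fin n) (Fin n) ℝ)
    (i j k : Fin n) (y : EuclideanSpace ℝ (Fin n)) : ℝ :=
  (1 / 2) * ∑ l, (g y)⁻¹ i l *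
    (rDeriv j (fun y' => g y' k l) y + rDeriv k (fun y' => g y' j l) y
      - rDeriv l (fun y' => g y' j k) y)

/-- Riemann curvature R_{ijk}^ℓ of the Levi-Civita connection:
R_{ijk}^ℓ = ∂_i Γ^ℓ_{kj} - ∂_j Γ^ℓ_{ki} + Γ^p_{kj} Γ^ℓ_{pi} - Γ^p_{ki} Γ^ℓ_{pj}. -/
def riemannUp {n : ℕ} (g : EuclideanSpace ℝ (Fin n) → Matrix (Fin n) (Fin n) ℝ)
    (i j k l : Fin n) (y : EuclideanSpace ℝ (Fin n)) : ℝ :=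
  rDeriv i (fun y' => christoffel g l k j y') y
    - rDeriv j (fun y' => christoffel g l k i y') y
    + ∑ p, christoffel g p k j y * christoffel g l p i y
    - ∑ p, christoffel g p k i y * christoffel g l p j y

/-- Riemann curvature tensor R_{ijkℓ} = g_{sℓ} R_{ijk}^s,
convention R(X,Y,Z,W) = g(R(X,Y)Z,W). -/
def riemannLo {n : ℕ} (g : EuclideanSpace ℝ (Fin n) → Matrix (Fin n) (Fin n) ℝ)
    (i j k l : Fin n) (y : EuclideanSpace ℝ (Fin n)) : ℝ :=
  ∑ s, g y s l * riemannUp g i j k s y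

/-- The data of a Riemannian metric on a manifold `N` modelled on ℝ^n: for every
`p : N`, the matrix `g p` of the metric in the coordinates of the chart
`chartAt _ p`, smooth, symmetric, positive definite, and transforming correctly
under change of charts. -/
structure RiemannData (n : ℕ) (N : Type*) [TopologicalSpace N]
    [ChartedSpace (EuclideanSpace ℝ (Fin n)) N] where
  g : N → EuclideanSpace ℝ (Fin n) → Matrix (Fin n) (Fin n) ℝ
  smooth : ∀ (p : N) (i j : Fin n), ContDiffOn ℝ (⊤ : ℕ∞) (fun y => g p y i j)
    (chartAt (EuclideanSpace ℝ (Fin n)) p).target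
  symm : ∀ p y i j, g p y i j = g p y j i
  posdef : ∀ (p : N) (y : EuclideanSpace ℝ (Fin n)),
    y ∈ (chartAt (EuclideanSpace ℝ (Fin n)) p).target →
    ∀ v : Fin n → ℝ, v ≠ 0 → 0 < ∑ i, ∑ j, g p y i j * v i * v j
  compat : ∀ p q : N,
    ∀ y ∈ ((chartAt (EuclideanSpace ℝ (Fin n)) p).symm.trans
            (chartAt (EuclideanSpace ℝ (Fin n)) q)).source, ∀ i j,
      g p y i j = ∑ k, ∑ l,
        (fderiv ℝ (((chartAt (EuclideanSpace ℝ (Fin n)) p).symm.trans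
            (chartAt (EuclideanSpace ℝ (Fin n)) q)) :
            EuclideanSpace ℝ (Fin n) → EuclideanSpace ℝ (Fin n)) y
            (EuclideanSpace.single i 1) k) *
        (fderiv ℝ (((chartAt (EuclideanSpace ℝ (Fin n)) p).symm.trans
            (chartAt (EuclideanSpace ℝ (Fin n)) q)) :
            EuclideanSpace ℝ (Fin n) → EuclideanSpace ℝ (Fin n)) y
            (EuclideanSpace.single j 1) l) *
        g q (((chartAt (EuclideanSpace ℝ (Fin n)) p).symm.trans
            (chartAt (EuclideanSpace ℝ (Fin n)) q)) y) k l

/-- The base point of the preferred chart around `p`. -/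
def basePt {m : ℕ} {M : Type*} [TopologicalSpace M]
    [ChartedSpace (EuclideanSpace ℂ (Fin m)) M] (p : M) : EuclideanSpace ℂ (Fin m) :=
  chartAt (EuclideanSpace ℂ (Fin m)) p p

/-- The base point of the preferred chart around `q` in a Riemannian manifold. -/
def basePtR {n : ℕ} {N : Type*} [TopologicalSpace N]
    [ChartedSpace (EuclideanSpace ℝ (Fin n)) N] (q : N) : EuclideanSpace ℝ (Fin n) :=
  chartAt (EuclideanSpace ℝ (Fin n)) q q

/-- `(N,g)` has non-positive complex sectional curvature: the complex-linear
extension of the Riemann curvature tensor to the complexified tangent bundle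
satisfies R(Z, W̄, W, Z̄) ≤ 0 for all complex tangent vectors Z, W (the
inequality is in the partial order of `ℂ`; in particular the quantity is real). -/
def RiemannData.NonposComplexSectional {n : ℕ} {N : Type*} [TopologicalSpace N]
    [ChartedSpace (EuclideanSpace ℝ (Fin n)) N] (gD : RiemannData n N) : Prop :=
  ∀ (q : N) (Z W : Fin n → ℂ),
    (∑ i, ∑ j, ∑ k, ∑ l, (riemannLo (gD.g q) i j k l (basePtR q) : ℂ) *
      Z i * (starRingEnd ℂ) (W j) * W k * (starRingEnd ℂ) (Z l)) ≤ 0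

/-- The data of a Hermitian metric on a complex manifold `M` modelled on ℂ^m:
for every `p : M`, the matrix `h p` (with `h p z α β = h_{α β̄}(z)`) of the
metric in the chart `chartAt _ p`, smooth, Hermitian, positive definite, and
transforming correctly under the (holomorphic) change of charts. -/
structure HermitianData (m : ℕ) (M : Type*) [TopologicalSpace M]
    [ChartedSpace (EuclideanSpace ℂ (Fin m)) M] where
  h : M → EuclideanSpace ℂ (Fin m) → Matrix (Fin m) (Fin m) ℂ
  smooth : ∀ (p : M) (α β : Fin m), ContDiffOn ℝ (⊤ : ℕ∞) (fun z => h p z α β)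
    (chartAt (EuclideanSpace ℂ (Fin m)) p).target
  hermitian : ∀ p z α β, h p z α β = (starRingEnd ℂ) (h p z β α)
  posdef : ∀ (p : M) (z : EuclideanSpace ℂ (Fin m)),
    z ∈ (chartAt (EuclideanSpace ℂ (Fin m)) p).target →
    ∀ v : Fin m → ℂ, v ≠ 0 → 0 < ∑ α, ∑ β, h p z α β * v α * (starRingEnd ℂ) (v β)
  compat : ∀ p q : M,
    ∀ z ∈ ((chartAt (EuclideanSpace ℂ (Fin m)) p).symm.trans
            (chartAt (EuclideanSpace ℂ (Fin m)) q)).source, ∀ α β,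
      h p z α β = ∑ γ, ∑ δ,
        (fderiv ℂ (((chartAt (EuclideanSpace ℂ (Fin m)) p).symm.trans
            (chartAt (EuclideanSpace ℂ (Fin m)) q)) :
            EuclideanSpace ℂ (Fin m) → EuclideanSpace ℂ (Fin m)) z
            (EuclideanSpace.single α 1) γ) *
        (starRingEnd ℂ) (fderiv ℂ (((chartAt (EuclideanSpace ℂ (Fin m)) p).symm.trans
            (chartAt (EuclideanSpace ℂ (Fin m)) q)) :
            EuclideanSpace ℂ (Fin m) → EuclideanSpace ℂ (Fin m)) z
            (EuclideanSpace.single β 1) δ) *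
        h q (((chartAt (EuclideanSpace ℂ (Fin m)) p).symm.trans
            (chartAt (EuclideanSpace ℂ (Fin m)) q)) z) γ δ

namespace HermitianData

variable {m : ℕ} {M : Type*} [TopologicalSpace M]
  [ChartedSpace (EuclideanSpace ℂ (Fin m)) M]

/-- The inverse metric: `hD.up p z α β = h^{α β̄}(z)`, so that
`∑ δ, h^{γ δ̄} h_{α δ̄} = δ_{γ α}`. -/
def up (hD : HermitianData m M) (p : M) (z : EuclideanSpace ℂ (Fin m))
    (α β : Fin m) : ℂ :=
  (hD.h p z)⁻¹ β α

/-- Christoffel symbols Γ^μ_{αγ} = h^{μ δ̄} ∂_α h_{γ δ̄} of the Chern connection. -/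
def chernChristoffel (hD : HermitianData m M) (p : M) (α γ μ : Fin m)
    (z : EuclideanSpace ℂ (Fin m)) : ℂ :=
  ∑ δ, hD.up p z μ δ * wDeriv α (fun z' => hD.h p z' γ δ) z

/-- The Chern curvature tensor
R_{α β̄ γ δ̄} = -∂_α ∂̄_β h_{γ δ̄} + h^{μ ν̄} (∂_α h_{γ ν̄}) (∂̄_β h_{μ δ̄}). -/
def chern (hD : HermitianData m M) (p : M) (α β γ δ : Fin m)
    (z : EuclideanSpace ℂ (Fin m)) : ℂ :=
  - wDeriv α (fun z' => wDerivBar β (fun z'' => hD.h p z'' γ δ) z') z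
    + ∑ μ, ∑ ν, hD.up p z μ ν * wDeriv α (fun z' => hD.h p z' γ ν) z *
        wDerivBar β (fun z' => hD.h p z' μ δ) z

/-- The mixed Christoffel symbols Γ^{γ̄}_{α β̄} = conj (Γ^γ_{β ᾱ}) of the Hermitian
metric `h`, where Γ^γ_{α β̄} = ½ h^{γ δ̄} (∂ h_{α δ̄}/∂z̄^β − ∂ h_{α β̄}/∂z̄^δ). -/
def hermChristoffelBar (hD : HermitianData m M) (p : M) (α β γ : Fin m)
    (z : EuclideanSpace ℂ (Fin m)) : ℂ :=
  (starRingEnd ℂ) ((1 / 2) * ∑ δ, hD.up p z γ δ *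
    (wDerivBar α (fun z' => hD.h p z' β δ) z - wDerivBar δ (fun z' => hD.h p z' β α) z))

/-- `(T^{1,0}M, h)` is uniformly RC-positive: at every point there is a
direction `u` such that `R(u, ū, v, v̄) > 0` for every nonzero `v`. -/
def UniformlyRCPositive (hD : HermitianData m M) : Prop :=
  ∀ p : M, ∃ u : Fin m → ℂ, ∀ v : Fin m → ℂ, v ≠ 0 →
    0 < ∑ α, ∑ β, ∑ γ, ∑ δ, hD.chern p α β γ δ (basePt p) *
      u α * (starRingEnd ℂ) (u β) * v γ * (starRingEnd ℂ) (v δ)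

/-- `(M, h)` has positive holomorphic sectional curvature:
`R(v, v̄, v, v̄) > 0` for every nonzero `v`. -/
def PosHolomorphicSectional (hD : HermitianData m M) : Prop :=
  ∀ p : M, ∀ v : Fin m → ℂ, v ≠ 0 →
    0 < ∑ α, ∑ β, ∑ γ, ∑ δ, hD.chern p α β γ δ (basePt p) *
      v α * (starRingEnd ℂ) (v β) * v γ * (starRingEnd ℂ) (v δ)

/-- The second Chern-Ricci curvature `h^{α β̄} R_{α β̄ γ δ̄}` is positive definite. -/
def SecondChernRicciPositive (hD : HermitianData m M) : Prop :=
  ∀ p : M, ∀ v : Fin m → ℂ, v ≠ 0 →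
    0 < ∑ α, ∑ β, ∑ γ, ∑ δ, hD.up p (basePt p) α β *
      hD.chern p α β γ δ (basePt p) * v γ * (starRingEnd ℂ) (v δ)

/-- `(M,h)` is Kähler: ∂_α h_{β γ̄} = ∂_β h_{α γ̄} in all charts. -/
def IsKaehler (hD : HermitianData m M) : Prop :=
  ∀ (p : M) (z : EuclideanSpace ℂ (Fin m)),
    z ∈ (chartAt (EuclideanSpace ℂ (Fin m)) p).target → ∀ α β γ,
      wDeriv α (fun z' => hD.h p z' β γ) z = wDeriv β (fun z' => hD.h p z' α γ) z

/-- `(M,h)` is astheno-Kähler: `∂ ∂̄ (ω_h^{m-2}) = 0`.  The coefficients of the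
`(m-1, m-1)`-form `∂ ∂̄ (ω_h^{m-2})` are, up to a nonzero universal constant, the
antisymmetrizations (over both the holomorphic multi-index `a` and the
anti-holomorphic multi-index `b`) of
`∂_{a j₀} ∂̄_{b j₀} ∏_{j ≠ j₀} h_{a j, (b j)‾}`. -/
def IsAstheno (hD : HermitianData m M) : Prop :=
  ∀ (p : M) (a b : Fin (m - 1) → Fin m) (j₀ : Fin (m - 1)),
    ∑ σ : Equiv.Perm (Fin (m - 1)), ∑ τ : Equiv.Perm (Fin (m - 1)),
      (((Equiv.Perm.sign σ : ℤ) * (Equiv.Perm.sign τ : ℤ) : ℤ) : ℂ) *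
        wDeriv (a (σ j₀)) (fun z => wDerivBar (b (τ j₀)) (fun z' =>
          ∏ j ∈ Finset.univ.erase j₀, hD.h p z' (a (σ j)) (b (τ j))) z) (basePt p) = 0

end HermitianData

section Maps

variable {m n : ℕ} {M N : Type*} [TopologicalSpace M]
  [ChartedSpace (EuclideanSpace ℂ (Fin m)) M]
  [TopologicalSpace N] [ChartedSpace (EuclideanSpace ℝ (Fin n)) N]

/-- The coordinate representative of `f : M → N` in the preferred charts around
`p` and `f p`. -/
def chartRep (f : M → N) (p : M) :
    EuclideanSpace ℂ (Fin m) → EuclideanSpace ℝ (Fin n) :=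
  (chartAt (EuclideanSpace ℝ (Fin n)) (f p)) ∘ f ∘
    (chartAt (EuclideanSpace ℂ (Fin m)) p).symm

/-- The (complexified) components `f^i` of `f` in the preferred charts around `p`. -/
def mapComp (f : M → N) (p : M) (i : Fin n) (z : EuclideanSpace ℂ (Fin m)) : ℂ :=
  ((chartRep f p z i : ℝ) : ℂ)

/-- `f : M → N` is a smooth map (`M` being regarded as a smooth real manifold). -/
def IsSmoothMap (f : M → N) : Prop :=
  ContMDiff 𝓘(ℝ, EuclideanSpace ℂ (Fin m)) 𝓘(ℝ, EuclideanSpace ℝ (Fin n)) (⊤ : ℕ∞) f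

/-- The components `(∂_E ∂̄ f)^i_{α β̄} = ∂²f^i/∂z^α ∂z̄^β + Γ^i_{jk} f^j_{β̄} f^k_α`
of the `E = f*(TN)`-valued `(1,1)`-form `∂_E ∂̄ f`, in the charts around `p`. -/
def pluriTensor (gD : RiemannData n N) (f : M → N) (p : M) (i : Fin n)
    (α β : Fin m) (z : EuclideanSpace ℂ (Fin m)) : ℂ :=
  wDeriv α (fun z' => wDerivBar β (mapComp f p i) z') z
    + ∑ j, ∑ k, (christoffel (gD.g (f p)) i j k (chartRep f p z) : ℂ) *
        wDerivBar β (mapComp f p j) z * wDeriv α (mapComp f p k) z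

/-- `f` is pluri-harmonic: `∂_E ∂̄ f = 0`. -/
def IsPluriHarmonic (gD : RiemannData n N) (f : M → N) : Prop :=
  ∀ (p : M) (i : Fin n) (α β : Fin m), pluriTensor gD f p i α β (basePt p) = 0

/-- `f` is Hermitian harmonic:
`h^{α β̄} (∂²f^i/∂z^α ∂z̄^β + Γ^i_{jk} f^j_{β̄} f^k_α) = 0`. -/
def IsHermitianHarmonic (hD : HermitianData m M) (gD : RiemannData n N)
    (f : M → N) : Prop :=
  ∀ (p : M) (i : Fin n),
    ∑ α, ∑ β, hD.up p (basePt p) α β * pluriTensor gD f p i α β (basePt p) = 0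

/-- `f` is harmonic (critical point of the energy; Euler-Lagrange equation in
complex coordinates):
`h^{α β̄} (∂²f^i/∂z^α ∂z̄^β − 2 Γ^{γ̄}_{α β̄} ∂f^i/∂z̄^γ + Γ^i_{jk} f^j_{β̄} f^k_α) = 0`. -/
def IsHarmonicMap (hD : HermitianData m M) (gD : RiemannData n N)
    (f : M → N) : Prop :=
  ∀ (p : M) (i : Fin n),
    ∑ α, ∑ β, hD.up p (basePt p) α β * (pluriTensor gD f p i α β (basePt p)
      - 2 * ∑ γ, hD.hermChristoffelBar p α β γ (basePt p) *
          wDerivBar γ (mapComp f p i) (basePt p)) = 0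

end Maps


variable {m n : ℕ} {M N : Type*} [TopologicalSpace M]
  [ChartedSpace (EuclideanSpace ℂ (Fin m)) M]
  [TopologicalSpace N] [ChartedSpace (EuclideanSpace ℝ (Fin n)) N]

/-- The function `u = |∂f|² = h^{α β̄} g_{ij} f^i_α (f^j_β)‾`, written in the
chart around `p`. -/
def delfNormSq (hD : HermitianData m M) (gD : RiemannData n N) (f : M → N)
    (p : M) (z : EuclideanSpace ℂ (Fin m)) : ℂ :=
  ∑ α, ∑ β, ∑ i, ∑ j, hD.up p z α β * (gD.g (f p) (chartRep f p z) i j : ℂ) *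
    wDeriv α (mapComp f p i) z * (starRingEnd ℂ) (wDeriv β (mapComp f p j) z)

/-- The components `(∂_F ∂f)^i_{γ α} = ∂_α f^i_γ − Γ^μ_{α γ} f^i_μ + Γ^i_{jk} f^j_α f^k_γ`
of the `(1,0)`-derivative of `∂f` in the bundle `F = T^{*1,0}M ⊗ f^*(TN)`, with
respect to the connection induced by the Chern connection of `h` on `M` and the
Levi-Civita connection of `g` on `N`. -/
def delFdelf (hD : HermitianData m M) (gD : RiemannData n N) (f : M → N)
    (p : M) (i : Fin n) (γ α : Fin m) (z : EuclideanSpace ℂ (Fin m)) : ℂ :=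
  wDeriv α (fun z' => wDeriv γ (mapComp f p i) z') z
    - ∑ μ, hD.chernChristoffel p α γ μ z * wDeriv μ (mapComp f p i) z
    + ∑ j, ∑ k, (christoffel (gD.g (f p)) i j k (chartRep f p z) : ℂ) *
        wDeriv α (mapComp f p j) z * wDeriv γ (mapComp f p k) z

/-- The common form of the two Wirtinger derivatives: `∂/∂z^α` for `c = -I` and `∂/∂z̄^α` for
`c = I`. -/
def wDir {m : ℕ} (c : ℂ) (α : Fin m) (F : EuclideanSpace ℂ (Fin m) → ℂ)
    (z : EuclideanSpace ℂ (Fin m)) : ℂ :=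
  (1 / 2) * (fderiv ℝ F z (EuclideanSpace.single α 1)
    + c * fderiv ℝ F z (EuclideanSpace.single α Complex.I))

section Wirtinger

open Filter Topology

variable {m n : ℕ} {c : ℂ} {α : Fin m} {F G : EuclideanSpace ℂ (Fin m) → ℂ}
  {z : EuclideanSpace ℂ (Fin m)}

theorem wDeriv_eq_wDir : wDeriv (m := m) = wDir (-Complex.I) := by
  funext α F z
  simp only [wDeriv, wDir]
  ring

theorem wDerivBar_eq_wDir : wDerivBar (m := m) = wDir Complex.I := rfl

theorem wDir_congr (h : F =ᶠ[𝓝 z] G) : wDir c α F z = wDir c α G z := by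
  simp only [wDir, h.fderiv_eq]

@[simp]
theorem wDir_const (a : ℂ) : wDir c α (fun _ => a) z = 0 := by
  simp [wDir]

theorem wDir_add (hF : DifferentiableAt ℝ F z) (hG : DifferentiableAt ℝ G z) :
    wDir c α (fun z => F z + G z) z = wDir c α F z + wDir c α G z := by
  simp only [wDir, fderiv_fun_add hF hG, _root_.add_apply]
  ring

theorem wDir_sub (hF : DifferentiableAt ℝ F z) (hG : DifferentiableAt ℝ G z) :
    wDir c α (fun z => F z - G z) z = wDir c α F z - wDir c α G z := by
  simp only [wDir, fderiv_fun_sub hF hG, _root_.sub_apply]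
  ring

theorem wDir_mul (hF : DifferentiableAt ℝ F z) (hG : DifferentiableAt ℝ G z) :
    wDir c α (fun z => F z * G z) z = wDir c α F z * G z + F z * wDir c α G z := by
  simp only [wDir, fderiv_fun_mul hF hG, _root_.add_apply,
    _root_.smul_apply, smul_eq_mul]
  ring

theorem wDir_sum {ι : Type*} (s : Finset ι) {A : ι → EuclideanSpace ℂ (Fin m) → ℂ}
    (hA : ∀ i ∈ s, DifferentiableAt ℝ (A i) z) :
    wDir c α (fun z => ∑ i ∈ s, A i z) z = ∑ i ∈ s, wDir c α (A i) z := by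
  simp only [wDir, fderiv_fun_sum hA, _root_.sum_apply, Finset.mul_sum,
    ← Finset.sum_add_distrib]

theorem wDir_conj :
    wDir c α (fun z => (starRingEnd ℂ) (F z)) z
      = (starRingEnd ℂ) (wDir ((starRingEnd ℂ) c) α F z) := by
  have h : fderiv ℝ (fun z => (starRingEnd ℂ) (F z)) z
      = (Complex.conjCLE : ℂ →L[ℝ] ℂ).comp (fderiv ℝ F z) :=
    Complex.conjCLE.comp_fderiv
  simp [wDir, h, map_ofNat]

theorem wDir_contDiffAt {k l : WithTop ℕ∞} (hF : ContDiffAt ℝ k F z) (hkl : l + 1 ≤ k) :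
    ContDiffAt ℝ l (wDir c α F) z := by
  have h := hF.fderiv_right hkl
  exact contDiffAt_const.mul ((h.clm_apply contDiffAt_const).add
    (contDiffAt_const.mul (h.clm_apply contDiffAt_const)))

theorem wDir_wDir (hF : ContDiffAt ℝ 2 F z) {d : ℂ} {β : Fin m} :
    wDir c α (wDir d β F) z = (1 / 4) * (fderiv ℝ (fderiv ℝ F) z (EuclideanSpace.single α 1)
        (EuclideanSpace.single β 1)
      + d * fderiv ℝ (fderiv ℝ F) z (EuclideanSpace.single α 1)
        (EuclideanSpace.single β Complex.I)
      + c * fderiv ℝ (fderiv ℝ F) z (EuclideanSpace.single α Complex.I)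
        (EuclideanSpace.single β 1)
      + c * d * fderiv ℝ (fderiv ℝ F) z (EuclideanSpace.single α Complex.I)
        (EuclideanSpace.single β Complex.I)) := by
  have h : DifferentiableAt ℝ (fderiv ℝ F) z :=
    (hF.fderiv_right (m := 1) (by norm_num)).differentiableAt (by norm_num)
  have key (v w : EuclideanSpace ℂ (Fin m)) :
      fderiv ℝ (fun z => fderiv ℝ F z v) z w = fderiv ℝ (fderiv ℝ F) z w v := by
    rw [fderiv_clm_apply h (differentiableAt_const v)]
    simp
  have hd (v : EuclideanSpace ℂ (Fin m)) : DifferentiableAt ℝ (fun z => fderiv ℝ F z v) z :=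
    h.clm_apply (differentiableAt_const v)
  have hw (v : EuclideanSpace ℂ (Fin m)) : fderiv ℝ (wDir d β F) z v
      = (1 / 2) * (fderiv ℝ (fderiv ℝ F) z v (EuclideanSpace.single β 1)
        + d * fderiv ℝ (fderiv ℝ F) z v (EuclideanSpace.single β Complex.I)) := by
    have h1 : HasFDerivAt (wDir d β F) _ z :=
      (((hd (EuclideanSpace.single β 1)).hasFDerivAt.fun_add
        ((hd (EuclideanSpace.single β Complex.I)).hasFDerivAt.const_mul d)).const_mul (1 / 2))
    rw [h1.fderiv]
    simp [key, mul_add]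
  rw [wDir, hw, hw]
  ring

theorem wDir_comm (hF : ContDiffAt ℝ 2 F z) {d : ℂ} {β : Fin m} :
    wDir c α (wDir d β F) z = wDir d β (wDir c α F) z := by
  have hs : IsSymmSndFDerivAt ℝ F z := hF.isSymmSndFDerivAt (by simp)
  rw [wDir_wDir hF, wDir_wDir hF, hs.eq (EuclideanSpace.single α 1),
    hs.eq (EuclideanSpace.single α Complex.I), hs.eq (EuclideanSpace.single α 1),
    hs.eq (EuclideanSpace.single α Complex.I)]
  ring

theorem hasFDerivAt_apply_coord {E : Type*} [NormedAddCommGroup E] [NormedSpace ℝ E]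
    {f : E → EuclideanSpace ℝ (Fin n)} {x : E} (hf : DifferentiableAt ℝ f x) (k : Fin n) :
    HasFDerivAt (fun x => f x k) ((EuclideanSpace.proj k : EuclideanSpace ℝ (Fin n) →L[ℝ] ℝ).comp
      (fderiv ℝ f x)) x :=
  (EuclideanSpace.proj k : EuclideanSpace ℝ (Fin n) →L[ℝ] ℝ).hasFDerivAt.comp x hf.hasFDerivAt

theorem clm_eq_sum_single {E : Type*} [NormedAddCommGroup E] [NormedSpace ℝ E]
    (L : EuclideanSpace ℝ (Fin n) →L[ℝ] E) (v : EuclideanSpace ℝ (Fin n)) :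
    L v = ∑ k, v k • L (EuclideanSpace.single k 1) := by
  conv_lhs => rw [← (EuclideanSpace.basisFun (Fin n) ℝ).sum_repr v]
  simp

theorem fderiv_ofReal_comp {E : Type*} [NormedAddCommGroup E] [NormedSpace ℝ E]
    {f : E → ℝ} {x : E} (hf : DifferentiableAt ℝ f x) (v : E) :
    fderiv ℝ (fun x => (f x : ℂ)) x v = (fderiv ℝ f x v : ℂ) := by
  have h : HasFDerivAt (fun x => (f x : ℂ)) (Complex.ofRealCLM.comp (fderiv ℝ f x)) x :=
    Complex.ofRealCLM.hasFDerivAt.comp x hf.hasFDerivAt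
  simp [h.fderiv]

theorem wDir_comp_real {f : EuclideanSpace ℂ (Fin m) → EuclideanSpace ℝ (Fin n)}
    {φ : EuclideanSpace ℝ (Fin n) → ℝ} (hf : DifferentiableAt ℝ f z)
    (hφ : DifferentiableAt ℝ φ (f z)) :
    wDir c α (fun z => (φ (f z) : ℂ)) z
      = ∑ k, (rDeriv k φ (f z) : ℂ) * wDir c α (fun z => (f z k : ℂ)) z := by
  have hcomp : HasFDerivAt (fun z => φ (f z)) ((fderiv ℝ φ (f z)).comp (fderiv ℝ f z)) z :=
    hφ.hasFDerivAt.comp z hf.hasFDerivAt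
  have h1 (v : EuclideanSpace ℂ (Fin m)) : fderiv ℝ (fun z => (φ (f z) : ℂ)) z v
      = ∑ k, (rDeriv k φ (f z) : ℂ) * fderiv ℝ (fun z => (f z k : ℂ)) z v := by
    rw [fderiv_ofReal_comp hcomp.differentiableAt, hcomp.fderiv, ContinuousLinearMap.comp_apply,
      clm_eq_sum_single]
    push_cast
    refine Finset.sum_congr rfl fun k _ => ?_
    have hk := hasFDerivAt_apply_coord hf k
    rw [fderiv_ofReal_comp hk.differentiableAt, hk.fderiv, rDeriv]
    simp [mul_comm]
  simp only [wDir, h1, Finset.mul_sum, ← Finset.sum_add_distrib]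
  refine Finset.sum_congr rfl fun k _ => ?_
  ring

end Wirtinger

section Riemann

open Filter Topology

variable {n : ℕ} {g : EuclideanSpace ℝ (Fin n) → Matrix (Fin n) (Fin n) ℝ}
  {F G : EuclideanSpace ℝ (Fin n) → ℝ} {y : EuclideanSpace ℝ (Fin n)} {i : Fin n}

theorem rDeriv_congr (h : F =ᶠ[𝓝 y] G) : rDeriv i F y = rDeriv i G y := by
  simp only [rDeriv, h.fderiv_eq]

theorem rDeriv_add (hF : DifferentiableAt ℝ F y) (hG : DifferentiableAt ℝ G y) :
    rDeriv i (fun y => F y + G y) y = rDeriv i F y + rDeriv i G y := by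
  simp [rDeriv, fderiv_fun_add hF hG]

theorem rDeriv_mul (hF : DifferentiableAt ℝ F y) (hG : DifferentiableAt ℝ G y) :
    rDeriv i (fun y => F y * G y) y = rDeriv i F y * G y + F y * rDeriv i G y := by
  simp only [rDeriv, fderiv_fun_mul hF hG, _root_.add_apply, _root_.smul_apply, smul_eq_mul]
  ring

theorem rDeriv_sum {ι : Type*} (s : Finset ι) {A : ι → EuclideanSpace ℝ (Fin n) → ℝ}
    (hA : ∀ i ∈ s, DifferentiableAt ℝ (A i) y) :
    rDeriv i (fun y => ∑ k ∈ s, A k y) y = ∑ k ∈ s, rDeriv i (A k) y := by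
  simp only [rDeriv, fderiv_fun_sum hA, _root_.sum_apply]

theorem rDeriv_contDiffAt {k l : WithTop ℕ∞} (hF : ContDiffAt ℝ k F y) (hkl : l + 1 ≤ k) :
    ContDiffAt ℝ l (rDeriv i F) y :=
  (hF.fderiv_right hkl).clm_apply contDiffAt_const

theorem rDeriv_comm (hF : ContDiffAt ℝ 2 F y) {j : Fin n} :
    rDeriv i (rDeriv j F) y = rDeriv j (rDeriv i F) y := by
  have h : DifferentiableAt ℝ (fderiv ℝ F) y :=
    (hF.fderiv_right (m := 1) (by norm_num)).differentiableAt (by norm_num)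
  have key (v w : EuclideanSpace ℝ (Fin n)) :
      fderiv ℝ (fun z => fderiv ℝ F z v) y w = fderiv ℝ (fderiv ℝ F) y w v := by
    rw [fderiv_clm_apply h (differentiableAt_const v)]
    simp
  have hs : IsSymmSndFDerivAt ℝ F y := hF.isSymmSndFDerivAt (by simp)
  unfold rDeriv
  rw [key, key, hs.eq]

/-- The entries of the inverse of a matrix with `C^k` entries are `C^k`. -/
theorem contDiffAt_matrix_inv_apply {E 𝕜 : Type*} [NormedAddCommGroup E] [NormedSpace ℝ E]
    [NormedField 𝕜] [NormedAlgebra ℝ 𝕜] {ι : Type*} [Fintype ι] [DecidableEq ι]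
    {A : E → Matrix ι ι 𝕜} {x : E} {k : WithTop ℕ∞}
    (hA : ∀ a b, ContDiffAt ℝ k (fun x => A x a b) x) (hx : IsUnit (A x).det) (a b : ι) :
    ContDiffAt ℝ k (fun x => (A x)⁻¹ a b) x := by
  have hdet (B : E → Matrix ι ι 𝕜) (hB : ∀ a b, ContDiffAt ℝ k (fun x => B x a b) x) :
      ContDiffAt ℝ k (fun x => (B x).det) x := by
    simp only [Matrix.det_apply']
    refine ContDiffAt.sum fun σ _ => contDiffAt_const.mul ?_
    exact contDiffAt_prod fun j _ => hB _ _
  simp only [Matrix.inv_def, Matrix.smul_apply, Ring.inverse_eq_inv', smul_eq_mul]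
  refine ((hdet A hA).inv hx.ne_zero).mul ?_
  simp only [Matrix.adjugate_apply]
  refine hdet _ fun c d => ?_
  by_cases h : c = b
  · subst h
    simpa using contDiffAt_const
  · simpa [Matrix.updateRow_ne h] using hA c d

theorem christoffel_symm (hs : ∀ y i j, g y i j = g y j i) (i j k : Fin n) :
    christoffel g i j k y = christoffel g i k j y := by
  have h : ∀ i j, (fun y => g y i j) = fun y => g y j i := fun i j => funext fun y => hs y i j
  simp only [christoffel]
  congr 1
  refine Finset.sum_congr rfl fun l _ => ?_
  rw [h j k]
  ring

theorem christoffel_contDiffAt {k l : WithTop ℕ∞}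
    (hg : ∀ i j, ContDiffAt ℝ k (fun y => g y i j) y) (hkl : l + 1 ≤ k)
    (hy : IsUnit (g y).det) (i a b : Fin n) : ContDiffAt ℝ l (christoffel g i a b) y := by
  have hlk : l ≤ k := le_trans le_self_add hkl
  refine contDiffAt_const.mul (ContDiffAt.sum fun j _ => ?_)
  exact (contDiffAt_matrix_inv_apply (fun a b => (hg a b).of_le hlk) hy i j).mul
    (((rDeriv_contDiffAt (hg b j) hkl).add (rDeriv_contDiffAt (hg a j) hkl)).sub
      (rDeriv_contDiffAt (hg a b) hkl))

theorem sum_christoffel_mul (hs : ∀ y i j, g y i j = g y j i) (hy : IsUnit (g y).det)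
    (j k l : Fin n) :
    ∑ p, christoffel g p j k y * g y p l = (1 / 2) * (rDeriv j (fun y => g y k l) y
      + rDeriv k (fun y => g y j l) y - rDeriv l (fun y => g y j k) y) := by
  have hinv : ∀ q, ∑ p, (g y)⁻¹ p q * g y p l = if l = q then 1 else 0 := by
    intro q
    have h := congrFun (congrFun (Matrix.mul_nonsing_inv (g y) hy) l) q
    rw [Matrix.mul_apply, Matrix.one_apply] at h
    rw [← h]
    exact Finset.sum_congr rfl fun p _ => by rw [hs y p l, mul_comm]
  simp only [christoffel, Finset.mul_sum, Finset.sum_mul]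
  rw [Finset.sum_comm]
  have : ∀ q, ∑ p, 1 / 2 * ((g y)⁻¹ p q * (rDeriv j (fun y => g y k q) y
      + rDeriv k (fun y => g y j q) y - rDeriv q (fun y => g y j k) y)) * g y p l
      = (if l = q then 1 else 0) * (1 / 2 * (rDeriv j (fun y => g y k q) y
      + rDeriv k (fun y => g y j q) y - rDeriv q (fun y => g y j k) y)) := by
    intro q
    rw [← hinv q, Finset.sum_mul]
    exact Finset.sum_congr rfl fun p _ => by ring
  rw [Finset.sum_congr rfl fun q _ => this q]
  simp

/-- The Levi-Civita connection is compatible with the metric. -/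
theorem rDeriv_metric (hs : ∀ y i j, g y i j = g y j i) (hy : IsUnit (g y).det)
    (i k l : Fin n) :
    rDeriv i (fun y => g y k l) y
      = ∑ p, christoffel g p k i y * g y p l + ∑ p, christoffel g p l i y * g y p k := by
  have h : ∀ i j, (fun y => g y i j) = fun y => g y j i := fun i j => funext fun y => hs y i j
  rw [sum_christoffel_mul hs hy, sum_christoffel_mul hs hy, h i l, h i k, h l k]
  ring

theorem riemannUp_swap (i j k l : Fin n) : riemannUp g j i k l y = -riemannUp g i j k l y := by
  simp only [riemannUp]
  ring

/-- The first Bianchi identity. -/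
theorem riemannUp_bianchi (hs : ∀ y i j, g y i j = g y j i) (i j k l : Fin n) :
    riemannUp g i j k l y + riemannUp g j k i l y + riemannUp g k i j l y = 0 := by
  have h : ∀ i j k, christoffel g i j k = christoffel g i k j := fun i j k =>
    funext fun y => christoffel_symm hs i j k
  simp only [riemannUp]
  rw [h l k j, h l k i, h l j i]
  simp only [fun p => h p k j, fun p => h p k i, fun p => h p j i]
  ring

theorem riemannLo_bianchi (hs : ∀ y i j, g y i j = g y j i) (i j k l : Fin n) :
    riemannLo g i j k l y + riemannLo g j k i l y + riemannLo g k i j l y = 0 := by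
  simp only [riemannLo, ← Finset.sum_add_distrib, ← mul_add, riemannUp_bianchi hs, mul_zero,
    Finset.sum_const_zero]

theorem riemannLo_antisymm (hs : ∀ y i j, g y i j = g y j i)
    (hg : ∀ i j, ContDiffAt ℝ 2 (fun y => g y i j) y) (hy : IsUnit (g y).det)
    (i j k l : Fin n) : riemannLo g i j l k y = -riemannLo g i j k l y := by
  have hgd : ∀ i j, DifferentiableAt ℝ (fun y => g y i j) y := fun i j =>
    (hg i j).differentiableAt (by norm_num)
  have hΓ : ∀ i a b, DifferentiableAt ℝ (christoffel g i a b) y := fun i a b =>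
    (christoffel_contDiffAt (l := 1) hg (by norm_num) hy i a b).differentiableAt (by norm_num)
  have hdet : ∀ᶠ y' in 𝓝 y, IsUnit (g y').det := by
    have hc : ContinuousAt (fun y => (g y).det) y := by
      have : ContinuousAt g y := continuousAt_pi.2 fun a => continuousAt_pi.2 fun b =>
        (hgd a b).continuousAt
      exact (Continuous.matrix_det continuous_id).continuousAt.comp this
    filter_upwards [hc.eventually_ne hy.ne_zero] with y' h' using h'.isUnit
  have h2 (i j : Fin n) : rDeriv i (rDeriv j fun y => g y k l) y
      = ∑ p, rDeriv i (christoffel g p k j) y * g y p l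
        + ∑ p, rDeriv i (christoffel g p l j) y * g y p k
        + ∑ p, ∑ q, (christoffel g p k j y * christoffel g q p i y * g y q l
          + christoffel g p k j y * christoffel g q l i y * g y q p)
        + ∑ p, ∑ q, (christoffel g p l j y * christoffel g q p i y * g y q k
          + christoffel g p l j y * christoffel g q k i y * g y q p) := by
    have he : rDeriv j (fun y => g y k l) =ᶠ[𝓝 y] fun y =>
        ∑ p, christoffel g p k j y * g y p l + ∑ p, christoffel g p l j y * g y p k := by
      filter_upwards [hdet] with y' h' using rDeriv_metric hs h' j k l
    rw [rDeriv_congr he, rDeriv_add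
      (DifferentiableAt.fun_sum fun p _ => (hΓ _ _ _).fun_mul (hgd _ _))
      (DifferentiableAt.fun_sum fun p _ => (hΓ _ _ _).fun_mul (hgd _ _)),
      rDeriv_sum _ fun p _ => (hΓ _ _ _).fun_mul (hgd _ _),
      rDeriv_sum _ fun p _ => (hΓ _ _ _).fun_mul (hgd _ _)]
    simp only [rDeriv_mul (hΓ _ _ _) (hgd _ _), rDeriv_metric hs hy, Finset.sum_add_distrib,
      mul_add, Finset.mul_sum, mul_assoc]
    ring
  have hcomm := rDeriv_comm (i := i) (j := j) (hg k l)
  rw [h2, h2] at hcomm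
  have hsw (i j k l : Fin n) : ∑ p, ∑ q, christoffel g p k j y * christoffel g q l i y * g y q p
      = ∑ p, ∑ q, christoffel g p l i y * christoffel g q k j y * g y q p := by
    rw [Finset.sum_comm]
    refine Finset.sum_congr rfl fun p _ => Finset.sum_congr rfl fun q _ => ?_
    rw [hs y p q]
    ring
  have hexp (i j k l : Fin n) : riemannLo g i j k l y
      = ∑ p, rDeriv i (christoffel g p k j) y * g y p l
        - ∑ p, rDeriv j (christoffel g p k i) y * g y p l
        + ∑ p, ∑ q, christoffel g p k j y * christoffel g q p i y * g y q l
        - ∑ p, ∑ q, christoffel g p k i y * christoffel g q p j y * g y q l := by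
    have e (i j : Fin n) : ∑ s, g y s l * ∑ p, christoffel g p k j y * christoffel g s p i y
        = ∑ p, ∑ q, christoffel g p k j y * christoffel g q p i y * g y q l := by
      simp only [Finset.mul_sum]
      rw [Finset.sum_comm]
      exact Finset.sum_congr rfl fun p _ => Finset.sum_congr rfl fun q _ => by ring
    simp only [riemannLo, riemannUp, mul_add, mul_sub, Finset.sum_add_distrib,
      Finset.sum_sub_distrib, e]
    simp only [mul_comm (g y _ l)]
  rw [hexp, hexp]
  simp only [Finset.sum_add_distrib] at hcomm
  linarith [hsw i j k l, hsw i j l k]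

end Riemann

section AlmostIsometry

open Filter Topology Asymptotics

variable {n : ℕ} {T S : EuclideanSpace ℝ (Fin n) → EuclideanSpace ℝ (Fin n)}

theorem norm_sub_le_of_fderiv_le
    (hT : ∀ ε > 0, ∀ᶠ x in 𝓝 0, DifferentiableAt ℝ T x ∧ ‖fderiv ℝ T x‖ ≤ 1 + ε * ‖x‖)
    {ε : ℝ} (hε : 0 < ε) : ∃ δ > 0, ∀ r, 0 < r → r < δ → ∀ x y, ‖x‖ ≤ r → ‖y‖ ≤ r →
      ‖T x - T y‖ ≤ (1 + ε * r) * ‖x - y‖ := by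
  obtain ⟨δ, hδ, h⟩ := Metric.eventually_nhds_iff_ball.1 (hT ε hε)
  refine ⟨δ, hδ, fun r hr hrδ x y hx hy => ?_⟩
  have hmem : ∀ w ∈ Metric.closedBall (0 : EuclideanSpace ℝ (Fin n)) r,
      w ∈ Metric.ball (0 : EuclideanSpace ℝ (Fin n)) δ := fun w hw =>
    Metric.closedBall_subset_ball hrδ hw
  refine (convex_closedBall (0 : EuclideanSpace ℝ (Fin n)) r).norm_image_sub_le_of_norm_fderiv_le
    (𝕜 := ℝ) (fun w hw => (h w (hmem w hw)).1) (fun w hw => (h w (hmem w hw)).2.trans ?_)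
    (by simpa using hy) (by simpa using hx)
  have : ‖w‖ ≤ r := by simpa using hw
  gcongr

theorem almost_isometry_sq
    (hT : ∀ ε > 0, ∀ᶠ x in 𝓝 0, DifferentiableAt ℝ T x ∧ ‖fderiv ℝ T x‖ ≤ 1 + ε * ‖x‖)
    (hS : ∀ ε > 0, ∀ᶠ x in 𝓝 0, DifferentiableAt ℝ S x ∧ ‖fderiv ℝ S x‖ ≤ 1 + ε * ‖x‖)
    (hT0 : T 0 = 0) (hST : ∀ᶠ x in 𝓝 0, S (T x) = x) {ε : ℝ} (hε : 0 < ε) :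
    ∃ δ > 0, ∀ r, 0 < r → r < δ → ∀ x y, ‖x‖ ≤ r → ‖y‖ ≤ r →
      |‖T x - T y‖ ^ 2 - ‖x - y‖ ^ 2| ≤ ε * r ^ 3 := by
  obtain ⟨δ₁, hδ₁, h₁⟩ := norm_sub_le_of_fderiv_le hT (ε := ε / 128) (by positivity)
  obtain ⟨δ₂, hδ₂, h₂⟩ := norm_sub_le_of_fderiv_le hS (ε := ε / 128) (by positivity)
  obtain ⟨δ₃, hδ₃, h₃⟩ := Metric.eventually_nhds_iff_ball.1 hST
  refine ⟨min (min δ₁ (δ₂ / 2)) (min δ₃ (1 / ε)), by positivity, fun r hr hrδ x y hx hy => ?_⟩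
  simp only [lt_min_iff] at hrδ
  obtain ⟨⟨hr₁, hr₂⟩, hr₃, hr₄⟩ := hrδ
  have hεr : ε * r ≤ 1 := by
    rw [lt_div_iff₀ hε] at hr₄
    linarith
  have hsmall : ∀ w, ‖w‖ ≤ r → ‖T w‖ ≤ 2 * r := by
    intro w hw
    have := h₁ r hr hr₁ w 0 hw (by simpa using hr.le)
    rw [hT0, sub_zero, sub_zero] at this
    nlinarith [norm_nonneg w]
  have ha := h₁ r hr hr₁ x y hx hy
  have hb := h₂ (2 * r) (by positivity) (by linarith) (T x) (T y) (hsmall x hx) (hsmall y hy)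
  rw [h₃ x (by simpa using hx.trans_lt hr₃), h₃ y (by simpa using hy.trans_lt hr₃)] at hb
  have hxy : ‖x - y‖ ≤ 2 * r := (norm_sub_le x y).trans (by linarith)
  have hTxy : ‖T x - T y‖ ≤ 4 * r :=
    (norm_sub_le _ _).trans (by linarith [hsmall x hx, hsmall y hy])
  have hεr0 : 0 < ε * r := by positivity
  generalize ‖T x - T y‖ = a at *
  generalize hbd : ‖x - y‖ = b at *
  have hb0 : 0 ≤ b := hbd ▸ norm_nonneg _
  have ha0 : 0 ≤ a := by
    by_contra! hneg
    have : (1 + ε / 128 * (2 * r)) * a < 0 := mul_neg_of_pos_of_neg (by positivity) hneg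
    linarith
  have ha2 : a ^ 2 ≤ (1 + ε / 128 * r) ^ 2 * b ^ 2 := by
    rw [← mul_pow]
    gcongr
  have hb2 : b ^ 2 ≤ (1 + ε / 128 * (2 * r)) ^ 2 * a ^ 2 := by
    rw [← mul_pow]
    gcongr
  have hb4 : ε * r * b ^ 2 ≤ ε * r * (2 * r) ^ 2 := by gcongr
  have ha4 : ε * r * a ^ 2 ≤ ε * r * (4 * r) ^ 2 := by gcongr
  have hb5 : (ε * r) ^ 2 * b ^ 2 ≤ ε * r * b ^ 2 := by
    gcongr
    nlinarith
  have ha5 : (ε * r) ^ 2 * a ^ 2 ≤ ε * r * a ^ 2 := by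
    gcongr
    nlinarith
  rw [abs_le]
  constructor <;> nlinarith

theorem almost_isometry_inner (hT0 : T 0 = 0) {ε r : ℝ} (hr : 0 ≤ r)
    (h : ∀ x y, ‖x‖ ≤ r → ‖y‖ ≤ r → |‖T x - T y‖ ^ 2 - ‖x - y‖ ^ 2| ≤ ε * r ^ 3)
    {x y : EuclideanSpace ℝ (Fin n)} (hx : ‖x‖ ≤ r) (hy : ‖y‖ ≤ r) :
    |inner ℝ (T x) (T y) - inner ℝ x y| ≤ 2 * (ε * r ^ 3) := by
  have h1 := h x y hx hy
  have h2 := h x 0 hx (by simpa using hr)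
  have h3 := h y 0 hy (by simpa using hr)
  rw [hT0, sub_zero, sub_zero] at h2 h3
  rw [norm_sub_sq_real, norm_sub_sq_real] at h1
  rw [abs_le] at *
  constructor <;> linarith [h1.1, h1.2, h2.1, h2.2, h3.1, h3.2]

theorem almost_isometry_midpoint
    (hT : ∀ ε > 0, ∀ᶠ x in 𝓝 0, DifferentiableAt ℝ T x ∧ ‖fderiv ℝ T x‖ ≤ 1 + ε * ‖x‖)
    (hS : ∀ ε > 0, ∀ᶠ x in 𝓝 0, DifferentiableAt ℝ S x ∧ ‖fderiv ℝ S x‖ ≤ 1 + ε * ‖x‖)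
    (hT0 : T 0 = 0) (hST : ∀ᶠ x in 𝓝 0, S (T x) = x)
    (hT1 : HasFDerivAt T (ContinuousLinearMap.id ℝ (EuclideanSpace ℝ (Fin n))) 0)
    {ε : ℝ} (hε : 0 < ε) :
    ∃ δ > 0, ∀ x, ‖x‖ < δ → ‖T x - (2 : ℝ) • T ((1 / 2 : ℝ) • x)‖ ≤ ε * ‖x‖ ^ 2 := by
  set κ : ℝ := ε / (12 * (n + 1)) with hκ
  have hκ0 : 0 < κ := by positivity
  obtain ⟨δ₁, hδ₁, h₁⟩ := almost_isometry_sq hT hS hT0 hST hκ0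
  set η : ℝ := 1 / (2 * (n + 1)) with hη
  have hη0 : 0 < η := by positivity
  have hlo := hT1.isLittleO.def hη0
  simp only [hT0, sub_zero, ContinuousLinearMap.id_apply] at hlo
  obtain ⟨δ₂, hδ₂, h₂⟩ := Metric.eventually_nhds_iff_ball.1 hlo
  refine ⟨min δ₁ δ₂, by positivity, fun x hx => ?_⟩
  rw [lt_min_iff] at hx
  rcases eq_or_ne x 0 with rfl | hx0
  · simp [hT0]
  set r := ‖x‖ with hr
  have hr0 : 0 < r := norm_pos_iff.2 hx0
  set w := T x - (2 : ℝ) • T ((1 / 2 : ℝ) • x) with hw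
  let e : Fin n → EuclideanSpace ℝ (Fin n) := fun i => EuclideanSpace.single i 1
  have he : ∀ i, ‖r • e i‖ = r := fun i => by simp [e, norm_smul, abs_of_pos hr0]
  have hinner := fun {u v : EuclideanSpace ℝ (Fin n)} (hu : ‖u‖ ≤ r) (hv : ‖v‖ ≤ r) =>
    almost_isometry_inner hT0 hr0.le (h₁ r hr0 hx.1) hu hv
  have hcoord : ∀ i, |w i| ≤ 6 * κ * r ^ 2 + η * ‖w‖ := by
    intro i
    have h3 := hinner (u := x) (v := r • e i) le_rfl (he i).le
    have h4 := hinner (u := (1 / 2 : ℝ) • x) (v := r • e i)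
      (by rw [norm_smul, ← hr]; norm_num; linarith) (he i).le
    have h5 : |inner ℝ w (T (r • e i))| ≤ 6 * κ * r ^ 3 := by
      rw [hw, inner_sub_left, inner_smul_left]
      rw [inner_smul_left] at h4
      simp only [conj_trivial] at *
      rw [abs_le] at *
      constructor <;> nlinarith [h3.1, h3.2, h4.1, h4.2]
    have h6 := h₂ (r • e i) (by simpa [he i] using hx.2)
    rw [he i] at h6
    have h7 : |inner ℝ w (T (r • e i) - r • e i)| ≤ ‖w‖ * (η * r) :=
      (abs_real_inner_le_norm _ _).trans (by gcongr)
    have h8 : inner ℝ w (r • e i) = r * w i := by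
      rw [inner_smul_right]
      simp [e, EuclideanSpace.inner_single_right]
    have h9 : r * |w i| ≤ 6 * κ * r ^ 3 + ‖w‖ * (η * r) := by
      rw [← abs_of_pos hr0, ← abs_mul, abs_of_pos hr0, ← h8]
      rw [inner_sub_right] at h7
      rw [abs_le] at *
      constructor <;> linarith [h5.1, h5.2, h7.1, h7.2]
    have h10 : r * |w i| ≤ r * (6 * κ * r ^ 2 + η * ‖w‖) := by linarith
    exact le_of_mul_le_mul_left h10 hr0
  have hsum : ‖w‖ ≤ ∑ i, |w i| := by
    conv_lhs => rw [← (EuclideanSpace.basisFun (Fin n) ℝ).sum_repr w]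
    refine (norm_sum_le _ _).trans (Finset.sum_le_sum fun i _ => ?_)
    simp [norm_smul]
  have hbound : ‖w‖ ≤ n * (6 * κ * r ^ 2 + η * ‖w‖) :=
    hsum.trans ((Finset.sum_le_sum fun i _ => hcoord i).trans (by simp [mul_add]))
  have hnη : n * η ≤ 1 / 2 := by
    rw [hη, mul_one_div, div_le_div_iff₀ (by positivity) (by positivity)]
    linarith
  have hnκ : n * (6 * κ) ≤ ε / 2 := by
    have : n * (6 * κ) = ε / 2 * (n / (n + 1)) := by
      rw [hκ]
      field_simp
      ring
    rw [this]
    have hle : (n : ℝ) / (n + 1) ≤ 1 := by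
      rw [div_le_one (by positivity)]
      linarith
    nlinarith
  nlinarith [norm_nonneg w, mul_le_mul_of_nonneg_right hnη (norm_nonneg w),
    mul_le_mul_of_nonneg_right hnκ (sq_nonneg r)]

/-- An invertible map which is isometric up to first order at the origin, and whose differential
there is the identity, agrees with the identity up to second order. -/
theorem almost_isometry_isLittleO
    (hT : ∀ ε > 0, ∀ᶠ x in 𝓝 0, DifferentiableAt ℝ T x ∧ ‖fderiv ℝ T x‖ ≤ 1 + ε * ‖x‖)
    (hS : ∀ ε > 0, ∀ᶠ x in 𝓝 0, DifferentiableAt ℝ S x ∧ ‖fderiv ℝ S x‖ ≤ 1 + ε * ‖x‖)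
    (hT0 : T 0 = 0) (hST : ∀ᶠ x in 𝓝 0, S (T x) = x)
    (hT1 : HasFDerivAt T (ContinuousLinearMap.id ℝ (EuclideanSpace ℝ (Fin n))) 0) :
    (fun x => T x - x) =o[𝓝 0] fun x => ‖x‖ ^ 2 := by
  refine IsLittleO.of_bound fun ε hε => ?_
  obtain ⟨δ, hδ, h⟩ := almost_isometry_midpoint hT hS hT0 hST hT1 (half_pos hε)
  rw [Metric.eventually_nhds_iff_ball]
  refine ⟨δ, hδ, fun x hx => ?_⟩
  have hx' : ‖x‖ < δ := by simpa using hx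
  have key : ∀ k : ℕ, ∀ x, ‖x‖ < δ →
      ‖T x - x‖ ≤ ε * ‖x‖ ^ 2 + 2 ^ k * ‖T ((1 / 2 : ℝ) ^ k • x) - (1 / 2 : ℝ) ^ k • x‖ := by
    intro k
    induction k with
    | zero =>
      intro x _
      simpa using by positivity
    | succ k ih =>
      intro x hx
      have hhalf : ‖(1 / 2 : ℝ) • x‖ = ‖x‖ / 2 := by
        rw [norm_smul]
        norm_num
        ring
      have h1 := ih ((1 / 2 : ℝ) • x) (by rw [hhalf]; linarith [norm_nonneg x])
      rw [hhalf, smul_smul, ← pow_succ] at h1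
      have h2 := h x hx
      have h3 : T x - x = (T x - (2 : ℝ) • T ((1 / 2 : ℝ) • x))
          + (2 : ℝ) • (T ((1 / 2 : ℝ) • x) - (1 / 2 : ℝ) • x) := by
        rw [smul_sub, smul_smul]
        norm_num
      rw [h3]
      refine (norm_add_le _ _).trans ?_
      rw [norm_smul (2 : ℝ), Real.norm_ofNat, pow_succ (2 : ℝ) k]
      nlinarith
  rw [Real.norm_of_nonneg (by positivity)]
  refine le_of_forall_pos_le_add fun η hη => ?_
  have hη' : 0 < η / (‖x‖ + 1) := by positivity
  have hlo := hT1.isLittleO.def hη'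
  simp only [hT0, sub_zero, ContinuousLinearMap.id_apply] at hlo
  have hlim : Tendsto (fun k : ℕ => (1 / 2 : ℝ) ^ k • x) atTop (𝓝 0) := by
    simpa using (tendsto_pow_atTop_nhds_zero_of_lt_one (r := (1 / 2 : ℝ))
      (by norm_num) (by norm_num)).smul_const x
  obtain ⟨k, hk⟩ := (hlim.eventually hlo).exists
  refine (key k x hx').trans ?_
  gcongr
  rw [norm_smul, norm_pow] at hk
  calc 2 ^ k * ‖T ((1 / 2 : ℝ) ^ k • x) - (1 / 2 : ℝ) ^ k • x‖
      ≤ 2 ^ k * (η / (‖x‖ + 1) * (‖(1 / 2 : ℝ)‖ ^ k * ‖x‖)) := by gcongr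
    _ = η * (‖x‖ / (‖x‖ + 1)) := by
        rw [Real.norm_of_nonneg (by norm_num), one_div, inv_pow]
        field_simp
    _ ≤ η * 1 := by
        gcongr
        rw [div_le_one (by positivity)]
        linarith
    _ = η := mul_one η

end AlmostIsometry

section Isometry

open Filter Topology Asymptotics

variable {n : ℕ}

/-- The bilinear form with matrix `G`. -/
def metricForm (G : Matrix (Fin n) (Fin n) ℝ) (a b : EuclideanSpace ℝ (Fin n)) : ℝ :=
  ∑ i, ∑ j, G i j * a i * b j

/-- The Christoffel symbols at `y`, as a vector-valued bilinear map. -/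
def christoffelForm (g : EuclideanSpace ℝ (Fin n) → Matrix (Fin n) (Fin n) ℝ)
    (y : EuclideanSpace ℝ (Fin n)) : EuclideanSpace ℝ (Fin n) →L[ℝ]
      EuclideanSpace ℝ (Fin n) →L[ℝ] EuclideanSpace ℝ (Fin n) :=
  ∑ j, ∑ k, (EuclideanSpace.proj j : EuclideanSpace ℝ (Fin n) →L[ℝ] ℝ).smulRight
    ((EuclideanSpace.proj k : EuclideanSpace ℝ (Fin n) →L[ℝ] ℝ).smulRight
      (WithLp.toLp 2 fun i => christoffel g i j k y))

variable {g g' : EuclideanSpace ℝ (Fin n) → Matrix (Fin n) (Fin n) ℝ}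
  {y₀ x₀ : EuclideanSpace ℝ (Fin n)}

theorem christoffelForm_apply (y a b : EuclideanSpace ℝ (Fin n)) (i : Fin n) :
    christoffelForm g y a b i = ∑ j, ∑ k, christoffel g i j k y * a j * b k := by
  simp only [christoffelForm, _root_.sum_apply, ContinuousLinearMap.smulRight_apply,
    _root_.smul_apply, WithLp.ofLp_sum, Finset.sum_apply, WithLp.ofLp_smul, Pi.smul_apply,
    smul_eq_mul, PiLp.proj_apply, EuclideanSpace.proj]
  refine Finset.sum_congr rfl fun j _ => Finset.sum_congr rfl fun k _ => ?_
  ring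

theorem metricForm_symm (hs : ∀ y i j, g y i j = g y j i) (y a b : EuclideanSpace ℝ (Fin n)) :
    metricForm (g y) a b = metricForm (g y) b a := by
  simp only [metricForm]
  rw [Finset.sum_comm]
  refine Finset.sum_congr rfl fun j _ => Finset.sum_congr rfl fun k _ => ?_
  rw [hs y k j]
  ring

theorem exists_inner_eq_metricForm {G : Matrix (Fin n) (Fin n) ℝ} (hs : ∀ i j, G i j = G j i)
    (hG : ∀ v : Fin n → ℝ, v ≠ 0 → 0 < ∑ i, ∑ j, G i j * v i * v j) :
    ∃ L : EuclideanSpace ℝ (Fin n) ≃L[ℝ] EuclideanSpace ℝ (Fin n),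
      ∀ a b, inner ℝ (L a) (L b) = metricForm G a b := by
  have hps : G.PosSemidef := by
    refine Matrix.PosSemidef.of_dotProduct_mulVec_nonneg ?_ fun v => ?_
    · ext i j
      simp [hs i j]
    · by_cases hv : v = 0
      · simp [hv]
      · have h := (hG v hv).le
        simp only [dotProduct, Matrix.mulVec, Finset.mul_sum, Pi.star_apply, star_trivial]
        refine h.trans_eq (Finset.sum_congr rfl fun i _ => Finset.sum_congr rfl fun j _ => ?_)
        ring
  obtain ⟨B, rfl⟩ : ∃ B : Matrix (Fin n) (Fin n) ℝ, G = B.conjTranspose * B := by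
    open scoped MatrixOrder Matrix.Norms.L2Operator in
    exact CStarAlgebra.nonneg_iff_eq_star_mul_self.mp hps.nonneg
  set l : EuclideanSpace ℝ (Fin n) →ₗ[ℝ] EuclideanSpace ℝ (Fin n) := Matrix.toEuclideanLin B
  have hl : ∀ a b, inner ℝ (l a) (l b) = metricForm (B.conjTranspose * B) a b := by
    intro a b
    simp only [l, metricForm, PiLp.inner_apply, Matrix.toEuclideanLin, Matrix.toLpLin_apply, Matrix.mulVec,
      dotProduct, Matrix.mul_apply, Matrix.conjTranspose_apply, star_trivial, Finset.sum_mul,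
      RCLike.inner_apply, conj_trivial, Finset.mul_sum]
    rw [Finset.sum_comm' (t' := Finset.univ) (s' := fun _ => Finset.univ) (by simp)]
    refine Finset.sum_congr rfl fun j _ => ?_
    rw [Finset.sum_comm]
    refine Finset.sum_congr rfl fun k _ => Finset.sum_congr rfl fun i _ => ?_
    ring
  have hinj : Function.Injective l := by
    rw [injective_iff_map_eq_zero]
    intro a ha
    by_contra hne
    have h := hG a.ofLp (by simpa using hne)
    have h2 := hl a a
    rw [ha, inner_zero_left, metricForm] at h2
    exact h.ne h2
  exact ⟨(LinearEquiv.ofInjectiveEndo l hinj).toContinuousLinearEquiv, fun a b => hl a b⟩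

/-- A map whose derivatives are isometric to first order at `y₀` for the metric `g`. -/
def IsAdaptedAt (g : EuclideanSpace ℝ (Fin n) → Matrix (Fin n) (Fin n) ℝ)
    (y₀ : EuclideanSpace ℝ (Fin n)) (ψ : EuclideanSpace ℝ (Fin n) → EuclideanSpace ℝ (Fin n)) :
    Prop :=
  ∀ ε > 0, ∀ᶠ y in 𝓝 y₀, DifferentiableAt ℝ ψ y ∧ ∀ a,
    |‖fderiv ℝ ψ y a‖ ^ 2 - metricForm (g y) a a| ≤ ε * ‖y - y₀‖ * ‖fderiv ℝ ψ y a‖ ^ 2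

/-- The quadratic change of coordinates which makes a metric Euclidean to first order. -/
def adaptedCoord (g : EuclideanSpace ℝ (Fin n) → Matrix (Fin n) (Fin n) ℝ)
    (y₀ : EuclideanSpace ℝ (Fin n)) (L : EuclideanSpace ℝ (Fin n) ≃L[ℝ] EuclideanSpace ℝ (Fin n))
    (y : EuclideanSpace ℝ (Fin n)) : EuclideanSpace ℝ (Fin n) :=
  L (y - y₀ + (1 / 2 : ℝ) • christoffelForm g y₀ (y - y₀) (y - y₀))

theorem christoffelForm_symm (hs : ∀ y i j, g y i j = g y j i)
    (y a b : EuclideanSpace ℝ (Fin n)) :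
    christoffelForm g y a b = christoffelForm g y b a := by
  ext i
  rw [christoffelForm_apply, christoffelForm_apply, Finset.sum_comm]
  refine Finset.sum_congr rfl fun j _ => Finset.sum_congr rfl fun k _ => ?_
  rw [christoffel_symm hs]
  ring

theorem hasFDerivAt_adaptedCoord (hs : ∀ y i j, g y i j = g y j i)
    (L : EuclideanSpace ℝ (Fin n) ≃L[ℝ] EuclideanSpace ℝ (Fin n))
    (y : EuclideanSpace ℝ (Fin n)) :
    HasFDerivAt (adaptedCoord g y₀ L) ((L : EuclideanSpace ℝ (Fin n) →L[ℝ]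
      EuclideanSpace ℝ (Fin n)).comp
      (ContinuousLinearMap.id ℝ _ + christoffelForm g y₀ (y - y₀))) y := by
  have h0 : HasFDerivAt (fun y => y - y₀) (ContinuousLinearMap.id ℝ _) y :=
    (hasFDerivAt_id y).sub_const y₀
  have h1 := (christoffelForm g y₀).hasFDerivAt_of_bilinear h0 h0
  have h2 := (L : EuclideanSpace ℝ (Fin n) →L[ℝ] EuclideanSpace ℝ (Fin n)).hasFDerivAt.comp y
    (h0.add (h1.const_smul (1 / 2 : ℝ)))
  refine h2.congr_fderiv ?_
  ext1 a
  simp [ContinuousLinearMap.precompR, ContinuousLinearMap.precompL,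
    christoffelForm_symm hs y₀ a, ← add_smul]
  module

theorem contDiff_adaptedCoord
    (L : EuclideanSpace ℝ (Fin n) ≃L[ℝ] EuclideanSpace ℝ (Fin n)) {k : WithTop ℕ∞} :
    ContDiff ℝ k (adaptedCoord g y₀ L) := by
  have h0 : ContDiff ℝ k (fun y => y - y₀) := contDiff_id.sub contDiff_const
  exact L.contDiff.comp (h0.add ((((christoffelForm g y₀).contDiff.comp h0).clm_apply
    h0).const_smul (1 / 2 : ℝ)))

end Isometry
section Isometry

open Filter Topology Asymptotics

variable {n : ℕ} {g g' : EuclideanSpace ℝ (Fin n) → Matrix (Fin n) (Fin n) ℝ}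
  {y₀ x₀ : EuclideanSpace ℝ (Fin n)}

theorem metricForm_single_left (G : Matrix (Fin n) (Fin n) ℝ) (i : Fin n)
    (b : EuclideanSpace ℝ (Fin n)) :
    metricForm G (EuclideanSpace.single i 1) b = ∑ j, G i j * b j := by
  rw [metricForm, Finset.sum_eq_single i]
  · simp
  · intro j _ hj
    simp [hj]
  · simp

theorem christoffelForm_single_right (y a : EuclideanSpace ℝ (Fin n)) (j i : Fin n) :
    christoffelForm g y a (EuclideanSpace.single j 1) i = ∑ k, christoffel g i k j y * a k := by
  rw [christoffelForm_apply]
  refine Finset.sum_congr rfl fun k _ => ?_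
  rw [Finset.sum_eq_single j]
  · simp
  · intro l _ hl
    simp [hl]
  · simp

theorem metricForm_christoffelForm (hs : ∀ y i j, g y i j = g y j i)
    (hdet : IsUnit (g y₀).det) (w : EuclideanSpace ℝ (Fin n)) (i j : Fin n) :
    metricForm (g y₀) (EuclideanSpace.single i 1)
        (christoffelForm g y₀ w (EuclideanSpace.single j 1))
      + metricForm (g y₀) (EuclideanSpace.single j 1)
        (christoffelForm g y₀ w (EuclideanSpace.single i 1))
      = fderiv ℝ (fun y => g y i j) y₀ w := by
  rw [clm_eq_sum_single (fderiv ℝ (fun y => g y i j) y₀)]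
  simp only [metricForm_single_left, christoffelForm_single_right, smul_eq_mul]
  have h : ∀ k, (fderiv ℝ (fun y => g y i j) y₀) (EuclideanSpace.single k 1)
      = ∑ p, christoffel g p i k y₀ * g y₀ p j + ∑ p, christoffel g p j k y₀ * g y₀ p i :=
    fun k => rDeriv_metric hs hdet k i j
  simp only [h, mul_add, Finset.sum_add_distrib, Finset.mul_sum]
  rw [add_comm, Finset.sum_comm, Finset.sum_comm (γ := Fin n)
    (f := fun q k => g y₀ i q * (christoffel g q k j y₀ * w k))]
  congr 1 <;>
  · refine Finset.sum_congr rfl fun k _ => Finset.sum_congr rfl fun p _ => ?_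
    rw [christoffel_symm hs p, hs _ p]
    ring

theorem isAdaptedAt_of_hasFDerivAt {ψ : EuclideanSpace ℝ (Fin n) → EuclideanSpace ℝ (Fin n)}
    (hψ : ∀ᶠ y in 𝓝 y₀, DifferentiableAt ℝ ψ y)
    (hK : ∃ K, ∀ᶠ y in 𝓝 y₀, ∀ a, ‖a‖ ^ 2 ≤ K * ‖fderiv ℝ ψ y a‖ ^ 2)
    (h0 : ∀ i j, inner ℝ (fderiv ℝ ψ y₀ (EuclideanSpace.single i 1))
      (fderiv ℝ ψ y₀ (EuclideanSpace.single j 1)) = g y₀ i j)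
    (h1 : ∀ i j, HasFDerivAt (fun y => inner ℝ (fderiv ℝ ψ y (EuclideanSpace.single i 1))
      (fderiv ℝ ψ y (EuclideanSpace.single j 1)) - g y i j)
      (0 : EuclideanSpace ℝ (Fin n) →L[ℝ] ℝ) y₀) :
    IsAdaptedAt g y₀ ψ := by
  obtain ⟨K, hK⟩ := hK
  intro ε hε
  set K' : ℝ := max K 0 + 1
  have hK' : 0 < K' := by positivity
  set δ : ℝ := ε / ((n : ℝ) ^ 2 + 1) / K'
  have hδ : 0 < δ := by positivity
  have h2 : ∀ i j, ∀ᶠ y in 𝓝 y₀, |inner ℝ (fderiv ℝ ψ y (EuclideanSpace.single i 1))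
      (fderiv ℝ ψ y (EuclideanSpace.single j 1)) - g y i j| ≤ δ * ‖y - y₀‖ := by
    intro i j
    have h := (h1 i j).isLittleO.def hδ
    simpa [h0 i j] using h
  have h3 := eventually_all.2 fun i => eventually_all.2 (h2 i)
  filter_upwards [hψ, hK, h3] with y hy hKy h3y
  refine ⟨hy, fun a => ?_⟩
  have hexp : ‖fderiv ℝ ψ y a‖ ^ 2 - metricForm (g y) a a
      = ∑ i, ∑ j, (inner ℝ (fderiv ℝ ψ y (EuclideanSpace.single i 1))
      (fderiv ℝ ψ y (EuclideanSpace.single j 1)) - g y i j) * (a i * a j) := by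
    rw [← real_inner_self_eq_norm_sq, clm_eq_sum_single, metricForm]
    simp only [sum_inner, inner_sum, inner_smul_left, inner_smul_right, conj_trivial,
      Finset.mul_sum, ← Finset.sum_sub_distrib]
    refine Finset.sum_congr rfl fun k _ => Finset.sum_congr rfl fun p _ => ?_
    rw [real_inner_comm]
    ring
  have ha : ∀ i, |a i| ≤ ‖a‖ := fun i => PiLp.norm_apply_le a i
  rw [hexp]
  calc _ ≤ ∑ _i : Fin n, ∑ _j : Fin n, δ * ‖y - y₀‖ * (‖a‖ * ‖a‖) := by
        refine (Finset.abs_sum_le_sum_abs _ _).trans (Finset.sum_le_sum fun i _ => ?_)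
        refine (Finset.abs_sum_le_sum_abs _ _).trans (Finset.sum_le_sum fun j _ => ?_)
        rw [abs_mul, abs_mul]
        exact mul_le_mul (h3y i j) (mul_le_mul (ha i) (ha j) (abs_nonneg _) (norm_nonneg _))
          (by positivity) (by positivity)
    _ = (n : ℝ) ^ 2 * δ * ‖y - y₀‖ * ‖a‖ ^ 2 := by
        simp
        ring
    _ ≤ (n : ℝ) ^ 2 * δ * ‖y - y₀‖ * (K' * ‖fderiv ℝ ψ y a‖ ^ 2) := by
        refine mul_le_mul_of_nonneg_left ((hKy a).trans ?_) (by positivity)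
        gcongr
        exact (le_max_left K 0).trans (by simp [K'])
    _ = ((n : ℝ) ^ 2 * δ * K') * (‖y - y₀‖ * ‖fderiv ℝ ψ y a‖ ^ 2) := by ring
    _ ≤ ε * (‖y - y₀‖ * ‖fderiv ℝ ψ y a‖ ^ 2) := by
        gcongr
        simp only [δ]
        field_simp
        simp
    _ = _ := by ring

theorem isAdaptedAt_adaptedCoord (hs : ∀ y i j, g y i j = g y j i)
    (hg : ∀ i j, DifferentiableAt ℝ (fun y => g y i j) y₀) (hdet : IsUnit (g y₀).det)
    {L : EuclideanSpace ℝ (Fin n) ≃L[ℝ] EuclideanSpace ℝ (Fin n)}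
    (hL : ∀ a b, inner ℝ (L a) (L b) = metricForm (g y₀) a b) :
    IsAdaptedAt g y₀ (adaptedCoord g y₀ L) := by
  have hD : ∀ y a, fderiv ℝ (adaptedCoord g y₀ L) y a = L (a + christoffelForm g y₀ (y - y₀) a) :=
    fun y a => by simp [(hasFDerivAt_adaptedCoord (y₀ := y₀) hs L y).fderiv]
  refine isAdaptedAt_of_hasFDerivAt
    (Eventually.of_forall fun y => (hasFDerivAt_adaptedCoord hs L y).differentiableAt) ?_ ?_ ?_
  · set C := ‖(L.symm : EuclideanSpace ℝ (Fin n) →L[ℝ] EuclideanSpace ℝ (Fin n))‖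
    refine ⟨4 * C ^ 2, ?_⟩
    have hc : Tendsto (fun y => ‖christoffelForm g y₀ (y - y₀)‖) (𝓝 y₀) (𝓝 0) := by
      have : ContinuousAt (fun y => ‖christoffelForm g y₀ (y - y₀)‖) y₀ := by fun_prop
      simpa [ContinuousAt] using this
    filter_upwards [hc.eventually_le_const (show (0 : ℝ) < 1 / 2 by norm_num)] with y hy a
    have h1 : ‖a + christoffelForm g y₀ (y - y₀) a‖ ≤ C * ‖fderiv ℝ (adaptedCoord g y₀ L) y a‖ := by
      rw [hD]
      simpa using (L.symm : EuclideanSpace ℝ (Fin n) →L[ℝ] EuclideanSpace ℝ (Fin n)).le_opNorm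
        (L (a + christoffelForm g y₀ (y - y₀) a))
    have h2 : ‖christoffelForm g y₀ (y - y₀) a‖ ≤ 1 / 2 * ‖a‖ :=
      ((christoffelForm g y₀ (y - y₀)).le_opNorm a).trans (by gcongr)
    have h3 : ‖a‖ ≤ ‖a + christoffelForm g y₀ (y - y₀) a‖ + ‖christoffelForm g y₀ (y - y₀) a‖ := by
      simpa using norm_sub_le (a + christoffelForm g y₀ (y - y₀) a)
        (christoffelForm g y₀ (y - y₀) a)
    have h4 : ‖a‖ ≤ 2 * (C * ‖fderiv ℝ (adaptedCoord g y₀ L) y a‖) := by linarith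
    calc ‖a‖ ^ 2 ≤ (2 * (C * ‖fderiv ℝ (adaptedCoord g y₀ L) y a‖)) ^ 2 := by gcongr
      _ = _ := by ring
  · intro i j
    rw [hD, hD, sub_self]
    simp [hL, metricForm_single_left]
  · intro i j
    simp only [hD]
    have h (i : Fin n) : HasFDerivAt (fun y => L (EuclideanSpace.single i 1 +
        christoffelForm g y₀ (y - y₀) (EuclideanSpace.single i 1)))
        ((L : EuclideanSpace ℝ (Fin n) →L[ℝ] EuclideanSpace ℝ (Fin n)).comp
          ((christoffelForm g y₀).flip (EuclideanSpace.single i 1))) y₀ := by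
      have h1 : HasFDerivAt (fun y => christoffelForm g y₀ (y - y₀) (EuclideanSpace.single i 1))
          ((christoffelForm g y₀).flip (EuclideanSpace.single i 1)) y₀ :=
        ((christoffelForm g y₀).flip (EuclideanSpace.single i 1)).hasFDerivAt.comp y₀
          ((hasFDerivAt_id y₀).sub_const y₀)
      exact (L : EuclideanSpace ℝ (Fin n) →L[ℝ] EuclideanSpace ℝ (Fin n)).hasFDerivAt.comp y₀
        (h1.const_add _)
    refine (((h i).inner ℝ (h j)).sub (hg i j).hasFDerivAt).congr_fderiv ?_
    ext1 w
    have := metricForm_christoffelForm (y₀ := y₀) hs hdet w i j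
    simp [fderivInnerCLM_apply, hL, ← this]
    rw [metricForm_symm hs y₀ (EuclideanSpace.single j 1)]
    ring

end Isometry
section Isometry

open Filter Topology Asymptotics

variable {n : ℕ} {g g' : EuclideanSpace ℝ (Fin n) → Matrix (Fin n) (Fin n) ℝ}
  {y₀ x₀ : EuclideanSpace ℝ (Fin n)}

theorem IsAdaptedAt.norm_fderiv_comp_le
    {ψ ψ' μ θ : EuclideanSpace ℝ (Fin n) → EuclideanSpace ℝ (Fin n)}
    (hψ : IsAdaptedAt g y₀ ψ) (hψ' : IsAdaptedAt g' x₀ ψ') (hμ : ContDiffAt ℝ 1 μ 0)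
    (hμ0 : μ 0 = y₀) (hψμ : ∀ᶠ x in 𝓝 0, ψ (μ x) = x) (hθ0 : θ y₀ = x₀)
    (hθ : ∀ᶠ y in 𝓝 y₀, DifferentiableAt ℝ θ y ∧
      ∀ a, metricForm (g y) a a = metricForm (g' (θ y)) (fderiv ℝ θ y a) (fderiv ℝ θ y a)) :
    ∀ ε > 0, ∀ᶠ x in 𝓝 0, DifferentiableAt ℝ (fun x => ψ' (θ (μ x))) x ∧
      ‖fderiv ℝ (fun x => ψ' (θ (μ x))) x‖ ≤ 1 + ε * ‖x‖ := by
  intro ε hε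
  have hμd : ∀ᶠ x in 𝓝 0, DifferentiableAt ℝ μ x :=
    (hμ.eventually (by simp)).mono fun x hx => hx.differentiableAt (by simp)
  have hμc : Tendsto μ (𝓝 0) (𝓝 y₀) := hμ0 ▸ hμ.continuousAt
  have hθd : DifferentiableAt ℝ θ y₀ := hθ.self_of_nhds.1
  have hθc : Tendsto (fun x => θ (μ x)) (𝓝 0) (𝓝 x₀) := by
    have : Tendsto θ (𝓝 y₀) (𝓝 x₀) := hθ0 ▸ hθd.continuousAt
    exact this.comp hμc
  obtain ⟨K, hK1, hK⟩ : ∃ K : ℝ, 0 < K ∧ ∀ᶠ x in 𝓝 (0 : EuclideanSpace ℝ (Fin n)),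
      ‖μ x - y₀‖ ≤ K * ‖x‖ ∧ ‖θ (μ x) - x₀‖ ≤ K * ‖x‖ := by
    have hd1 : (fun x => μ x - y₀) =O[𝓝 0] fun x => x := by
      simpa [hμ0] using (hμ.differentiableAt (by simp)).isBigO_sub
    have hd2 : (fun x => θ (μ x) - x₀) =O[𝓝 0] fun x => x := by
      have := DifferentiableAt.comp (g := θ) (0 : EuclideanSpace ℝ (Fin n)) (hμ0 ▸ hθd)
        (hμ.differentiableAt (by simp))
      simpa [hμ0, hθ0] using this.isBigO_sub
    obtain ⟨K₁, hK₁, h₁⟩ := hd1.exists_pos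
    obtain ⟨K₂, hK₂, h₂⟩ := hd2.exists_pos
    refine ⟨max K₁ K₂, lt_max_of_lt_left hK₁, ?_⟩
    filter_upwards [h₁.bound, h₂.bound] with x hx₁ hx₂
    exact ⟨hx₁.trans (by gcongr; exact le_max_left _ _),
      hx₂.trans (by gcongr; exact le_max_right _ _)⟩
  have hη : 0 < ε / (8 * K) := by positivity
  have hsmall : ∀ᶠ x in 𝓝 (0 : EuclideanSpace ℝ (Fin n)), ε * ‖x‖ ≤ 6 := by
    have : ContinuousAt (fun x : EuclideanSpace ℝ (Fin n) => ε * ‖x‖) 0 := by fun_prop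
    refine this.tendsto.eventually_le_const ?_
    simp
  filter_upwards [hμd, hK, hψμ.eventually_nhds, hμc.eventually hθ, hμc.eventually (hψ _ hη),
    hθc.eventually (hψ' _ hη), hsmall] with x hμx ⟨hK1x, hK2x⟩ hψμx ⟨hθx, hmx⟩ ⟨hψx, hex⟩
    ⟨hψ'x, hex'⟩ hsx
  have hT : HasFDerivAt (fun x => ψ' (θ (μ x))) _ x :=
    hψ'x.hasFDerivAt.comp x (hθx.hasFDerivAt.comp x hμx.hasFDerivAt)
  refine ⟨hT.differentiableAt, ?_⟩
  rw [hT.fderiv]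
  refine ContinuousLinearMap.opNorm_le_bound _ (by positivity) fun a => ?_
  have hid : ∀ a, fderiv ℝ ψ (μ x) (fderiv ℝ μ x a) = a := by
    have h1 : HasFDerivAt (fun x => ψ (μ x)) _ x := hψx.hasFDerivAt.comp x hμx.hasFDerivAt
    have h2 : HasFDerivAt (fun x => ψ (μ x)) (ContinuousLinearMap.id ℝ _) x :=
      (hasFDerivAt_id x).congr_of_eventuallyEq hψμx
    intro a
    exact congrArg (fun l => l a) (h1.unique h2)
  have he := hex (fderiv ℝ μ x a)
  have he' := hex' (fderiv ℝ θ (μ x) (fderiv ℝ μ x a))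
  rw [hid, hmx] at he
  simp only [ContinuousLinearMap.comp_apply]
  set P := ‖fderiv ℝ ψ' (θ (μ x)) (fderiv ℝ θ (μ x) (fderiv ℝ μ x a))‖
  set Q := metricForm (g' (θ (μ x))) (fderiv ℝ θ (μ x) (fderiv ℝ μ x a))
    (fderiv ℝ θ (μ x) (fderiv ℝ μ x a))
  have hs1 : ε / (8 * K) * ‖μ x - y₀‖ ≤ ε * ‖x‖ / 8 := by
    calc _ ≤ ε / (8 * K) * (K * ‖x‖) := by gcongr
      _ = _ := by field_simp
  have hs2 : ε / (8 * K) * ‖θ (μ x) - x₀‖ ≤ ε * ‖x‖ / 8 := by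
    calc _ ≤ ε / (8 * K) * (K * ‖x‖) := by gcongr
      _ = _ := by field_simp
  have hs0 : 0 ≤ ε * ‖x‖ := by positivity
  have hb1 : Q ≤ (1 + ε * ‖x‖ / 8) * ‖a‖ ^ 2 := by
    have := (abs_le.1 he).1
    have h2 := mul_le_mul_of_nonneg_right hs1 (sq_nonneg ‖a‖)
    linarith
  have hb2 : P ^ 2 - Q ≤ ε * ‖x‖ / 8 * P ^ 2 := by
    have := (abs_le.1 he').2
    have h2 := mul_le_mul_of_nonneg_right hs2 (sq_nonneg P)
    linarith
  refine le_of_sq_le_sq ?_ (by positivity)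
  set s := ε * ‖x‖
  have hb3 : (1 - s / 8) * P ^ 2 ≤ (1 - s / 8) * ((1 + s) * ‖a‖) ^ 2 := by
    have h3 : (1 + s / 8) * ‖a‖ ^ 2 ≤ (1 - s / 8) * ((1 + s) * ‖a‖) ^ 2 := by
      rw [mul_pow, ← mul_assoc]
      refine mul_le_mul_of_nonneg_right ?_ (sq_nonneg _)
      nlinarith [mul_nonneg hs0 (by linarith : (0 : ℝ) ≤ 6 - s),
        mul_nonneg hs0 (mul_nonneg hs0 (by linarith : (0 : ℝ) ≤ 6 - s))]
    linarith
  exact le_of_mul_le_mul_left hb3 (by linarith)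

/-- An isometry between two Riemannian metrics is determined to second order by its derivative. -/
theorem isometry_expansion (hs : ∀ y i j, g y i j = g y j i) (hs' : ∀ y i j, g' y i j = g' y j i)
    (hg : ∀ i j, DifferentiableAt ℝ (fun y => g y i j) y₀)
    (hg' : ∀ i j, DifferentiableAt ℝ (fun y => g' y i j) x₀)
    (hpos : ∀ v : Fin n → ℝ, v ≠ 0 → 0 < ∑ i, ∑ j, g y₀ i j * v i * v j)
    (hdet : IsUnit (g y₀).det) (hdet' : IsUnit (g' x₀).det)
    {θ θ' : EuclideanSpace ℝ (Fin n) → EuclideanSpace ℝ (Fin n)}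
    (hθ0 : θ y₀ = x₀) (hθ'0 : θ' x₀ = y₀)
    (hθ : ∀ᶠ y in 𝓝 y₀, DifferentiableAt ℝ θ y ∧
      ∀ a, metricForm (g y) a a = metricForm (g' (θ y)) (fderiv ℝ θ y a) (fderiv ℝ θ y a))
    (hθ' : ∀ᶠ x in 𝓝 x₀, DifferentiableAt ℝ θ' x ∧
      ∀ a, metricForm (g' x) a a = metricForm (g (θ' x)) (fderiv ℝ θ' x a) (fderiv ℝ θ' x a))
    (hinv : ∀ᶠ y in 𝓝 y₀, θ' (θ y) = y) (hinv' : ∀ᶠ x in 𝓝 x₀, θ (θ' x) = x) :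
    Function.Injective (fderiv ℝ θ y₀) ∧
    (fun y => θ y - x₀ + (1 / 2 : ℝ) • christoffelForm g' x₀ (θ y - x₀) (θ y - x₀)
      - fderiv ℝ θ y₀ (y - y₀ + (1 / 2 : ℝ) • christoffelForm g y₀ (y - y₀) (y - y₀)))
      =o[𝓝 y₀] fun y => ‖y - y₀‖ ^ 2 := by
  have hθd := hθ.self_of_nhds.1.hasFDerivAt
  have hθ'd := hθ'.self_of_nhds.1.hasFDerivAt
  have hc1 : (fderiv ℝ θ' x₀).comp (fderiv ℝ θ y₀) = ContinuousLinearMap.id ℝ _ :=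
    HasFDerivAt.unique (f := fun y => θ' (θ y))
      ((hθ0 ▸ hθ'd : HasFDerivAt θ' (fderiv ℝ θ' x₀) (θ y₀)).comp y₀ hθd)
      ((hasFDerivAt_id y₀).congr_of_eventuallyEq hinv)
  have hc2 : (fderiv ℝ θ y₀).comp (fderiv ℝ θ' x₀) = ContinuousLinearMap.id ℝ _ :=
    HasFDerivAt.unique (f := fun y => θ (θ' y))
      ((hθ'0 ▸ hθd : HasFDerivAt θ (fderiv ℝ θ y₀) (θ' x₀)).comp x₀ hθ'd)
      ((hasFDerivAt_id x₀).congr_of_eventuallyEq hinv')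
  set A : EuclideanSpace ℝ (Fin n) ≃L[ℝ] EuclideanSpace ℝ (Fin n) :=
    ContinuousLinearEquiv.equivOfInverse (fderiv ℝ θ y₀) (fderiv ℝ θ' x₀)
      (fun a => congrArg (fun l => l a) hc1) (fun a => congrArg (fun l => l a) hc2)
  have hA : ∀ a, A a = fderiv ℝ θ y₀ a := fun a => rfl
  refine ⟨A.injective, ?_⟩
  obtain ⟨L, hL⟩ := exists_inner_eq_metricForm (hs y₀) hpos
  set L' := A.symm.trans L
  have hL' : ∀ a b, inner ℝ (L' a) (L' b) = metricForm (g' x₀) a b := by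
    have hadd (G : Matrix (Fin n) (Fin n) ℝ) (hG : ∀ i j, G i j = G j i)
        (a b : EuclideanSpace ℝ (Fin n)) : metricForm G a b
        = (metricForm G (a + b) (a + b) - metricForm G a a - metricForm G b b) / 2 := by
      have h1 : metricForm G b a = metricForm G a b :=
        metricForm_symm (g := fun _ => G) (fun _ => hG) 0 b a
      have h2 : metricForm G (a + b) (a + b)
          = metricForm G a a + metricForm G a b + metricForm G b a + metricForm G b b := by
        simp only [metricForm, ← Finset.sum_add_distrib]
        refine Finset.sum_congr rfl fun i _ => Finset.sum_congr rfl fun j _ => ?_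
        simp only [PiLp.add_apply]
        ring
      rw [h2, h1]
      ring
    have hd (a : EuclideanSpace ℝ (Fin n)) :
        metricForm (g y₀) (A.symm a) (A.symm a) = metricForm (g' x₀) a a := by
      rw [hθ.self_of_nhds.2, hθ0, ← hA, A.apply_symm_apply]
    intro a b
    change inner ℝ (L (A.symm a)) (L (A.symm b)) = _
    rw [hL, hadd _ (hs y₀), hadd _ (hs' x₀), ← map_add, hd, hd, hd]
  have hψ := isAdaptedAt_adaptedCoord hs hg hdet hL
  have hψ' := isAdaptedAt_adaptedCoord hs' hg' hdet' hL'
  have hloc (g : EuclideanSpace ℝ (Fin n) → Matrix (Fin n) (Fin n) ℝ)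
      (hs : ∀ y i j, g y i j = g y j i) (y₀ : EuclideanSpace ℝ (Fin n))
      (L : EuclideanSpace ℝ (Fin n) ≃L[ℝ] EuclideanSpace ℝ (Fin n)) :
      ∃ μ : EuclideanSpace ℝ (Fin n) → EuclideanSpace ℝ (Fin n), ContDiffAt ℝ 1 μ 0 ∧ μ 0 = y₀ ∧
        (∀ᶠ x in 𝓝 0, adaptedCoord g y₀ L (μ x) = x) ∧
        (∀ᶠ y in 𝓝 y₀, μ (adaptedCoord g y₀ L y) = y) ∧
        HasFDerivAt μ (L.symm : EuclideanSpace ℝ (Fin n) →L[ℝ] EuclideanSpace ℝ (Fin n)) 0 := by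
    have h0 : adaptedCoord g y₀ L y₀ = 0 := by simp [adaptedCoord]
    have hd : HasFDerivAt (adaptedCoord g y₀ L)
        (L : EuclideanSpace ℝ (Fin n) →L[ℝ] EuclideanSpace ℝ (Fin n)) y₀ := by
      refine (hasFDerivAt_adaptedCoord hs L y₀).congr_fderiv ?_
      ext1 a
      simp
    have hcd : ContDiffAt ℝ 1 (adaptedCoord g y₀ L) y₀ := (contDiff_adaptedCoord L).contDiffAt
    have hsd := hcd.hasStrictFDerivAt' hd (by simp)
    refine ⟨hcd.localInverse hd (by simp), ?_, ?_, ?_, ?_, ?_⟩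
    · simpa [h0] using hcd.to_localInverse hd (by simp)
    · simpa [h0] using hcd.localInverse_apply_image hd (by simp)
    · have h := hsd.eventually_right_inverse
      rw [h0] at h
      exact h
    · exact hsd.eventually_left_inverse
    · have h := hsd.to_localInverse.hasFDerivAt
      rw [h0] at h
      exact h
  obtain ⟨μ, hμ, hμ0, hr, hl, hμd⟩ := hloc g hs y₀ L
  obtain ⟨μ', hμ', hμ'0, hr', hl', hμ'd⟩ := hloc g' hs' x₀ L'
  have hψc : Tendsto (adaptedCoord g y₀ L) (𝓝 y₀) (𝓝 0) := by
    have : ContinuousAt (adaptedCoord g y₀ L) y₀ :=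
      (contDiff_adaptedCoord (k := 0) L).continuous.continuousAt
    simpa [ContinuousAt, adaptedCoord] using this
  have hμc : Tendsto μ (𝓝 0) (𝓝 y₀) := hμ0 ▸ hμ.continuousAt
  have hθc : Tendsto θ (𝓝 y₀) (𝓝 x₀) := hθ0 ▸ hθd.continuousAt
  have hT1 : HasFDerivAt (fun x => adaptedCoord g' x₀ L' (θ (μ x)))
      (ContinuousLinearMap.id ℝ (EuclideanSpace ℝ (Fin n))) 0 := by
    have h1 : HasFDerivAt (fun x => θ (μ x)) _ 0 :=
      HasFDerivAt.comp (g := θ) (0 : EuclideanSpace ℝ (Fin n)) (hμ0.symm ▸ hθd) hμd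
    have h2 : HasFDerivAt (adaptedCoord g' x₀ L') _ (θ (μ 0)) :=
      hasFDerivAt_adaptedCoord (y₀ := x₀) hs' L' (θ (μ 0))
    refine (h2.comp 0 h1).congr_fderiv ?_
    ext1 a
    simp [hμ0, hθ0, L', ← hA]
  have key := almost_isometry_isLittleO
    (T := fun x => adaptedCoord g' x₀ L' (θ (μ x)))
    (S := fun x => adaptedCoord g y₀ L (θ' (μ' x)))
    (hψ.norm_fderiv_comp_le hψ' hμ hμ0 hr hθ0 hθ)
    (hψ'.norm_fderiv_comp_le hψ hμ' hμ'0 hr' hθ'0 hθ')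
    (by simp [hμ0, hθ0, adaptedCoord])
    (by
      filter_upwards [hμc.eventually (hθc.eventually hl'), hμc.eventually hinv, hr]
        with x h1 h2 h3
      rw [h1, h2, h3])
    hT1
  have key2 := (key.comp_tendsto hψc).trans_isBigO (k := fun y => ‖y - y₀‖ ^ 2) (by
    have : (adaptedCoord g y₀ L) =O[𝓝 y₀] fun y => y - y₀ := by
      have h := (hasFDerivAt_adaptedCoord (y₀ := y₀) hs L y₀).isBigO_sub
      have h0 : adaptedCoord g y₀ L y₀ = 0 := by simp [adaptedCoord]
      simpa only [h0, sub_zero] using h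
    exact this.norm_norm.pow 2)
  have key3 := ((L'.symm : EuclideanSpace ℝ (Fin n) →L[ℝ] EuclideanSpace ℝ (Fin n)).isBigO_comp
    _ (𝓝 y₀)).trans_isLittleO key2
  refine key3.congr' ?_ EventuallyEq.rfl
  filter_upwards [hl] with y hy
  have hLA : ∀ a, L'.symm (L a) = A a := fun a => by simp [L']
  simp only [Function.comp_apply, hy, ContinuousLinearEquiv.coe_coe]
  rw [map_sub L'.symm, adaptedCoord, adaptedCoord, L'.symm_apply_apply, hLA, hA]

end Isometry
section SecondOrder

open Filter Topology Asymptotics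

variable {X Y : Type*} [NormedAddCommGroup X] [NormedSpace ℝ X]
  [NormedAddCommGroup Y] [NormedSpace ℝ Y]

/-- The curve `γ` has the second order expansion `p + t U + t² W` at `t = 0`. -/
def HasExpansionTwo (γ : ℝ → X) (p U W : X) : Prop :=
  (fun t => γ t - (p + t • U + t ^ 2 • W)) =o[𝓝 0] fun t : ℝ => t ^ 2

variable {γ : ℝ → X} {p U W : X}

theorem HasExpansionTwo.unique (h : HasExpansionTwo γ p U W) {W' : X}
    (h' : HasExpansionTwo γ p U W') : W = W' := by
  have h1 : (fun t : ℝ => t ^ 2 • (W - W')) =o[𝓝 0] fun t : ℝ => t ^ 2 := by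
    refine (h'.sub h).congr_left fun t => ?_
    module
  by_contra hne
  have hpos : 0 < ‖W - W'‖ := norm_pos_iff.2 (sub_ne_zero.2 hne)
  have h2 := (h1.def (half_pos hpos)).filter_mono (nhdsWithin_le_nhds (s := {(0 : ℝ)}ᶜ))
  obtain ⟨t, ht, ht0⟩ := (h2.and self_mem_nhdsWithin).exists
  have ht2 : 0 < ‖t ^ 2‖ := norm_pos_iff.2 (pow_ne_zero 2 ht0)
  rw [norm_smul] at ht
  nlinarith

theorem HasExpansionTwo.sub_isLittleO (h : HasExpansionTwo γ p U W) :
    (fun t => γ t - p - t • U) =o[𝓝 0] fun t : ℝ => t := by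
  have h1 : (fun t : ℝ => t ^ 2) =o[𝓝 0] fun t : ℝ => t := by
    simpa using isLittleO_pow_pow (𝕜 := ℝ) (m := 1) (n := 2) (by norm_num)
  have h2 : (fun t : ℝ => t ^ 2 • W) =O[𝓝 0] fun t : ℝ => t ^ 2 := by
    refine IsBigO.of_bound ‖W‖ (Eventually.of_forall fun t => ?_)
    rw [norm_smul, mul_comm]
  refine ((h.trans h1).add (h2.trans_isLittleO h1)).congr_left fun t => ?_
  module

theorem HasExpansionTwo.sub_isBigO (h : HasExpansionTwo γ p U W) :
    (fun t => γ t - p) =O[𝓝 0] fun t : ℝ => t := by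
  have h2 : (fun t : ℝ => t • U) =O[𝓝 0] fun t : ℝ => t := by
    refine IsBigO.of_bound ‖U‖ (Eventually.of_forall fun t => ?_)
    rw [norm_smul, mul_comm]
  refine (h.sub_isLittleO.isBigO.add h2).congr_left fun t => ?_
  module

theorem HasExpansionTwo.tendsto (h : HasExpansionTwo γ p U W) : Tendsto γ (𝓝 0) (𝓝 p) := by
  have h1 := h.sub_isBigO.trans_tendsto (f'' := fun t => γ t - p) tendsto_id
  simpa using h1.add_const p

theorem HasExpansionTwo.bilin (h : HasExpansionTwo γ p U W) (B : X →L[ℝ] X →L[ℝ] Y) :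
    (fun t => B (γ t - p) (γ t - p) - t ^ 2 • B U U) =o[𝓝 0] fun t : ℝ => t ^ 2 := by
  have h2 : (fun t : ℝ => t • U) =O[𝓝 0] fun t : ℝ => t := by
    refine IsBigO.of_bound ‖U‖ (Eventually.of_forall fun t => ?_)
    rw [norm_smul, mul_comm]
  have hb {a b : ℝ → X} (ha : a =O[𝓝 0] fun t : ℝ => t) (hb : b =o[𝓝 0] fun t : ℝ => t) :
      (fun t => B (a t) (b t)) =o[𝓝 0] fun t : ℝ => t ^ 2 := by
    have h3 : (fun t => B (a t) (b t)) =O[𝓝 0] fun t => ‖a t‖ * ‖b t‖ :=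
      IsBigO.of_bound ‖B‖ (Eventually.of_forall fun t => by
        simpa [mul_assoc] using B.le_opNorm₂ (a t) (b t))
    simpa [pow_two] using h3.trans_isLittleO (ha.norm_left.mul_isLittleO hb.norm_left)
  have h3 := hb h.sub_isBigO h.sub_isLittleO
  have h4 : (fun t => B (γ t - p - t • U) (t • U)) =o[𝓝 0] fun t : ℝ => t ^ 2 := by
    have h5 : (fun t => B (γ t - p - t • U) (t • U)) =O[𝓝 0]
        fun t => ‖t • U‖ * ‖γ t - p - t • U‖ :=
      IsBigO.of_bound ‖B‖ (Eventually.of_forall fun t => by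
        simpa [mul_assoc, mul_comm ‖t • U‖] using B.le_opNorm₂ (γ t - p - t • U) (t • U))
    simpa [pow_two] using h5.trans_isLittleO (h2.norm_left.mul_isLittleO h.sub_isLittleO.norm_left)
  refine (h3.add h4).congr_left fun t => ?_
  simp only [map_sub, map_smul, _root_.sub_apply, _root_.smul_apply]
  module

theorem taylor_two_isLittleO {F : X → Y} {x : X} (hF : ContDiffAt ℝ 2 F x) :
    (fun y => F y - F x - fderiv ℝ F x (y - x)
      - (1 / 2 : ℝ) • fderiv ℝ (fderiv ℝ F) x (y - x) (y - x)) =o[𝓝 x] fun y => ‖y - x‖ ^ 2 := by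
  have hs : IsSymmSndFDerivAt ℝ F x := hF.isSymmSndFDerivAt (by simp)
  have hd : ∀ᶠ y in 𝓝 x, DifferentiableAt ℝ F y :=
    (hF.eventually (by simp)).mono fun y hy => hy.differentiableAt (by simp)
  have hd2 : HasFDerivAt (fderiv ℝ F) (fderiv ℝ (fderiv ℝ F) x) x :=
    ((hF.fderiv_right (m := 1) (by norm_num)).differentiableAt (by norm_num)).hasFDerivAt
  set R : X → Y := fun y => F y - F x - fderiv ℝ F x (y - x)
      - (1 / 2 : ℝ) • fderiv ℝ (fderiv ℝ F) x (y - x) (y - x)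
  have hR : ∀ y, DifferentiableAt ℝ F y → HasFDerivAt R
      (fderiv ℝ F y - fderiv ℝ F x - fderiv ℝ (fderiv ℝ F) x (y - x)) y := by
    intro y hy
    have h0 : HasFDerivAt (fun y => y - x) (ContinuousLinearMap.id ℝ X) y :=
      (hasFDerivAt_id y).sub_const x
    have h1 := (fderiv ℝ (fderiv ℝ F) x).hasFDerivAt_of_bilinear h0 h0
    have h2 := ((hy.hasFDerivAt.sub_const (F x)).sub
      ((fderiv ℝ F x).hasFDerivAt.comp y h0)).sub (h1.const_smul (1 / 2 : ℝ))
    refine h2.congr_fderiv ?_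
    ext1 a
    simp only [ContinuousLinearMap.precompR_apply, ContinuousLinearMap.precompL_apply,
      _root_.sub_apply, _root_.smul_apply, _root_.add_apply, ContinuousLinearMap.comp_apply,
      ContinuousLinearMap.id_apply, hs.eq a, ContinuousLinearMap.compL_apply]
    module
  refine IsLittleO.of_bound fun ε hε => ?_
  have hev := hd.and (hd2.isLittleO.def hε)
  obtain ⟨r, hr, hball⟩ := Metric.eventually_nhds_iff_ball.1 hev
  filter_upwards [Metric.ball_mem_nhds x hr] with y hy
  have hsub : Metric.closedBall x ‖y - x‖ ⊆ Metric.ball x r :=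
    Metric.closedBall_subset_ball (by simpa [dist_eq_norm] using hy)
  have h := (convex_closedBall x ‖y - x‖).norm_image_sub_le_of_norm_hasFDerivWithin_le
    (f := R) (C := ε * ‖y - x‖)
    (fun z hz => (hR z (hball z (hsub hz)).1).hasFDerivWithinAt)
    (fun z hz => ((hball z (hsub hz)).2).trans (by
      gcongr
      simpa [dist_eq_norm] using hz))
    (Metric.mem_closedBall_self (norm_nonneg _))
    (show y ∈ Metric.closedBall x ‖y - x‖ by simp [dist_eq_norm])
  have hRx : R x = 0 := by simp [R]
  rw [hRx, sub_zero] at h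
  rw [norm_pow, norm_norm]
  linarith [h, show ε * ‖y - x‖ * ‖y - x‖ = ε * ‖y - x‖ ^ 2 by ring]

theorem HasExpansionTwo.comp (h : HasExpansionTwo γ p U W) {F : X → Y}
    (hF : ContDiffAt ℝ 2 F p) :
    HasExpansionTwo (fun t => F (γ t)) (F p) (fderiv ℝ F p U)
      (fderiv ℝ F p W + (1 / 2 : ℝ) • fderiv ℝ (fderiv ℝ F) p U U) := by
  have h1 := (taylor_two_isLittleO hF).comp_tendsto h.tendsto
  have h2 : (fun t => ‖γ t - p‖ ^ 2) =O[𝓝 0] fun t : ℝ => t ^ 2 := h.sub_isBigO.norm_left.pow 2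
  have h3 := h1.trans_isBigO h2
  have h4 := (h.bilin (fderiv ℝ (fderiv ℝ F) p)).const_smul_left (1 / 2 : ℝ)
  have h5 := ((fderiv ℝ F p).isBigO_comp (fun t => γ t - (p + t • U + t ^ 2 • W))
    (𝓝 0)).trans_isLittleO h
  refine ((h3.add h4).add h5).congr_left fun t => ?_
  have e : fderiv ℝ F p (γ t - (p + t • U + t ^ 2 • W)) = fderiv ℝ F p (γ t - p)
      - t • fderiv ℝ F p U - t ^ 2 • fderiv ℝ F p W := by
    simp only [map_sub, map_add, map_smul]
    module
  simp only [Function.comp_apply, Pi.smul_apply, e]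
  module

theorem HasExpansionTwo.quadratic (h : HasExpansionTwo γ p U W) (B : X →L[ℝ] X →L[ℝ] X) :
    HasExpansionTwo (fun t => γ t - p + (1 / 2 : ℝ) • B (γ t - p) (γ t - p)) 0 U
      (W + (1 / 2 : ℝ) • B U U) := by
  refine (h.add ((h.bilin B).const_smul_left (1 / 2 : ℝ))).congr_left fun t => ?_
  simp only [Pi.smul_apply]
  module

theorem HasExpansionTwo.clm (h : HasExpansionTwo γ p U W) (A : X →L[ℝ] Y) :
    HasExpansionTwo (fun t => A (γ t)) (A p) (A U) (A W) := by
  refine ((A.isBigO_comp (fun t => γ t - (p + t • U + t ^ 2 • W))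
    (𝓝 0)).trans_isLittleO h).congr_left fun t => ?_
  simp only [map_sub, map_add, map_smul]

theorem hasExpansionTwo_line (p U : X) : HasExpansionTwo (fun t => p + t • U) p U 0 := by
  refine (isLittleO_zero _ _).congr_left fun t => ?_
  module

theorem exists_hasExpansionTwo_of_holomorphic {X Y : Type*} [NormedAddCommGroup X]
    [NormedSpace ℂ X] [NormedAddCommGroup Y] [NormedSpace ℂ Y] [CompleteSpace Y]
    {τ : X → Y} {z : X}
    (hτ : ∀ᶠ x in 𝓝 z, DifferentiableAt ℂ τ x) (v : X) :
    ∃ w : Y, ∀ c : ℂ, HasExpansionTwo (fun t : ℝ => τ (z + t • (c • v))) (τ z)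
      (c • fderiv ℂ τ z v) (c ^ 2 • w) := by
  have hline : ContinuousAt (fun s : ℂ => z + s • v) 0 := by fun_prop
  have htend : Tendsto (fun s : ℂ => z + s • v) (𝓝 0) (𝓝 z) := by
    simpa [ContinuousAt] using hline
  set φ : ℂ → Y := fun s => τ (z + s • v)
  have hφ : ∀ᶠ s in 𝓝 (0 : ℂ), DifferentiableAt ℂ φ s := by
    filter_upwards [htend.eventually hτ] with s hs
    exact hs.comp s ((differentiableAt_const z).add (differentiableAt_id.smul_const v))
  have hφ0 : HasDerivAt φ (fderiv ℂ τ z v) 0 := by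
    have h1 : HasDerivAt (fun s : ℂ => z + s • v) v 0 := by
      simpa using ((hasDerivAt_id (0 : ℂ)).smul_const v).const_add z
    have h2 : HasFDerivAt τ (fderiv ℂ τ z) (z + (0 : ℂ) • v) := by
      simpa using hτ.self_of_nhds.hasFDerivAt
    exact h2.comp_hasDerivAt 0 h1
  obtain ⟨s, hs, hsd⟩ := hφ.exists_mem
  have hds : DifferentiableAt ℂ (dslope φ 0) 0 :=
    ((Complex.differentiableOn_dslope hs).2 fun x hx =>
      (hsd x hx).differentiableWithinAt).differentiableAt hs
  refine ⟨deriv (dslope φ 0) 0, fun c => ?_⟩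
  have h1 := hds.hasDerivAt.isLittleO
  have hc : Tendsto (fun t : ℝ => (t : ℂ) * c) (𝓝 0) (𝓝 0) := by
    have : ContinuousAt (fun t : ℝ => (t : ℂ) * c) 0 := by fun_prop
    simpa [ContinuousAt] using this
  have h2 := h1.comp_tendsto hc
  have h3 : (fun t : ℝ => (t : ℂ) * c) =O[𝓝 0] fun t : ℝ => t :=
    IsBigO.of_bound ‖c‖ (Eventually.of_forall fun t => by simp [mul_comm])
  have h4 := h3.smul_isLittleO (h2.trans_isBigO (by simpa [Function.comp_def] using h3))
  refine (h4.congr_right fun t => by simp [pow_two]).congr_left fun t => ?_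
  have h5 := sub_smul_dslope φ 0 ((t : ℂ) * c)
  have h6 : φ ((t : ℂ) * c) = τ (z + t • (c • v)) := by
    simp [φ, mul_smul]
  have h7 : φ 0 = τ z := by simp [φ]
  rw [h6, h7, sub_zero] at h5
  simp only [Function.comp_apply, dslope_same, hφ0.deriv, sub_zero, smul_sub, h5, smul_smul]
  simp only [← Complex.coe_smul (E := Y), smul_smul]
  push_cast
  module

end SecondOrder
section Charts

open Filter Topology Asymptotics

theorem isUnit_det_of_real_posdef {n : ℕ} {G : Matrix (Fin n) (Fin n) ℝ}
    (hG : ∀ v : Fin n → ℝ, v ≠ 0 → 0 < ∑ i, ∑ j, G i j * v i * v j) : IsUnit G.det := by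
  rw [isUnit_iff_ne_zero]
  intro h
  obtain ⟨v, hv, hGv⟩ := Matrix.exists_mulVec_eq_zero_iff.2 h
  have h1 : ∀ i, ∑ j, G i j * v j = 0 := fun i => congrFun hGv i
  refine (hG v hv).ne' (Finset.sum_eq_zero fun i _ => ?_)
  have h2 : ∑ j, G i j * v i * v j = v i * ∑ j, G i j * v j := by
    rw [Finset.mul_sum]
    exact Finset.sum_congr rfl fun j _ => by ring
  rw [h2, h1, mul_zero]

theorem isUnit_det_of_hermitian_posdef {m : ℕ} {H : Matrix (Fin m) (Fin m) ℂ}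
    (hH : ∀ v : Fin m → ℂ, v ≠ 0 → 0 < ∑ α, ∑ β, H α β * v α * (starRingEnd ℂ) (v β)) :
    IsUnit H.det := by
  rw [isUnit_iff_ne_zero]
  intro h
  obtain ⟨v, hv, hHv⟩ := Matrix.exists_vecMul_eq_zero_iff.2 h
  have h1 : ∀ β, ∑ α, v α * H α β = 0 := fun β => congrFun hHv β
  refine (hH v hv).ne' ?_
  rw [Finset.sum_comm]
  refine Finset.sum_eq_zero fun β _ => ?_
  have h2 : ∑ α, H α β * v α * (starRingEnd ℂ) (v β)
      = (∑ α, v α * H α β) * (starRingEnd ℂ) (v β) := by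
    rw [Finset.sum_mul]
    exact Finset.sum_congr rfl fun j _ => by ring
  rw [h2, h1, zero_mul]

theorem RiemannData.differentiableAt_transition {n : ℕ} {N : Type*} [TopologicalSpace N]
    [ChartedSpace (EuclideanSpace ℝ (Fin n)) N] (gD : RiemannData n N) (a b : N)
    {y : EuclideanSpace ℝ (Fin n)} (hy : y ∈ ((chartAt (EuclideanSpace ℝ (Fin n)) a).symm.trans
      (chartAt (EuclideanSpace ℝ (Fin n)) b)).source) :
    DifferentiableAt ℝ ((chartAt (EuclideanSpace ℝ (Fin n)) a).symm.trans
      (chartAt (EuclideanSpace ℝ (Fin n)) b)) y := by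
  by_contra hnd
  have hc := gD.compat a b y hy
  simp only [fderiv_zero_of_not_differentiableAt hnd, _root_.zero_apply, PiLp.zero_apply,
    zero_mul, Finset.sum_const_zero] at hc
  have hya : y ∈ (chartAt (EuclideanSpace ℝ (Fin n)) a).target := by
    simp only [OpenPartialHomeomorph.trans_source, OpenPartialHomeomorph.symm_source] at hy
    exact hy.1
  rcases isEmpty_or_nonempty (Fin n) with hn | hn
  · exact hnd ((hasFDerivAt_of_subsingleton _ y).differentiableAt)
  · have h := gD.posdef a y hya (fun _ => 1) (by
      intro h
      simpa using congrFun h (Classical.arbitrary _))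
    simp [hc] at h

theorem HermitianData.differentiableAt_transition {m : ℕ} {M : Type*} [TopologicalSpace M]
    [ChartedSpace (EuclideanSpace ℂ (Fin m)) M] (hD : HermitianData m M) (a b : M)
    {z : EuclideanSpace ℂ (Fin m)} (hz : z ∈ ((chartAt (EuclideanSpace ℂ (Fin m)) a).symm.trans
      (chartAt (EuclideanSpace ℂ (Fin m)) b)).source) :
    DifferentiableAt ℂ ((chartAt (EuclideanSpace ℂ (Fin m)) a).symm.trans
      (chartAt (EuclideanSpace ℂ (Fin m)) b)) z := by
  by_contra hnd
  have hc := hD.compat a b z hz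
  simp only [fderiv_zero_of_not_differentiableAt hnd, _root_.zero_apply, PiLp.zero_apply,
    zero_mul, Finset.sum_const_zero] at hc
  have hza : z ∈ (chartAt (EuclideanSpace ℂ (Fin m)) a).target := by
    simp only [OpenPartialHomeomorph.trans_source, OpenPartialHomeomorph.symm_source] at hz
    exact hz.1
  rcases isEmpty_or_nonempty (Fin m) with hm | hm
  · exact hnd ((hasFDerivAt_of_subsingleton _ z).differentiableAt)
  · have h := hD.posdef a z hza (fun _ => 1) (by
      intro h
      simpa using congrFun h (Classical.arbitrary _))
    simp [hc] at h

theorem metricForm_eq_of_single {n : ℕ} {G G' : Matrix (Fin n) (Fin n) ℝ}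
    {A : EuclideanSpace ℝ (Fin n) →L[ℝ] EuclideanSpace ℝ (Fin n)}
    (h : ∀ i j, G i j = ∑ k, ∑ l,
      A (EuclideanSpace.single i 1) k * A (EuclideanSpace.single j 1) l * G' k l)
    (v : EuclideanSpace ℝ (Fin n)) : metricForm G v v = metricForm G' (A v) (A v) := by
  have hA : ∀ k, A v k = ∑ i, v i * A (EuclideanSpace.single i 1) k := by
    intro k
    rw [clm_eq_sum_single A v]
    simp
  simp only [metricForm, hA, h, Finset.sum_mul, Finset.mul_sum]
  have e : ∀ (P : Fin n → Fin n → Fin n → Fin n → ℝ), ∑ i, ∑ j, ∑ k, ∑ l, P i j k l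
      = ∑ k, ∑ l, ∑ j, ∑ i, P i j k l := by
    intro P
    have e1 : ∀ i, ∑ j, ∑ k, ∑ l, P i j k l = ∑ k, ∑ l, ∑ j, P i j k l := by
      intro i
      rw [Finset.sum_comm]
      exact Finset.sum_congr rfl fun k _ => Finset.sum_comm
    simp only [e1]
    rw [Finset.sum_comm]
    refine Finset.sum_congr rfl fun k _ => ?_
    rw [Finset.sum_comm]
    exact Finset.sum_congr rfl fun l _ => Finset.sum_comm
  rw [e]
  refine Finset.sum_congr rfl fun k _ => Finset.sum_congr rfl fun l _ =>
    Finset.sum_congr rfl fun j _ => Finset.sum_congr rfl fun i _ => ?_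
  ring

theorem RiemannData.transition_expansion {n : ℕ} {N : Type*} [TopologicalSpace N]
    [ChartedSpace (EuclideanSpace ℝ (Fin n)) N] (gD : RiemannData n N) (a b : N)
    {y₀ : EuclideanSpace ℝ (Fin n)} (hy : y₀ ∈ ((chartAt (EuclideanSpace ℝ (Fin n)) a).symm.trans
      (chartAt (EuclideanSpace ℝ (Fin n)) b)).source)
    {θ : EuclideanSpace ℝ (Fin n) → EuclideanSpace ℝ (Fin n)}
    (hθ : θ = (chartAt (EuclideanSpace ℝ (Fin n)) a).symm.trans
      (chartAt (EuclideanSpace ℝ (Fin n)) b)) :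
    Function.Injective (fderiv ℝ θ y₀) ∧
    (fun y => θ y - θ y₀ + (1 / 2 : ℝ) • christoffelForm (gD.g b) (θ y₀) (θ y - θ y₀) (θ y - θ y₀)
      - fderiv ℝ θ y₀ (y - y₀ + (1 / 2 : ℝ) • christoffelForm (gD.g a) y₀ (y - y₀) (y - y₀)))
      =o[𝓝 y₀] fun y => ‖y - y₀‖ ^ 2 := by
  set T := (chartAt (EuclideanSpace ℝ (Fin n)) a).symm.trans
    (chartAt (EuclideanSpace ℝ (Fin n)) b) with hT
  have hTs : T.symm = (chartAt (EuclideanSpace ℝ (Fin n)) b).symm.trans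
    (chartAt (EuclideanSpace ℝ (Fin n)) a) := by
    rw [hT, OpenPartialHomeomorph.trans_symm_eq_symm_trans_symm, OpenPartialHomeomorph.symm_symm]
  have hx : T y₀ ∈ T.symm.source := T.map_source hy
  have hya : y₀ ∈ (chartAt (EuclideanSpace ℝ (Fin n)) a).target := by
    rw [hT, OpenPartialHomeomorph.trans_source] at hy
    exact hy.1
  have hxb : T y₀ ∈ (chartAt (EuclideanSpace ℝ (Fin n)) b).target := by
    rw [hTs, OpenPartialHomeomorph.trans_source] at hx
    exact hx.1
  subst hθ
  refine isometry_expansion (g := gD.g a) (g' := gD.g b) (θ' := T.symm) (gD.symm a) (gD.symm b)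
    (fun i j => ((gD.smooth a i j).contDiffAt
      ((chartAt (EuclideanSpace ℝ (Fin n)) a).open_target.mem_nhds hya)).differentiableAt (by simp))
    (fun i j => ((gD.smooth b i j).contDiffAt
      ((chartAt (EuclideanSpace ℝ (Fin n)) b).open_target.mem_nhds hxb)).differentiableAt (by simp))
    (gD.posdef a y₀ hya) (isUnit_det_of_real_posdef (gD.posdef a y₀ hya))
    (isUnit_det_of_real_posdef (gD.posdef b _ hxb)) rfl (T.left_inv hy) ?_ ?_
    (T.eventually_left_inverse hy) ?_
  · filter_upwards [T.open_source.mem_nhds hy] with y hy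
    exact ⟨gD.differentiableAt_transition a b hy,
      metricForm_eq_of_single (gD.compat a b y hy)⟩
  · filter_upwards [T.symm.open_source.mem_nhds hx] with y hy
    rw [hTs] at hy ⊢
    exact ⟨gD.differentiableAt_transition b a hy,
      metricForm_eq_of_single (gD.compat b a y hy)⟩
  · exact T.eventually_right_inverse (T.map_source hy)

end Charts
section Transformation

open Filter Topology Asymptotics

theorem HasExpansionTwo.unique_linear {X : Type*} [NormedAddCommGroup X] [NormedSpace ℝ X]
    {γ : ℝ → X} {p U W U' W' : X} (h : HasExpansionTwo γ p U W)
    (h' : HasExpansionTwo γ p U' W') : U = U' := by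
  have h1 : (fun t : ℝ => t • (U - U')) =o[𝓝 0] fun t : ℝ => t := by
    refine (h'.sub_isLittleO.sub h.sub_isLittleO).congr_left fun t => ?_
    module
  by_contra hne
  have hpos : 0 < ‖U - U'‖ := norm_pos_iff.2 (sub_ne_zero.2 hne)
  have h2 := (h1.def (half_pos hpos)).filter_mono (nhdsWithin_le_nhds (s := {(0 : ℝ)}ᶜ))
  obtain ⟨t, ht, ht0⟩ := (h2.and self_mem_nhdsWithin).exists
  have ht2 : 0 < ‖t‖ := norm_pos_iff.2 ht0
  rw [norm_smul] at ht
  nlinarith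

variable {m n : ℕ}

/-- The second derivative of `F` corrected by the bilinear form `B`. -/
def covariantHessian (B : EuclideanSpace ℝ (Fin n) →L[ℝ] EuclideanSpace ℝ (Fin n) →L[ℝ]
      EuclideanSpace ℝ (Fin n)) (F : EuclideanSpace ℂ (Fin m) → EuclideanSpace ℝ (Fin n))
    (z v : EuclideanSpace ℂ (Fin m)) : EuclideanSpace ℝ (Fin n) :=
  fderiv ℝ (fderiv ℝ F) z v v + B (fderiv ℝ F z v) (fderiv ℝ F z v)

/-- The complex Hessian trace `Q(v) + Q(iv)` transforms tensorially under holomorphic changes of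
coordinates in the source and changes of normal form in the target. -/
theorem exists_covariantHessian_transform
    {B B' : EuclideanSpace ℝ (Fin n) →L[ℝ] EuclideanSpace ℝ (Fin n) →L[ℝ]
      EuclideanSpace ℝ (Fin n)}
    {A : EuclideanSpace ℝ (Fin n) →L[ℝ] EuclideanSpace ℝ (Fin n)}
    {F F' : EuclideanSpace ℂ (Fin m) → EuclideanSpace ℝ (Fin n)}
    {τ : EuclideanSpace ℂ (Fin m) → EuclideanSpace ℂ (Fin m)}
    {θ : EuclideanSpace ℝ (Fin n) → EuclideanSpace ℝ (Fin n)} {z : EuclideanSpace ℂ (Fin m)}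
    (hF : ContDiffAt ℝ 2 F z) (hF' : ContDiffAt ℝ 2 F' (τ z))
    (hτ : ∀ᶠ x in 𝓝 z, DifferentiableAt ℂ τ x)
    (hcomm : ∀ᶠ x in 𝓝 z, F' (τ x) = θ (F x))
    (hθ : (fun y => θ y - θ (F z) + (1 / 2 : ℝ) • B' (θ y - θ (F z)) (θ y - θ (F z))
      - A (y - F z + (1 / 2 : ℝ) • B (y - F z) (y - F z))) =o[𝓝 (F z)] fun y => ‖y - F z‖ ^ 2)
    (v : EuclideanSpace ℂ (Fin m)) :
    ∃ v', A (covariantHessian B F z v + covariantHessian B F z (Complex.I • v))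
      = covariantHessian B' F' (τ z) v' + covariantHessian B' F' (τ z) (Complex.I • v') := by
  obtain ⟨w, hw⟩ := exists_hasExpansionTwo_of_holomorphic hτ v
  refine ⟨fderiv ℂ τ z v, ?_⟩
  have key : ∀ c : ℂ, A ((1 / 2 : ℝ) • covariantHessian B F z (c • v))
      = fderiv ℝ F' (τ z) (c ^ 2 • w)
        + (1 / 2 : ℝ) • covariantHessian B' F' (τ z) (c • fderiv ℂ τ z v) := by
    intro c
    have hy := (hasExpansionTwo_line z (c • v)).comp hF
    have hx := (((hw c).comp hF').quadratic B')
    have hAy := (hy.quadratic B).clm A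
    have htend : Tendsto (fun t : ℝ => z + t • (c • v)) (𝓝 0) (𝓝 z) :=
      (hasExpansionTwo_line z (c • v)).tendsto
    have hθt := (hθ.comp_tendsto hy.tendsto).trans_isBigO (hy.sub_isBigO.norm_left.pow 2)
    have hx' : HasExpansionTwo (fun t : ℝ => F' (τ (z + t • c • v)) - F' (τ z) + (1 / 2 : ℝ) •
        B' (F' (τ (z + t • c • v)) - F' (τ z)) (F' (τ (z + t • c • v)) - F' (τ z)))
        (A 0) (A (fderiv ℝ F z (c • v)))
        (A (fderiv ℝ F z 0 + (1 / 2 : ℝ) • fderiv ℝ (fderiv ℝ F) z (c • v) (c • v)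
          + (1 / 2 : ℝ) • B (fderiv ℝ F z (c • v)) (fderiv ℝ F z (c • v)))) := by
      refine (hAy.add hθt).congr' ?_ EventuallyEq.rfl
      filter_upwards [htend.eventually hcomm] with t ht
      simp only [Function.comp_apply, ht, hcomm.self_of_nhds]
      module
    rw [map_zero] at hx'
    have hU := hx.unique_linear hx'
    rw [← hU] at hx'
    have hW := hx.unique hx'
    simp only [covariantHessian, smul_add]
    rw [map_zero, zero_add] at hW
    rw [← hW]
    abel
  have h1 := key 1
  have hI := key Complex.I
  simp only [one_smul, one_pow] at h1
  rw [Complex.I_sq, neg_smul, one_smul, map_neg] at hI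
  have h2 : A ((1 / 2 : ℝ) • covariantHessian B F z v)
      + A ((1 / 2 : ℝ) • covariantHessian B F z (Complex.I • v))
      = (1 / 2 : ℝ) • covariantHessian B' F' (τ z) (fderiv ℂ τ z v)
        + (1 / 2 : ℝ) • covariantHessian B' F' (τ z) (Complex.I • fderiv ℂ τ z v) := by
    rw [h1, hI]
    abel
  rw [← map_add, ← smul_add, ← smul_add, map_smul] at h2
  exact smul_right_injective _ (by norm_num : (1 / 2 : ℝ) ≠ 0) h2

end Transformation
section ComplexHessian

open Filter Topology

variable {m n : ℕ}

theorem realLinear_eq_wirtinger (L : EuclideanSpace ℂ (Fin m) →L[ℝ] ℂ)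
    (v : EuclideanSpace ℂ (Fin m)) :
    L v = ∑ α, ((1 / 2) * (L (EuclideanSpace.single α 1)
        + -Complex.I * L (EuclideanSpace.single α Complex.I)) * v α
      + (1 / 2) * (L (EuclideanSpace.single α 1)
        + Complex.I * L (EuclideanSpace.single α Complex.I)) * (starRingEnd ℂ) (v α)) := by
  have hv : v = ∑ α, ((v α).re • EuclideanSpace.single α (1 : ℂ)
      + (v α).im • EuclideanSpace.single α Complex.I) := by
    ext β
    simp [Finset.sum_apply, Pi.single_apply, Finset.sum_add_distrib, Complex.re_add_im]
  conv_lhs => rw [hv]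
  simp only [map_sum, map_add, map_smul, Complex.real_smul]
  refine Finset.sum_congr rfl fun α _ => ?_
  conv_rhs => rw [← Complex.re_add_im (v α)]
  simp only [map_add, map_mul, Complex.conj_ofReal, Complex.conj_I]
  linear_combination ((v α).im : ℂ) * L (EuclideanSpace.single α Complex.I) * Complex.I_mul_I

theorem fderiv_eq_wirtinger (G : EuclideanSpace ℂ (Fin m) → ℂ) (z v : EuclideanSpace ℂ (Fin m)) :
    fderiv ℝ G z v = ∑ α, (wDir (-Complex.I) α G z * v α
      + wDir Complex.I α G z * (starRingEnd ℂ) (v α)) :=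
  realLinear_eq_wirtinger _ v

theorem fderiv_fderiv_eq_wirtinger {G : EuclideanSpace ℂ (Fin m) → ℂ}
    {z : EuclideanSpace ℂ (Fin m)} (hG : ContDiffAt ℝ 2 G z) (v : EuclideanSpace ℂ (Fin m)) :
    fderiv ℝ (fderiv ℝ G) z v v
      = ∑ α, ∑ β, (wDir (-Complex.I) α (wDir (-Complex.I) β G) z * v α * v β
        + 2 * wDir (-Complex.I) α (wDir Complex.I β G) z * v α * (starRingEnd ℂ) (v β)
        + wDir Complex.I α (wDir Complex.I β G) z
          * (starRingEnd ℂ) (v α) * (starRingEnd ℂ) (v β)) := by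
  have hd2 : DifferentiableAt ℝ (fderiv ℝ G) z :=
    (hG.fderiv_right (m := 1) (by norm_num)).differentiableAt (by norm_num)
  have hw : ∀ c β, DifferentiableAt ℝ (wDir c β G) z := fun c β =>
    (wDir_contDiffAt (l := 1) hG (by norm_num)).differentiableAt (by norm_num)
  have h1 : fderiv ℝ (fderiv ℝ G) z v v = fderiv ℝ (fun x => fderiv ℝ G x v) z v := by
    rw [fderiv_clm_apply hd2 (differentiableAt_const v)]
    simp
  have h2 : ∀ c α, wDir c α (fun x => fderiv ℝ G x v) z
      = ∑ β, (wDir c α (wDir (-Complex.I) β G) z * v β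
        + wDir c α (wDir Complex.I β G) z * (starRingEnd ℂ) (v β)) := by
    intro c α
    simp only [fderiv_eq_wirtinger G _ v]
    rw [wDir_sum _ fun β _ => by
      exact ((hw _ β).mul_const _).add ((hw _ β).mul_const _)]
    refine Finset.sum_congr rfl fun β _ => ?_
    rw [wDir_add ((hw _ β).mul_const _) ((hw _ β).mul_const _),
      wDir_mul (hw _ β) (differentiableAt_const _), wDir_mul (hw _ β) (differentiableAt_const _)]
    simp
  rw [h1, fderiv_eq_wirtinger]
  simp only [h2, Finset.sum_add_distrib, add_mul, Finset.sum_mul]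
  have h3 : ∑ α, ∑ β, wDir Complex.I α (wDir (-Complex.I) β G) z * v β * (starRingEnd ℂ) (v α)
      = ∑ α, ∑ β, wDir (-Complex.I) α (wDir Complex.I β G) z * (starRingEnd ℂ) (v β) * v α := by
    rw [Finset.sum_comm]
    refine Finset.sum_congr rfl fun α _ => Finset.sum_congr rfl fun β _ => ?_
    rw [wDir_comm hG]
    ring
  have h4 : ∑ α, ∑ β, 2 * wDir (-Complex.I) α (wDir Complex.I β G) z * v α
      * (starRingEnd ℂ) (v β) = 2 * ∑ α, ∑ β, wDir (-Complex.I) α (wDir Complex.I β G) z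
      * (starRingEnd ℂ) (v β) * v α := by
    simp only [Finset.mul_sum]
    refine Finset.sum_congr rfl fun α _ => Finset.sum_congr rfl fun β _ => ?_
    ring
  have h5 : ∀ (c : ℂ) (u : Fin m → ℂ), ∑ α, ∑ β, wDir c α (wDir c β G) z * u β * u α
      = ∑ α, ∑ β, wDir c α (wDir c β G) z * u α * u β := fun c u =>
    Finset.sum_congr rfl fun α _ => Finset.sum_congr rfl fun β _ => mul_right_comm _ _ _
  rw [h3, h4, h5 (-Complex.I) v, h5 Complex.I fun α => (starRingEnd ℂ) (v α)]
  ring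

theorem covariantHessian_add_I_smul
    {g : EuclideanSpace ℝ (Fin n) → Matrix (Fin n) (Fin n) ℝ} (hs : ∀ y i j, g y i j = g y j i)
    {F : EuclideanSpace ℂ (Fin m) → EuclideanSpace ℝ (Fin n)}
    {z : EuclideanSpace ℂ (Fin m)} (hF : ContDiffAt ℝ 2 F z) (v : EuclideanSpace ℂ (Fin m))
    (i : Fin n) :
    (((covariantHessian (christoffelForm g (F z)) F z v
      + covariantHessian (christoffelForm g (F z)) F z (Complex.I • v)) i : ℝ) : ℂ)
      = 4 * ∑ α, ∑ β, (wDir (-Complex.I) α (wDir Complex.I β fun x => ((F x i : ℝ) : ℂ)) z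
        + ∑ j, ∑ k, (christoffel g i j k (F z) : ℂ)
          * wDir Complex.I β (fun x => ((F x j : ℝ) : ℂ)) z
          * wDir (-Complex.I) α (fun x => ((F x k : ℝ) : ℂ)) z) * v α * (starRingEnd ℂ) (v β) := by
  have hG : ∀ i, ContDiffAt ℝ 2 (fun x => ((F x i : ℝ) : ℂ)) z := fun i =>
    Complex.ofRealCLM.contDiff.contDiffAt.comp z
      ((EuclideanSpace.proj (𝕜 := ℝ) i).contDiff.contDiffAt.comp z hF)
  have hD1 : ∀ᶠ x in 𝓝 z, ∀ i v, ((fderiv ℝ F x v i : ℝ) : ℂ)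
      = fderiv ℝ (fun x => ((F x i : ℝ) : ℂ)) x v := by
    filter_upwards [(hF.eventually (by simp)).mono fun y hy =>
      hy.differentiableAt (n := 2) (by simp)] with x hx i v
    have := (Complex.ofRealCLM.hasFDerivAt).comp x
      ((EuclideanSpace.proj (𝕜 := ℝ) i).hasFDerivAt.comp x hx.hasFDerivAt)
    exact (congrArg (fun L => L v) this.fderiv).symm
  have hD2 : ∀ v, ((fderiv ℝ (fderiv ℝ F) z v v i : ℝ) : ℂ)
      = fderiv ℝ (fderiv ℝ (fun x => ((F x i : ℝ) : ℂ))) z v v := by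
    intro v
    have hd2 : DifferentiableAt ℝ (fderiv ℝ F) z :=
      (hF.fderiv_right (m := 1) (by norm_num)).differentiableAt (by norm_num)
    have hd2' : DifferentiableAt ℝ (fderiv ℝ (fun x => ((F x i : ℝ) : ℂ))) z :=
      ((hG i).fderiv_right (m := 1) (by norm_num)).differentiableAt (by norm_num)
    have h1 : HasFDerivAt (fun x => fderiv ℝ F x v) ((fderiv ℝ (fderiv ℝ F) z).flip v) z := by
      simpa using hd2.hasFDerivAt.clm_apply (hasFDerivAt_const v z)
    have h2 : HasFDerivAt (fun x => fderiv ℝ (fun x => ((F x i : ℝ) : ℂ)) x v)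
        ((fderiv ℝ (fderiv ℝ (fun x => ((F x i : ℝ) : ℂ))) z).flip v) z := by
      simpa using hd2'.hasFDerivAt.clm_apply (hasFDerivAt_const v z)
    have h3 := (Complex.ofRealCLM.hasFDerivAt).comp z
      ((EuclideanSpace.proj (𝕜 := ℝ) i).hasFDerivAt.comp z h1)
    have h4 := h3.unique (h2.congr_of_eventuallyEq (hD1.mono fun x hx => hx i v))
    exact congrArg (fun L => L v) h4
  have hΓ : ∀ v, ((christoffelForm g (F z) (fderiv ℝ F z v) (fderiv ℝ F z v) i : ℝ) : ℂ)
      = ∑ j, ∑ k, (christoffel g i j k (F z) : ℂ)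
        * fderiv ℝ (fun x => ((F x j : ℝ) : ℂ)) z v
        * fderiv ℝ (fun x => ((F x k : ℝ) : ℂ)) z v := by
    intro v
    rw [christoffelForm_apply]
    push_cast
    simp only [hD1.self_of_nhds]
  simp only [covariantHessian, PiLp.add_apply, Complex.ofReal_add, hD2, hΓ,
    fderiv_fderiv_eq_wirtinger (hG i), PiLp.smul_apply, smul_eq_mul, map_mul, Complex.conj_I]
  set p : Fin n → ℂ := fun j => ∑ α, wDir (-Complex.I) α (fun x => ((F x j : ℝ) : ℂ)) z * v α
  set q : Fin n → ℂ := fun j =>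
    ∑ α, wDir Complex.I α (fun x => ((F x j : ℝ) : ℂ)) z * (starRingEnd ℂ) (v α)
  have hfd : ∀ j, fderiv ℝ (fun x => ((F x j : ℝ) : ℂ)) z v = p j + q j := fun j => by
    rw [fderiv_eq_wirtinger, Finset.sum_add_distrib]
  have hfdI : ∀ j, fderiv ℝ (fun x => ((F x j : ℝ) : ℂ)) z (Complex.I • v)
      = Complex.I * p j - Complex.I * q j := fun j => by
    rw [fderiv_eq_wirtinger, Finset.sum_add_distrib, sub_eq_add_neg, ← mul_neg, ← Finset.sum_neg_distrib,
      Finset.mul_sum, Finset.mul_sum]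
    congr 1 <;> refine Finset.sum_congr rfl fun α _ => ?_
    · simp only [PiLp.smul_apply, smul_eq_mul]
      ring
    · simp only [PiLp.smul_apply, smul_eq_mul, map_mul, Complex.conj_I]
      ring
  have hsw : ∑ j, ∑ k, (christoffel g i j k (F z) : ℂ) * p j * q k
      = ∑ j, ∑ k, (christoffel g i j k (F z) : ℂ) * q j * p k := by
    rw [Finset.sum_comm]
    refine Finset.sum_congr rfl fun j _ => Finset.sum_congr rfl fun k _ => ?_
    rw [christoffel_symm hs]
    ring
  have hpq : ∑ j, ∑ k, (christoffel g i j k (F z) : ℂ) * q j * p k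
      = ∑ α, ∑ β, (∑ j, ∑ k, (christoffel g i j k (F z) : ℂ)
          * wDir Complex.I β (fun x => ((F x j : ℝ) : ℂ)) z
          * wDir (-Complex.I) α (fun x => ((F x k : ℝ) : ℂ)) z) * v α * (starRingEnd ℂ) (v β) := by
    have e : ∀ j k, (christoffel g i j k (F z) : ℂ) * q j * p k
        = ∑ α, ∑ β, (christoffel g i j k (F z) : ℂ)
          * wDir Complex.I β (fun x => ((F x j : ℝ) : ℂ)) z
          * wDir (-Complex.I) α (fun x => ((F x k : ℝ) : ℂ)) z * v α * (starRingEnd ℂ) (v β) := by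
      intro j k
      simp only [p, q, Finset.mul_sum, Finset.sum_mul]
      refine Finset.sum_congr rfl fun α _ => Finset.sum_congr rfl fun β _ => ?_
      ring
    simp only [e, Finset.sum_mul]
    have e1 : ∀ j, (∑ k, ∑ α, ∑ β, (christoffel g i j k (F z) : ℂ)
          * wDir Complex.I β (fun x => ((F x j : ℝ) : ℂ)) z
          * wDir (-Complex.I) α (fun x => ((F x k : ℝ) : ℂ)) z * v α * (starRingEnd ℂ) (v β))
        = ∑ α, ∑ β, ∑ k, (christoffel g i j k (F z) : ℂ)
          * wDir Complex.I β (fun x => ((F x j : ℝ) : ℂ)) z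
          * wDir (-Complex.I) α (fun x => ((F x k : ℝ) : ℂ)) z * v α * (starRingEnd ℂ) (v β) := by
      intro j
      rw [Finset.sum_comm]
      exact Finset.sum_congr rfl fun α _ => Finset.sum_comm
    simp only [e1]
    rw [Finset.sum_comm]
    exact Finset.sum_congr rfl fun α _ => Finset.sum_comm
  simp only [hfd, hfdI]
  have hq2 : ∑ j, ∑ k, (christoffel g i j k (F z) : ℂ) * (p j + q j) * (p k + q k)
      + ∑ j, ∑ k, (christoffel g i j k (F z) : ℂ) * (Complex.I * p j - Complex.I * q j)
        * (Complex.I * p k - Complex.I * q k)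
      = 4 * ∑ j, ∑ k, (christoffel g i j k (F z) : ℂ) * q j * p k := by
    have : ∀ j k, (christoffel g i j k (F z) : ℂ) * (p j + q j) * (p k + q k)
      + (christoffel g i j k (F z) : ℂ) * (Complex.I * p j - Complex.I * q j)
        * (Complex.I * p k - Complex.I * q k) = 2 * ((christoffel g i j k (F z) : ℂ) * p j * q k)
        + 2 * ((christoffel g i j k (F z) : ℂ) * q j * p k) := by
      intro j k
      linear_combination ((christoffel g i j k (F z) : ℂ) * (p j - q j) * (p k - q k))
        * Complex.I_mul_I
    simp only [← Finset.sum_add_distrib, this]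
    simp only [Finset.sum_add_distrib, ← Finset.mul_sum, hsw]
    ring
  have hlhs : ∀ a b c d : ℂ, a + b + (c + d) = (a + c) + (b + d) := fun a b c d => by ring
  rw [hlhs, hq2, hpq]
  simp only [add_mul, Finset.sum_add_distrib, mul_add]
  congr 1
  simp only [Finset.mul_sum, ← Finset.sum_add_distrib]
  refine Finset.sum_congr rfl fun α _ => Finset.sum_congr rfl fun β _ => ?_
  ring_nf
  simp only [Complex.I_sq]
  ring

end ComplexHessian
section PluriharmonicNear

open Filter Topology

theorem eq_zero_of_sesquilinear_self {m : ℕ} {P : Matrix (Fin m) (Fin m) ℂ}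
    (h : ∀ v : EuclideanSpace ℂ (Fin m), ∑ α, ∑ β, P α β * v α * (starRingEnd ℂ) (v β) = 0) :
    P = 0 := by
  have hT : Matrix.toEuclideanLin P.transpose = 0 := by
    refine inner_map_self_eq_zero _ |>.1 fun v => ?_
    rw [← inner_conj_symm, map_eq_zero, ← h v]
    simp only [PiLp.inner_apply, Matrix.toEuclideanLin, Matrix.toLpLin_apply, Matrix.mulVec,
      dotProduct, Matrix.transpose_apply, RCLike.inner_apply, Finset.sum_mul]
    exact Finset.sum_comm
  have := (Matrix.toEuclideanLin (𝕜 := ℂ) (m := Fin m) (n := Fin m)).map_eq_zero_iff.1 hT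
  simpa using congrArg Matrix.transpose this

theorem contDiffAt_chartRep_basePt {f : M → N} (hf : IsSmoothMap (m := m) (n := n) f) (p : M) :
    ContDiffAt ℝ (⊤ : ℕ∞) (chartRep (m := m) (n := n) f p) (basePt p) := by
  have h := (contMDiffAt_iff.1 (hf p)).2
  simpa [chartRep, basePt, Function.comp_def, contDiffWithinAt_univ] using h

theorem covariantHessian_chartRep (gD : RiemannData n N) {f : M → N} {p : M}
    {z : EuclideanSpace ℂ (Fin m)} (hF : ContDiffAt ℝ 2 (chartRep (m := m) (n := n) f p) z)
    (v : EuclideanSpace ℂ (Fin m)) (i : Fin n) :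
    (((covariantHessian (christoffelForm (gD.g (f p)) (chartRep f p z)) (chartRep f p) z v
      + covariantHessian (christoffelForm (gD.g (f p)) (chartRep f p z)) (chartRep f p) z
        (Complex.I • v)) i : ℝ) : ℂ)
      = 4 * ∑ α, ∑ β, pluriTensor gD f p i α β z * v α * (starRingEnd ℂ) (v β) := by
  simp only [pluriTensor, wDeriv_eq_wDir, wDerivBar_eq_wDir]
  exact covariantHessian_add_I_smul (gD.symm (f p)) hF v i

theorem pluriTensor_eq_zero_of_mem (hD : HermitianData m M) (gD : RiemannData n N) {f : M → N}
    (hf : IsSmoothMap (m := m) (n := n) f) (hpluri : IsPluriHarmonic (m := m) gD f) (p : M)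
    {z : EuclideanSpace ℂ (Fin m)} (hz : z ∈ (chartAt (EuclideanSpace ℂ (Fin m)) p).target)
    (hfz : f ((chartAt (EuclideanSpace ℂ (Fin m)) p).symm z)
      ∈ (chartAt (EuclideanSpace ℝ (Fin n)) (f p)).source)
    (hF : ContDiffAt ℝ 2 (chartRep (m := m) (n := n) f p) z) (i : Fin n) (α β : Fin m) :
    pluriTensor gD f p i α β z = 0 := by
  set φ := chartAt (EuclideanSpace ℂ (Fin m)) p with hφ
  set q := φ.symm z with hq
  set ψ := chartAt (EuclideanSpace ℂ (Fin m)) q with hψ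
  set φ' := chartAt (EuclideanSpace ℝ (Fin n)) (f p) with hφ'
  set ψ' := chartAt (EuclideanSpace ℝ (Fin n)) (f q) with hψ'
  have hzτ : z ∈ (φ.symm.trans ψ).source := by
    rw [OpenPartialHomeomorph.trans_source]
    exact ⟨hz, mem_chart_source _ q⟩
  have hyθ : chartRep (m := m) (n := n) f p z ∈ (φ'.symm.trans ψ').source := by
    rw [OpenPartialHomeomorph.trans_source]
    refine ⟨φ'.map_source hfz, ?_⟩
    have : φ'.symm (chartRep (m := m) (n := n) f p z) = f q := φ'.left_inv hfz
    rw [Set.mem_preimage, this]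
    exact mem_chart_source _ (f q)
  have hτz : (φ.symm.trans ψ) z = basePt q := rfl
  have hθy : (φ'.symm.trans ψ') (chartRep (m := m) (n := n) f p z) = chartRep (m := m) (n := n) f q (basePt q) := by
    have h1 : φ'.symm (chartRep (m := m) (n := n) f p z) = f q := φ'.left_inv hfz
    have h2 : ψ.symm (basePt q) = q := ψ.left_inv (mem_chart_source _ q)
    simp only [OpenPartialHomeomorph.coe_trans, Function.comp_apply, h1]
    rw [chartRep, Function.comp_apply, Function.comp_apply, h2]
  have hF' : ContDiffAt ℝ 2 (chartRep (m := m) (n := n) f q) ((φ.symm.trans ψ) z) :=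
    (contDiffAt_chartRep_basePt hf q).of_le (WithTop.coe_le_coe.2 (le_top : (2 : ℕ∞) ≤ ⊤))
  have hτ : ∀ᶠ x in 𝓝 z, DifferentiableAt ℂ (φ.symm.trans ψ) x :=
    Filter.Eventually.mono ((φ.symm.trans ψ).open_source.mem_nhds hzτ) fun x hx =>
      hD.differentiableAt_transition p q hx
  have hcomm : ∀ᶠ x in 𝓝 z, chartRep (m := m) (n := n) f q ((φ.symm.trans ψ) x)
      = (φ'.symm.trans ψ') (chartRep (m := m) (n := n) f p x) := by
    have hcont : ContinuousAt (fun x => f (φ.symm x)) z :=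
      ContinuousAt.comp (g := f) hf.continuous.continuousAt (φ.continuousAt_symm hz)
    filter_upwards [(φ.symm.trans ψ).open_source.mem_nhds hzτ,
      hcont.preimage_mem_nhds (φ'.open_source.mem_nhds hfz)] with x hx hx'
    rw [OpenPartialHomeomorph.trans_source] at hx
    have h1 : ψ.symm ((φ.symm.trans ψ) x) = φ.symm x := ψ.left_inv hx.2
    have h2 : φ'.symm (chartRep (m := m) (n := n) f p x) = f (φ.symm x) := φ'.left_inv hx'
    simp only [OpenPartialHomeomorph.coe_trans (e := φ'.symm), Function.comp_apply, h2]
    rw [chartRep, Function.comp_apply, Function.comp_apply, h1]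
  obtain ⟨hinj, hexp⟩ := gD.transition_expansion (f p) (f q) hyθ rfl
  have hzero : ∀ v, covariantHessian (christoffelForm (gD.g (f p)) (chartRep f p z))
      (chartRep f p) z v + covariantHessian (christoffelForm (gD.g (f p)) (chartRep f p z))
      (chartRep f p) z (Complex.I • v) = 0 := by
    intro v
    obtain ⟨v', hv'⟩ := exists_covariantHessian_transform hF hF' hτ hcomm hexp v
    apply hinj
    rw [hv', map_zero, hθy, hτz]
    ext i
    rw [← Complex.ofReal_inj, covariantHessian_chartRep gD (hτz ▸ hF') v' i]
    simp only [hpluri q i]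
    simp
  have hP : (Matrix.of fun α β => pluriTensor gD f p i α β z) = 0 := by
    refine eq_zero_of_sesquilinear_self fun v => ?_
    have h := covariantHessian_chartRep gD hF v i
    rw [hzero v] at h
    simp only [Matrix.of_apply]
    have h4 : (4 : ℂ) ≠ 0 := by norm_num
    simpa [h4] using h.symm
  exact congrFun (congrFun hP α) β

end PluriharmonicNear
section SumPull

variable {ι : Type*} [Fintype ι] {A : Type*} [AddCommMonoid A]

theorem sum_pull_third {κ₁ κ₂ κ₃ : Type*} [Fintype κ₁] [Fintype κ₂] [Fintype κ₃]
    (T : κ₁ → κ₂ → κ₃ → A) :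
    ∑ i, ∑ j, ∑ k, T i j k = ∑ k, ∑ i, ∑ j, T i j k := by
  rw [Finset.sum_congr rfl fun i _ => Finset.sum_comm, Finset.sum_comm]

theorem sum_pull_fourth {κ₁ κ₂ κ₃ κ₄ : Type*} [Fintype κ₁] [Fintype κ₂] [Fintype κ₃] [Fintype κ₄]
    (T : κ₁ → κ₂ → κ₃ → κ₄ → A) :
    ∑ i, ∑ j, ∑ k, ∑ l, T i j k l = ∑ l, ∑ i, ∑ j, ∑ k, T i j k l := by
  rw [Finset.sum_congr rfl fun i _ => sum_pull_third _, Finset.sum_comm]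

theorem sum_swap_first_fourth (T : ι → ι → ι → ι → A) :
    ∑ i, ∑ j, ∑ k, ∑ l, T i j k l = ∑ i, ∑ j, ∑ k, ∑ l, T l j k i := by
  rw [sum_pull_fourth]
  exact Finset.sum_congr rfl fun i _ => (sum_pull_third fun j k l => T l j k i).symm

theorem sum_swap_second_fourth (T : ι → ι → ι → ι → A) :
    ∑ i, ∑ j, ∑ k, ∑ l, T i j k l = ∑ i, ∑ j, ∑ k, ∑ l, T i l k j := by
  refine Finset.sum_congr rfl fun i _ => ?_
  rw [sum_pull_third]
  exact Finset.sum_congr rfl fun j _ => Finset.sum_comm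

end SumPull

section PullbackConnection

open Filter Topology

variable {m n : ℕ}

/-- The complexified component `F^i` of a map between coordinate spaces. -/
def coordComp (F : EuclideanSpace ℂ (Fin m) → EuclideanSpace ℝ (Fin n)) (i : Fin n)
    (z : EuclideanSpace ℂ (Fin m)) : ℂ :=
  ((F z i : ℝ) : ℂ)

/-- The pull-back of the Levi-Civita connection of `g` by `F`, in the direction of `wDir c α`. -/
def covDir (g : EuclideanSpace ℝ (Fin n) → Matrix (Fin n) (Fin n) ℝ)
    (F : EuclideanSpace ℂ (Fin m) → EuclideanSpace ℝ (Fin n)) (c : ℂ) (α : Fin m)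
    (s : Fin n → EuclideanSpace ℂ (Fin m) → ℂ) (i : Fin n) (z : EuclideanSpace ℂ (Fin m)) : ℂ :=
  wDir c α (s i) z + ∑ j, ∑ k, (christoffel g i j k (F z) : ℂ) * wDir c α (coordComp F j) z * s k z

/-- The complex-bilinear extension of the metric. -/
def cPair (G : Matrix (Fin n) (Fin n) ℝ) (a b : Fin n → ℂ) : ℂ :=
  ∑ i, ∑ j, (G i j : ℂ) * a i * b j

/-- The complex-trilinear extension of the curvature operator `R(X,Y)Z`. -/
def cCurv (g : EuclideanSpace ℝ (Fin n) → Matrix (Fin n) (Fin n) ℝ) (y : EuclideanSpace ℝ (Fin n))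
    (X Y Z : Fin n → ℂ) (l : Fin n) : ℂ :=
  ∑ i, ∑ j, ∑ k, (riemannUp g i j k l y : ℂ) * X i * Y j * Z k

variable {g : EuclideanSpace ℝ (Fin n) → Matrix (Fin n) (Fin n) ℝ}
  {F : EuclideanSpace ℂ (Fin m) → EuclideanSpace ℝ (Fin n)} {z : EuclideanSpace ℂ (Fin m)}
  {c d : ℂ} {α β : Fin m}

theorem coordComp_contDiffAt {k : WithTop ℕ∞} (hF : ContDiffAt ℝ k F z) (i : Fin n) :
    ContDiffAt ℝ k (coordComp F i) z :=
  Complex.ofRealCLM.contDiff.contDiffAt.comp z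
    ((EuclideanSpace.proj (𝕜 := ℝ) i).contDiff.contDiffAt.comp z hF)

theorem comp_ofReal_contDiffAt {k : WithTop ℕ∞} (hF : ContDiffAt ℝ k F z)
    {φ : EuclideanSpace ℝ (Fin n) → ℝ} (hφ : ContDiffAt ℝ k φ (F z)) :
    ContDiffAt ℝ k (fun x => ((φ (F x) : ℝ) : ℂ)) z :=
  Complex.ofRealCLM.contDiff.contDiffAt.comp z (hφ.comp z hF)

theorem wDir_cPair (hs : ∀ y i j, g y i j = g y j i) (hy : IsUnit (g (F z)).det)
    (hg : ∀ i j, DifferentiableAt ℝ (fun y => g y i j) (F z)) (hF : DifferentiableAt ℝ F z)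
    {a b : Fin n → EuclideanSpace ℂ (Fin m) → ℂ} (ha : ∀ i, DifferentiableAt ℝ (a i) z)
    (hb : ∀ i, DifferentiableAt ℝ (b i) z) :
    wDir c α (fun x => cPair (g (F x)) (fun i => a i x) (fun i => b i x)) z
      = cPair (g (F z)) (fun i => covDir g F c α a i z) (fun i => b i z)
        + cPair (g (F z)) (fun i => a i z) (fun i => covDir g F c α b i z) := by
  have hgF : ∀ i j, DifferentiableAt ℝ (fun x => ((g (F x) i j : ℝ) : ℂ)) z := fun i j =>
    Complex.ofRealCLM.differentiableAt.comp z ((hg i j).comp z hF)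
  have hX : ∀ i j, wDir c α (fun x => ((g (F x) i j : ℝ) : ℂ)) z
      = ∑ k, ((∑ p, (christoffel g p k i (F z) : ℂ) * (g (F z) p j : ℂ))
        + ∑ p, (christoffel g p k j (F z) : ℂ) * (g (F z) i p : ℂ)) * wDir c α (coordComp F k) z := by
    intro i j
    rw [wDir_comp_real (φ := fun y => g y i j) hF (hg i j)]
    refine Finset.sum_congr rfl fun k _ => ?_
    rw [rDeriv_metric hs hy]
    push_cast
    congr 2 <;> congr 1 <;> ext p <;> rw [christoffel_symm hs p k]
    rw [hs _ i p]
  have e1 : ∀ i j, DifferentiableAt ℝ (fun x => ((g (F x) i j : ℝ) : ℂ) * a i x) z := fun i j =>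
    (hgF i j).mul (ha i)
  have e2 : ∀ i j, DifferentiableAt ℝ (fun x => ((g (F x) i j : ℝ) : ℂ) * a i x * b j x) z :=
    fun i j => (e1 i j).mul (hb j)
  have hL : wDir c α (fun x => cPair (g (F x)) (fun i => a i x) (fun i => b i x)) z
      = ∑ i, ∑ j, (wDir c α (fun x => ((g (F x) i j : ℝ) : ℂ)) z * a i z * b j z
        + (g (F z) i j : ℂ) * wDir c α (a i) z * b j z
        + (g (F z) i j : ℂ) * a i z * wDir c α (b j) z) := by
    unfold cPair
    rw [wDir_sum _ fun i _ => DifferentiableAt.fun_sum fun j _ => e2 i j]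
    refine Finset.sum_congr rfl fun i _ => ?_
    rw [wDir_sum _ fun j _ => e2 i j]
    refine Finset.sum_congr rfl fun j _ => ?_
    rw [wDir_mul (F := fun x => ((g (F x) i j : ℝ) : ℂ) * a i x) (G := b j) (e1 i j) (hb j),
      wDir_mul (F := fun x => ((g (F x) i j : ℝ) : ℂ)) (G := a i) (hgF i j) (ha i)]
    ring
  have hA : ∑ i, ∑ j, ∑ k, ∑ p, (christoffel g p k i (F z) : ℂ) * (g (F z) p j : ℂ)
        * wDir c α (coordComp F k) z * a i z * b j z
      = ∑ i, ∑ j, ∑ k, ∑ p, (christoffel g i k p (F z) : ℂ) * (g (F z) i j : ℂ)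
        * wDir c α (coordComp F k) z * a p z * b j z := sum_swap_first_fourth _
  have hB : ∑ i, ∑ j, ∑ k, ∑ p, (christoffel g p k j (F z) : ℂ) * (g (F z) i p : ℂ)
        * wDir c α (coordComp F k) z * a i z * b j z
      = ∑ i, ∑ j, ∑ k, ∑ p, (christoffel g j k p (F z) : ℂ) * (g (F z) i j : ℂ)
        * wDir c α (coordComp F k) z * a i z * b p z := sum_swap_second_fourth _
  rw [hL]
  simp only [hX]
  calc _ = (∑ i, ∑ j, (g (F z) i j : ℂ) * wDir c α (a i) z * b j z
        + ∑ i, ∑ j, ∑ k, ∑ p, (christoffel g p k i (F z) : ℂ) * (g (F z) p j : ℂ)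
          * wDir c α (coordComp F k) z * a i z * b j z)
        + (∑ i, ∑ j, (g (F z) i j : ℂ) * a i z * wDir c α (b j) z
        + ∑ i, ∑ j, ∑ k, ∑ p, (christoffel g p k j (F z) : ℂ) * (g (F z) i p : ℂ)
          * wDir c α (coordComp F k) z * a i z * b j z) := by
        simp only [← Finset.sum_add_distrib]
        refine Finset.sum_congr rfl fun i _ => Finset.sum_congr rfl fun j _ => ?_
        simp only [add_mul, Finset.sum_mul, Finset.sum_add_distrib]
        ring
    _ = _ := by
        rw [hA, hB]
        simp only [cPair, covDir, ← Finset.sum_add_distrib]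
        refine Finset.sum_congr rfl fun i _ => Finset.sum_congr rfl fun j _ => ?_
        simp only [mul_add, add_mul, Finset.mul_sum, Finset.sum_mul]
        congr 1 <;> congr 1 <;>
          refine Finset.sum_congr rfl fun k _ => Finset.sum_congr rfl fun p _ => ?_ <;> ring

theorem covDir_comm (hs : ∀ y i j, g y i j = g y j i) (hF : ContDiffAt ℝ 2 F z)
    (hΓ : ∀ i j k, DifferentiableAt ℝ (christoffel g i j k) (F z))
    {s : Fin n → EuclideanSpace ℂ (Fin m) → ℂ} (hs2 : ∀ i, ContDiffAt ℝ 2 (s i) z) (l : Fin n) :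
    covDir g F c α (covDir g F d β s) l z - covDir g F d β (covDir g F c α s) l z
      = cCurv g (F z) (fun i => wDir c α (coordComp F i) z) (fun i => wDir d β (coordComp F i) z)
        (fun i => s i z) l := by
  have hφ := coordComp_contDiffAt hF
  have hF1 : DifferentiableAt ℝ F z := hF.differentiableAt (by simp)
  have hΓF : ∀ i j k, DifferentiableAt ℝ (fun x => ((christoffel g i j k (F x) : ℝ) : ℂ)) z :=
    fun i j k => Complex.ofRealCLM.differentiableAt.comp z ((hΓ i j k).comp z hF1)
  have hw : ∀ {G : EuclideanSpace ℂ (Fin m) → ℂ}, ContDiffAt ℝ 2 G z → ∀ c α,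
      DifferentiableAt ℝ (wDir c α G) z := fun hG c α =>
    (wDir_contDiffAt (l := 1) hG (by norm_num)).differentiableAt (by norm_num)
  have hs1 : ∀ i, DifferentiableAt ℝ (s i) z := fun i => (hs2 i).differentiableAt (by simp)
  have key : ∀ c d α β, covDir g F c α (covDir g F d β s) l z
      = wDir c α (wDir d β (s l)) z
        + ∑ i, ∑ j, ∑ k, (rDeriv i (christoffel g l j k) (F z) : ℂ) * wDir c α (coordComp F i) z
          * wDir d β (coordComp F j) z * s k z
        + ∑ j, ∑ k, (christoffel g l j k (F z) : ℂ) * wDir c α (wDir d β (coordComp F j)) z * s k z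
        + ∑ j, ∑ k, (christoffel g l j k (F z) : ℂ) * (wDir d β (coordComp F j) z * wDir c α (s k) z
          + wDir c α (coordComp F j) z * wDir d β (s k) z)
        + ∑ i, ∑ j, ∑ k, (∑ p, (christoffel g l i p (F z) : ℂ) * (christoffel g p j k (F z) : ℂ))
          * wDir c α (coordComp F i) z * wDir d β (coordComp F j) z * s k z := by
    intro c d α β
    have h1 : wDir c α (covDir g F d β s l) z = wDir c α (wDir d β (s l)) z
        + ∑ j, ∑ k, ((∑ i, (rDeriv i (christoffel g l j k) (F z) : ℂ) * wDir c α (coordComp F i) z)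
            * wDir d β (coordComp F j) z * s k z
          + (christoffel g l j k (F z) : ℂ) * wDir c α (wDir d β (coordComp F j)) z * s k z
          + (christoffel g l j k (F z) : ℂ) * wDir d β (coordComp F j) z * wDir c α (s k) z) := by
      have hterm : ∀ j k, DifferentiableAt ℝ (fun x => (christoffel g l j k (F x) : ℂ)
          * wDir d β (coordComp F j) x * s k x) z := fun j k =>
        ((hΓF l j k).mul (hw (hφ j) d β)).mul (hs1 k)
      have hsum : ∀ j, DifferentiableAt ℝ (fun x => ∑ k, (christoffel g l j k (F x) : ℂ)
          * wDir d β (coordComp F j) x * s k x) z := fun j =>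
        DifferentiableAt.fun_sum fun k _ => hterm j k
      unfold covDir
      rw [wDir_add (hw (hs2 l) d β) (DifferentiableAt.fun_sum fun j _ => hsum j),
        wDir_sum _ fun j _ => hsum j]
      congr 1
      refine Finset.sum_congr rfl fun j _ => ?_
      rw [wDir_sum _ fun k _ => hterm j k]
      refine Finset.sum_congr rfl fun k _ => ?_
      have e1 : DifferentiableAt ℝ (fun x => (christoffel g l j k (F x) : ℂ)
          * wDir d β (coordComp F j) x) z := (hΓF l j k).mul (hw (hφ j) d β)
      rw [wDir_mul (F := fun x => (christoffel g l j k (F x) : ℂ) * wDir d β (coordComp F j) x)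
          (G := s k) e1 (hs1 k),
        wDir_mul (F := fun x => (christoffel g l j k (F x) : ℂ)) (G := wDir d β (coordComp F j))
          (hΓF l j k) (hw (hφ j) d β), wDir_comp_real (φ := christoffel g l j k) hF1 (hΓ l j k)]
      simp only [add_mul]
      rfl
    have h2 : ∑ j, ∑ k, (christoffel g l j k (F z) : ℂ) * wDir c α (coordComp F j) z
          * covDir g F d β s k z
        = ∑ j, ∑ k, (christoffel g l j k (F z) : ℂ)
            * (wDir c α (coordComp F j) z * wDir d β (s k) z)
          + ∑ i, ∑ j, ∑ k, (∑ p, (christoffel g l i p (F z) : ℂ) * (christoffel g p j k (F z) : ℂ))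
            * wDir c α (coordComp F i) z * wDir d β (coordComp F j) z * s k z := by
      rw [← Finset.sum_add_distrib]
      refine Finset.sum_congr rfl fun i _ => ?_
      simp only [covDir, Finset.mul_sum, Finset.sum_mul, mul_add, Finset.sum_add_distrib]
      congr 1
      · exact Finset.sum_congr rfl fun _ _ => by ring
      · rw [Finset.sum_comm, Finset.sum_congr rfl fun j _ => Finset.sum_comm]
        exact Finset.sum_congr rfl fun _ _ => Finset.sum_congr rfl fun _ _ =>
          Finset.sum_congr rfl fun _ _ => by ring
    have h3 : ∑ j, ∑ k, (∑ i, (rDeriv i (christoffel g l j k) (F z) : ℂ)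
            * wDir c α (coordComp F i) z) * wDir d β (coordComp F j) z * s k z
        = ∑ i, ∑ j, ∑ k, (rDeriv i (christoffel g l j k) (F z) : ℂ) * wDir c α (coordComp F i) z
          * wDir d β (coordComp F j) z * s k z := by
      simp only [Finset.sum_mul]
      exact sum_pull_third _
    rw [covDir, h1, h2]
    simp only [mul_add, Finset.sum_add_distrib, h3]
    simp only [mul_assoc]
    ring
  rw [key c d α β, key d c β α, wDir_comm (hs2 l)]
  have hsw : ∀ j, wDir d β (wDir c α (coordComp F j)) z = wDir c α (wDir d β (coordComp F j)) z :=
    fun j => wDir_comm (hφ j)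
  simp only [hsw]
  have e1 : ∑ i, ∑ j, ∑ k, (rDeriv i (christoffel g l j k) (F z) : ℂ)
        * wDir d β (coordComp F i) z * wDir c α (coordComp F j) z * s k z
      = ∑ i, ∑ j, ∑ k, (rDeriv j (christoffel g l i k) (F z) : ℂ)
        * wDir d β (coordComp F j) z * wDir c α (coordComp F i) z * s k z := Finset.sum_comm
  have e2 : ∑ i, ∑ j, ∑ k, (∑ p, (christoffel g l i p (F z) : ℂ) * (christoffel g p j k (F z) : ℂ))
        * wDir d β (coordComp F i) z * wDir c α (coordComp F j) z * s k z
      = ∑ i, ∑ j, ∑ k, (∑ p, (christoffel g l j p (F z) : ℂ) * (christoffel g p i k (F z) : ℂ))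
        * wDir d β (coordComp F j) z * wDir c α (coordComp F i) z * s k z := Finset.sum_comm
  have e3 : ∑ j, ∑ k, (christoffel g l j k (F z) : ℂ)
        * (wDir d β (coordComp F j) z * wDir c α (s k) z
          + wDir c α (coordComp F j) z * wDir d β (s k) z)
      = ∑ j, ∑ k, (christoffel g l j k (F z) : ℂ)
        * (wDir c α (coordComp F j) z * wDir d β (s k) z
          + wDir d β (coordComp F j) z * wDir c α (s k) z) :=
    Finset.sum_congr rfl fun _ _ => Finset.sum_congr rfl fun _ _ => by ring
  have hfun : ∀ i j k, christoffel g i j k = christoffel g i k j := fun i j k =>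
    funext fun y => christoffel_symm hs i j k
  rw [e1, e2, e3]
  calc _ = (∑ i, ∑ j, ∑ k, (rDeriv i (christoffel g l j k) (F z) : ℂ)
          * wDir c α (coordComp F i) z * wDir d β (coordComp F j) z * s k z
        - ∑ i, ∑ j, ∑ k, (rDeriv j (christoffel g l i k) (F z) : ℂ)
          * wDir d β (coordComp F j) z * wDir c α (coordComp F i) z * s k z)
      + (∑ i, ∑ j, ∑ k, (∑ p, (christoffel g l i p (F z) : ℂ) * (christoffel g p j k (F z) : ℂ))
          * wDir c α (coordComp F i) z * wDir d β (coordComp F j) z * s k z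
        - ∑ i, ∑ j, ∑ k, (∑ p, (christoffel g l j p (F z) : ℂ) * (christoffel g p i k (F z) : ℂ))
          * wDir d β (coordComp F j) z * wDir c α (coordComp F i) z * s k z) := by ring
    _ = _ := by
        simp only [cCurv, ← Finset.sum_add_distrib, ← Finset.sum_sub_distrib]
        refine Finset.sum_congr rfl fun i _ => Finset.sum_congr rfl fun j _ =>
          Finset.sum_congr rfl fun k _ => ?_
        have r1 : ∑ p, christoffel g p k j (F z) * christoffel g l p i (F z)
            = ∑ p, christoffel g l i p (F z) * christoffel g p j k (F z) :=
          Finset.sum_congr rfl fun p _ => by rw [hfun p k j, hfun l p i, mul_comm]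
        have r2 : ∑ p, christoffel g p k i (F z) * christoffel g l p j (F z)
            = ∑ p, christoffel g l j p (F z) * christoffel g p i k (F z) :=
          Finset.sum_congr rfl fun p _ => by rw [hfun p k i, hfun l p j, mul_comm]
        rw [riemannUp, r1, r2, hfun l k j, hfun l k i]
        push_cast
        ring

end PullbackConnection
section HermitianContraction

open Filter Topology

variable {m : ℕ} {h : EuclideanSpace ℂ (Fin m) → Matrix (Fin m) (Fin m) ℂ}
  {z : EuclideanSpace ℂ (Fin m)} {c : ℂ} {α : Fin m}

/-- The coefficients of the connection with `∂h = Γ h`, in the direction of `wDir c α`. -/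
def chernLeft (h : EuclideanSpace ℂ (Fin m) → Matrix (Fin m) (Fin m) ℂ) (c : ℂ) (α γ μ : Fin m)
    (z : EuclideanSpace ℂ (Fin m)) : ℂ :=
  ∑ δ, (h z)⁻¹ δ μ * wDir c α (fun x => h x γ δ) z

/-- The coefficients of the connection with `∂h = h Γ`, in the direction of `wDir c α`. -/
def chernRight (h : EuclideanSpace ℂ (Fin m) → Matrix (Fin m) (Fin m) ℂ) (c : ℂ) (α ν μ : Fin m)
    (z : EuclideanSpace ℂ (Fin m)) : ℂ :=
  ∑ δ, (h z)⁻¹ μ δ * wDir c α (fun x => h x δ ν) z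

theorem eventually_isUnit_det (hh : ∀ a b, ContinuousAt (fun x => h x a b) z)
    (hz : IsUnit (h z).det) : ∀ᶠ x in 𝓝 z, IsUnit (h x).det := by
  have hc : ContinuousAt (fun x => (h x).det) z := by
    simp only [Matrix.det_apply]
    fun_prop
  filter_upwards [hc.eventually_ne hz.ne_zero] with x hx using isUnit_iff_ne_zero.2 hx

theorem wDir_matrix_inv (hh : ∀ a b, ContDiffAt ℝ 1 (fun x => h x a b) z)
    (hz : IsUnit (h z).det) (i j : Fin m) :
    wDir c α (fun x => (h x)⁻¹ i j) z
      = -∑ a, ∑ b, (h z)⁻¹ i a * wDir c α (fun x => h x a b) z * (h z)⁻¹ b j := by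
  have hi : ∀ a b, DifferentiableAt ℝ (fun x => (h x)⁻¹ a b) z := fun a b =>
    (contDiffAt_matrix_inv_apply hh hz a b).differentiableAt one_ne_zero
  have hd : ∀ a b, DifferentiableAt ℝ (fun x => h x a b) z := fun a b =>
    (hh a b).differentiableAt one_ne_zero
  let D : Matrix (Fin m) (Fin m) ℂ := fun a b => wDir c α (fun x => h x a b) z
  let D' : Matrix (Fin m) (Fin m) ℂ := fun a b => wDir c α (fun x => (h x)⁻¹ a b) z
  have key : D' * h z + (h z)⁻¹ * D = 0 := by
    ext a b
    have e : (fun x => ∑ k, (h x)⁻¹ a k * h x k b) =ᶠ[𝓝 z]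
        fun _ => (1 : Matrix (Fin m) (Fin m) ℂ) a b := by
      filter_upwards [eventually_isUnit_det (fun a b => (hh a b).continuousAt) hz] with x hx
      rw [← Matrix.mul_apply, Matrix.nonsing_inv_mul _ hx]
    have h1 := wDir_congr (c := c) (α := α) e
    rw [wDir_const, wDir_sum _ fun k _ => DifferentiableAt.fun_mul (hi a k) (hd k b)] at h1
    rw [Matrix.add_apply, Matrix.mul_apply, Matrix.mul_apply, ← Finset.sum_add_distrib,
      Matrix.zero_apply, ← h1]
    refine Finset.sum_congr rfl fun k _ => ?_
    rw [wDir_mul (F := fun x => (h x)⁻¹ a k) (G := fun x => h x k b) (hi a k) (hd k b)]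
  have key2 : D' = -((h z)⁻¹ * D * (h z)⁻¹) := by
    calc D' = D' * h z * (h z)⁻¹ := by
          rw [Matrix.mul_assoc, Matrix.mul_nonsing_inv _ hz, Matrix.mul_one]
      _ = _ := by rw [eq_neg_of_add_eq_zero_left key, Matrix.neg_mul]
  have := congrFun (congrFun key2 i) j
  rw [Matrix.neg_apply, Matrix.mul_apply] at this
  simp only [Matrix.mul_apply, Finset.sum_mul] at this
  rw [Finset.sum_comm] at this
  exact this

variable {P : Fin m → Fin m → EuclideanSpace ℂ (Fin m) → ℂ}

theorem wDir_contract (hh : ∀ a b, ContDiffAt ℝ 1 (fun x => h x a b) z)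
    (hz : IsUnit (h z).det) (hP : ∀ γ ν, DifferentiableAt ℝ (P γ ν) z) :
    wDir c α (fun x => ∑ γ, ∑ ν, (h x)⁻¹ ν γ * P γ ν x) z
      = ∑ γ, ∑ ν, (h z)⁻¹ ν γ * wDir c α (P γ ν) z
        - ∑ γ, ∑ ν, ∑ a, ∑ b, (h z)⁻¹ ν a * wDir c α (fun x => h x a b) z * (h z)⁻¹ b γ
          * P γ ν z := by
  have hi : ∀ a b, DifferentiableAt ℝ (fun x => (h x)⁻¹ a b) z := fun a b =>
    (contDiffAt_matrix_inv_apply hh hz a b).differentiableAt one_ne_zero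
  have e : ∀ γ ν, DifferentiableAt ℝ (fun x => (h x)⁻¹ ν γ * P γ ν x) z := fun γ ν =>
    (hi ν γ).fun_mul (hP γ ν)
  rw [wDir_sum _ fun γ _ => DifferentiableAt.fun_sum fun ν _ => e γ ν, ← Finset.sum_sub_distrib]
  refine Finset.sum_congr rfl fun γ _ => ?_
  rw [wDir_sum _ fun ν _ => e γ ν, ← Finset.sum_sub_distrib]
  refine Finset.sum_congr rfl fun ν _ => ?_
  rw [wDir_mul (F := fun x => (h x)⁻¹ ν γ) (G := P γ ν) (hi ν γ) (hP γ ν),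
    wDir_matrix_inv hh hz]
  simp only [neg_mul, Finset.sum_mul]
  ring

theorem wDir_contract_left (hh : ∀ a b, ContDiffAt ℝ 1 (fun x => h x a b) z)
    (hz : IsUnit (h z).det) (hP : ∀ γ ν, DifferentiableAt ℝ (P γ ν) z) :
    wDir c α (fun x => ∑ γ, ∑ ν, (h x)⁻¹ ν γ * P γ ν x) z
      = ∑ γ, ∑ ν, (h z)⁻¹ ν γ * (wDir c α (P γ ν) z - ∑ μ, chernLeft h c α γ μ z * P μ ν z) := by
  rw [wDir_contract hh hz hP]
  simp only [mul_sub, Finset.sum_sub_distrib]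
  congr 1
  have : ∑ γ, ∑ ν, ∑ a, ∑ b, (h z)⁻¹ ν a * wDir c α (fun x => h x a b) z * (h z)⁻¹ b γ * P γ ν z
      = ∑ a, ∑ ν, ∑ γ, ∑ b, (h z)⁻¹ ν a * wDir c α (fun x => h x a b) z * (h z)⁻¹ b γ
        * P γ ν z := by
    rw [sum_pull_third]
    exact Finset.sum_congr rfl fun _ _ => Finset.sum_comm
  rw [this]
  refine Finset.sum_congr rfl fun γ _ => Finset.sum_congr rfl fun ν _ => ?_
  rw [Finset.mul_sum]
  refine Finset.sum_congr rfl fun μ _ => ?_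
  rw [chernLeft, Finset.sum_mul, Finset.mul_sum]
  exact Finset.sum_congr rfl fun _ _ => by ring

theorem wDir_contract_right (hh : ∀ a b, ContDiffAt ℝ 1 (fun x => h x a b) z)
    (hz : IsUnit (h z).det) (hP : ∀ γ ν, DifferentiableAt ℝ (P γ ν) z) :
    wDir c α (fun x => ∑ γ, ∑ ν, (h x)⁻¹ ν γ * P γ ν x) z
      = ∑ γ, ∑ ν, (h z)⁻¹ ν γ * (wDir c α (P γ ν) z - ∑ μ, chernRight h c α ν μ z * P γ μ z) := by
  rw [wDir_contract hh hz hP]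
  simp only [mul_sub, Finset.sum_sub_distrib]
  congr 1
  refine Finset.sum_congr rfl fun γ _ => ?_
  rw [sum_pull_third]
  refine Finset.sum_congr rfl fun ν _ => ?_
  rw [Finset.mul_sum]
  refine Finset.sum_congr rfl fun μ _ => ?_
  rw [chernRight, Finset.sum_mul, Finset.mul_sum]
  exact Finset.sum_congr rfl fun _ _ => by ring

/-- The curvature of the Chern connection in terms of `wDir`. -/
def chernCoord (h : EuclideanSpace ℂ (Fin m) → Matrix (Fin m) (Fin m) ℂ) (α β γ δ : Fin m)
    (z : EuclideanSpace ℂ (Fin m)) : ℂ :=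
  -wDir (-I) α (wDir I β (fun x => h x γ δ)) z
    + ∑ μ, ∑ ν, (h z)⁻¹ ν μ * wDir (-I) α (fun x => h x γ ν) z * wDir I β (fun x => h x μ δ) z

theorem wDir_chernLeft (hh : ∀ a b, ContDiffAt ℝ 2 (fun x => h x a b) z)
    (hz : IsUnit (h z).det) (α β γ μ : Fin m) :
    wDir I β (chernLeft h (-I) α γ μ) z = -∑ δ, (h z)⁻¹ δ μ * chernCoord h α β γ δ z := by
  have hh1 : ∀ a b, ContDiffAt ℝ 1 (fun x => h x a b) z := fun a b =>
    (hh a b).of_le one_le_two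
  have hi : ∀ a b, DifferentiableAt ℝ (fun x => (h x)⁻¹ a b) z := fun a b =>
    (contDiffAt_matrix_inv_apply hh1 hz a b).differentiableAt one_ne_zero
  have hw : ∀ a b, DifferentiableAt ℝ (wDir (-I) α (fun x => h x a b)) z := fun a b =>
    (wDir_contDiffAt (l := 1) (hh a b) (by norm_num)).differentiableAt one_ne_zero
  unfold chernLeft
  rw [wDir_sum _ fun δ _ => (hi δ μ).fun_mul (hw γ δ)]
  have e : ∀ δ, wDir I β (fun x => (h x)⁻¹ δ μ * wDir (-I) α (fun x => h x γ δ) x) z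
      = (h z)⁻¹ δ μ * wDir (-I) α (wDir I β (fun x => h x γ δ)) z
        - ∑ a, ∑ b, (h z)⁻¹ δ a * wDir I β (fun x => h x a b) z * (h z)⁻¹ b μ
          * wDir (-I) α (fun x => h x γ δ) z := by
    intro δ
    rw [wDir_mul (F := fun x => (h x)⁻¹ δ μ) (G := wDir (-I) α (fun x => h x γ δ)) (hi δ μ)
      (hw γ δ), wDir_matrix_inv hh1 hz, wDir_comm (hh γ δ)]
    simp only [neg_mul, Finset.sum_mul]
    ring
  simp only [e, Finset.sum_sub_distrib, chernCoord, mul_add, Finset.sum_add_distrib, mul_neg,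
    Finset.sum_neg_distrib]
  rw [sum_pull_third]
  have : ∑ δ, (h z)⁻¹ δ μ * ∑ a, ∑ b, (h z)⁻¹ b a * wDir (-I) α (fun x => h x γ b) z
        * wDir I β (fun x => h x a δ) z
      = ∑ k, ∑ i, ∑ j, (h z)⁻¹ i j * wDir I β (fun x => h x j k) z * (h z)⁻¹ k μ
        * wDir (-I) α (fun x => h x γ i) z := by
    refine Finset.sum_congr rfl fun δ _ => ?_
    rw [Finset.sum_comm, Finset.mul_sum]
    refine Finset.sum_congr rfl fun _ _ => ?_
    rw [Finset.mul_sum]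
    exact Finset.sum_congr rfl fun _ _ => by ring
  rw [this]
  ring

end HermitianContraction

section BilinearExtension

variable {m n : ℕ} {g : EuclideanSpace ℝ (Fin n) → Matrix (Fin n) (Fin n) ℝ}
  {y : EuclideanSpace ℝ (Fin n)}

theorem cPair_sub_sum_left (G : Matrix (Fin n) (Fin n) ℝ) (s : Fin n → ℂ) (f : Fin m → ℂ)
    (t : Fin m → Fin n → ℂ) (b : Fin n → ℂ) :
    cPair G (fun i => s i - ∑ μ, f μ * t μ i) b = cPair G s b - ∑ μ, f μ * cPair G (t μ) b := by
  simp only [cPair, mul_sub, sub_mul, Finset.sum_sub_distrib, Finset.mul_sum, Finset.sum_mul]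
  rw [sum_pull_third]
  congr 1
  exact Finset.sum_congr rfl fun _ _ => Finset.sum_congr rfl fun _ _ =>
    Finset.sum_congr rfl fun _ _ => by ring

theorem cPair_sub_sum_right (G : Matrix (Fin n) (Fin n) ℝ) (s : Fin n → ℂ) (f : Fin m → ℂ)
    (t : Fin m → Fin n → ℂ) (b : Fin n → ℂ) :
    cPair G b (fun i => s i - ∑ μ, f μ * t μ i) = cPair G b s - ∑ μ, f μ * cPair G b (t μ) := by
  simp only [cPair, mul_sub, Finset.sum_sub_distrib, Finset.mul_sum]
  rw [sum_pull_third]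
  congr 1
  exact Finset.sum_congr rfl fun _ _ => Finset.sum_congr rfl fun _ _ =>
    Finset.sum_congr rfl fun _ _ => by ring

theorem cPair_zero_right (G : Matrix (Fin n) (Fin n) ℝ) (a : Fin n → ℂ) :
    cPair G a (fun _ => 0) = 0 := by
  simp [cPair]

theorem cPair_zero_left (G : Matrix (Fin n) (Fin n) ℝ) (a : Fin n → ℂ) :
    cPair G (fun _ => 0) a = 0 := by
  simp [cPair]

theorem cPair_cCurv (X Y Z W : Fin n → ℂ) :
    cPair (g y) (cCurv g y X Y Z) W
      = ∑ i, ∑ j, ∑ k, ∑ l, (riemannLo g i j k l y : ℂ) * X i * Y j * Z k * W l := by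
  simp only [cPair, cCurv, riemannLo, Finset.mul_sum, Finset.sum_mul, Complex.ofReal_sum]
  have e : ∀ T : Fin n → Fin n → Fin n → Fin n → Fin n → ℂ,
      ∑ s, ∑ l, ∑ i, ∑ j, ∑ k, T s l i j k = ∑ i, ∑ j, ∑ k, ∑ l, ∑ s, T s l i j k := by
    intro T
    rw [sum_pull_third]
    refine Finset.sum_congr rfl fun i _ => ?_
    rw [sum_pull_third]
    refine Finset.sum_congr rfl fun j _ => ?_
    rw [sum_pull_third]
    exact Finset.sum_congr rfl fun k _ => Finset.sum_comm
  rw [e]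
  refine Finset.sum_congr rfl fun _ _ => Finset.sum_congr rfl fun _ _ =>
    Finset.sum_congr rfl fun _ _ => Finset.sum_congr rfl fun _ _ =>
    Finset.sum_congr rfl fun _ _ => ?_
  push_cast
  ring

theorem cPair_cCurv_swap (X Y Z W : Fin n → ℂ) :
    cPair (g y) (cCurv g y X Y Z) W = -cPair (g y) (cCurv g y Y X Z) W := by
  rw [cPair_cCurv, cPair_cCurv, Finset.sum_comm]
  simp only [← Finset.sum_neg_distrib]
  refine Finset.sum_congr rfl fun j _ => Finset.sum_congr rfl fun i _ =>
    Finset.sum_congr rfl fun k _ => Finset.sum_congr rfl fun l _ => ?_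
  have : riemannLo g i j k l y = -riemannLo g j i k l y := by
    simp only [riemannLo, ← Finset.sum_neg_distrib]
    exact Finset.sum_congr rfl fun s _ => by rw [riemannUp_swap, mul_neg]
  rw [this]
  push_cast
  ring

theorem cPair_cCurv_antisymm (hs : ∀ y i j, g y i j = g y j i)
    (hg : ∀ i j, ContDiffAt ℝ 2 (fun y => g y i j) y) (hy : IsUnit (g y).det)
    (X Y Z W : Fin n → ℂ) :
    cPair (g y) (cCurv g y X Y Z) W = -cPair (g y) (cCurv g y X Y W) Z := by
  rw [cPair_cCurv, cPair_cCurv]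
  simp only [← Finset.sum_neg_distrib]
  refine Finset.sum_congr rfl fun i _ => Finset.sum_congr rfl fun j _ => ?_
  rw [Finset.sum_comm]
  refine Finset.sum_congr rfl fun l _ => Finset.sum_congr rfl fun k _ => ?_
  rw [riemannLo_antisymm hs hg hy i j l k]
  push_cast
  ring

theorem cPair_cCurv_bianchi (hs : ∀ y i j, g y i j = g y j i) (X Y Z W : Fin n → ℂ) :
    cPair (g y) (cCurv g y X Y Z) W + cPair (g y) (cCurv g y Y Z X) W
      + cPair (g y) (cCurv g y Z X Y) W = 0 := by
  rw [cPair_cCurv, cPair_cCurv, cPair_cCurv, sum_pull_third (κ₁ := Fin n)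
    (T := fun j k i => ∑ l, (riemannLo g j k i l y : ℂ) * Y j * Z k * X i * W l),
    ← sum_pull_third (κ₃ := Fin n)
    (T := fun i j k => ∑ l, (riemannLo g k i j l y : ℂ) * Z k * X i * Y j * W l)]
  simp only [← Finset.sum_add_distrib]
  refine Finset.sum_eq_zero fun i _ => Finset.sum_eq_zero fun j _ =>
    Finset.sum_eq_zero fun k _ => Finset.sum_eq_zero fun l _ => ?_
  have h : (riemannLo g i j k l y + riemannLo g j k i l y + riemannLo g k i j l y : ℂ) = 0 := by
    exact_mod_cast riemannLo_bianchi hs i j k l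
  linear_combination X i * Y j * Z k * W l * h

/-- If the curvature operator in the plane of `X` and `B` kills `A`, the first Bianchi identity
exchanges the remaining arguments. -/
theorem cPair_cCurv_of_flat (hs : ∀ y i j, g y i j = g y j i)
    (hg : ∀ i j, ContDiffAt ℝ 2 (fun y => g y i j) y) (hy : IsUnit (g y).det)
    {X B A : Fin n → ℂ} (hflat : ∀ l, cCurv g y X B A l = 0) (C : Fin n → ℂ) :
    cPair (g y) (cCurv g y X A C) B = -cPair (g y) (cCurv g y A B C) X := by
  have h0 : cPair (g y) (cCurv g y X B A) C = 0 := by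
    rw [funext hflat, cPair_zero_left]
  have h1 := cPair_cCurv_bianchi (y := y) hs A X B C
  have h2 := cPair_cCurv_swap (g := g) (y := y) X A C B
  have h3 := cPair_cCurv_antisymm hs hg hy A X C B
  have h4 := cPair_cCurv_swap (g := g) (y := y) B A X C
  have h5 := cPair_cCurv_antisymm hs hg hy A B X C
  linear_combination h2 - h3 - h0 + h1 - h4 + h5

end BilinearExtension

section SecondFundamentalForm

open Filter Topology

variable {m n : ℕ} {g : EuclideanSpace ℝ (Fin n) → Matrix (Fin n) (Fin n) ℝ}
  {h : EuclideanSpace ℂ (Fin m) → Matrix (Fin m) (Fin m) ℂ}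
  {F : EuclideanSpace ℂ (Fin m) → EuclideanSpace ℝ (Fin n)} {z : EuclideanSpace ℂ (Fin m)}
  {c d : ℂ} {α β : Fin m}

theorem covDir_congr {s t : Fin n → EuclideanSpace ℂ (Fin m) → ℂ} (hst : ∀ i, s i =ᶠ[𝓝 z] t i)
    (i : Fin n) : covDir g F c α s i z = covDir g F c α t i z := by
  simp only [covDir, wDir_congr (hst i), fun k => (hst k).eq_of_nhds]

theorem covDir_zero (i : Fin n) : covDir g F c α (fun _ _ => 0) i z = 0 := by
  simp [covDir]

theorem covDir_sub_sum {t : Fin n → EuclideanSpace ℂ (Fin m) → ℂ}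
    {f : Fin m → EuclideanSpace ℂ (Fin m) → ℂ} {s : Fin m → Fin n → EuclideanSpace ℂ (Fin m) → ℂ}
    (ht : ∀ i, DifferentiableAt ℝ (t i) z) (hf : ∀ μ, DifferentiableAt ℝ (f μ) z)
    (hs : ∀ μ i, DifferentiableAt ℝ (s μ i) z) (i : Fin n) :
    covDir g F c α (fun i x => t i x - ∑ μ, f μ x * s μ i x) i z
      = covDir g F c α t i z - ∑ μ, wDir c α (f μ) z * s μ i z
        - ∑ μ, f μ z * covDir g F c α (s μ) i z := by
  have e : ∀ μ, DifferentiableAt ℝ (fun x => f μ x * s μ i x) z := fun μ =>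
    (hf μ).fun_mul (hs μ i)
  simp only [covDir]
  rw [wDir_sub (ht i) (DifferentiableAt.fun_sum fun μ _ => e μ), wDir_sum _ fun μ _ => e μ]
  simp only [fun μ => wDir_mul (c := c) (α := α) (hf μ) (hs μ i), mul_sub, Finset.mul_sum, mul_add,
    Finset.sum_sub_distrib, Finset.sum_add_distrib]
  rw [sum_pull_third]
  have : ∑ k, ∑ i_1, ∑ j, (christoffel g i i_1 j (F z) : ℂ) * wDir c α (coordComp F i_1) z
        * (f k z * s k j z)
      = ∑ x, ∑ x_1, ∑ i_1, f x z * ((christoffel g i x_1 i_1 (F z) : ℂ)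
        * wDir c α (coordComp F x_1) z * s x i_1 z) :=
    Finset.sum_congr rfl fun _ _ => Finset.sum_congr rfl fun _ _ =>
      Finset.sum_congr rfl fun _ _ => by ring
  rw [this]
  ring

theorem covDir_contDiffAt {k l : WithTop ℕ∞} (hF : ContDiffAt ℝ k F z) (hkl : l + 1 ≤ k)
    (hΓ : ∀ i j k, ContDiffAt ℝ l (christoffel g i j k) (F z))
    {s : Fin n → EuclideanSpace ℂ (Fin m) → ℂ} (hs : ∀ i, ContDiffAt ℝ k (s i) z) (i : Fin n) :
    ContDiffAt ℝ l (covDir g F c α s i) z := by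
  have hlk : l ≤ k := le_self_add.trans hkl
  unfold covDir
  exact (wDir_contDiffAt (hs i) hkl).add <| ContDiffAt.sum fun j _ => ContDiffAt.sum fun p _ =>
    ((comp_ofReal_contDiffAt (hF.of_le hlk) (hΓ i j p)).mul
      (wDir_contDiffAt (coordComp_contDiffAt hF j) hkl)).mul ((hs p).of_le hlk)

/-- The mixed covariant derivatives of the differential commute. -/
theorem covDir_wDir_comm (hs : ∀ y i j, g y i j = g y j i) (hF : ContDiffAt ℝ 2 F z) (i : Fin n) :
    covDir g F c α (fun i => wDir d β (coordComp F i)) i z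
      = covDir g F d β (fun i => wDir c α (coordComp F i)) i z := by
  simp only [covDir]
  rw [wDir_comm (coordComp_contDiffAt hF i), Finset.sum_comm]
  congr 1
  refine Finset.sum_congr rfl fun j _ => Finset.sum_congr rfl fun k _ => ?_
  rw [christoffel_symm hs]
  ring

/-- The components of `∂_F ∂f`. -/
def secondForm (g : EuclideanSpace ℝ (Fin n) → Matrix (Fin n) (Fin n) ℝ)
    (h : EuclideanSpace ℂ (Fin m) → Matrix (Fin m) (Fin m) ℂ)
    (F : EuclideanSpace ℂ (Fin m) → EuclideanSpace ℝ (Fin n)) (α γ : Fin m) (i : Fin n)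
    (z : EuclideanSpace ℂ (Fin m)) : ℂ :=
  covDir g F (-I) α (fun i => wDir (-I) γ (coordComp F i)) i z
    - ∑ μ, chernLeft h (-I) α γ μ z * wDir (-I) μ (coordComp F i) z

/-- The components of the conjugate of `∂_F ∂f`. -/
def secondFormBar (g : EuclideanSpace ℝ (Fin n) → Matrix (Fin n) (Fin n) ℝ)
    (h : EuclideanSpace ℂ (Fin m) → Matrix (Fin m) (Fin m) ℂ)
    (F : EuclideanSpace ℂ (Fin m) → EuclideanSpace ℝ (Fin n)) (β ν : Fin m) (i : Fin n)
    (z : EuclideanSpace ℂ (Fin m)) : ℂ :=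
  covDir g F I β (fun i => wDir I ν (coordComp F i)) i z
    - ∑ μ, chernRight h I β ν μ z * wDir I μ (coordComp F i) z

/-- The energy density `|∂f|²`. -/
def delEnergy (g : EuclideanSpace ℝ (Fin n) → Matrix (Fin n) (Fin n) ℝ)
    (h : EuclideanSpace ℂ (Fin m) → Matrix (Fin m) (Fin m) ℂ)
    (F : EuclideanSpace ℂ (Fin m) → EuclideanSpace ℝ (Fin n)) (z : EuclideanSpace ℂ (Fin m)) : ℂ :=
  ∑ γ, ∑ ν, (h z)⁻¹ ν γ * cPair (g (F z)) (fun i => wDir (-I) γ (coordComp F i) z)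
    (fun i => wDir I ν (coordComp F i) z)

theorem cPair_differentiableAt (hF : DifferentiableAt ℝ F z)
    (hg : ∀ i j, DifferentiableAt ℝ (fun y => g y i j) (F z))
    {a b : Fin n → EuclideanSpace ℂ (Fin m) → ℂ} (ha : ∀ i, DifferentiableAt ℝ (a i) z)
    (hb : ∀ i, DifferentiableAt ℝ (b i) z) :
    DifferentiableAt ℝ (fun x => cPair (g (F x)) (fun i => a i x) (fun i => b i x)) z := by
  unfold cPair
  exact DifferentiableAt.fun_sum fun i _ => DifferentiableAt.fun_sum fun j _ =>
    ((Complex.ofRealCLM.differentiableAt.comp z ((hg i j).comp z hF)).fun_mul (ha i)).fun_mul (hb j)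

theorem wDir_delEnergy (hs : ∀ y i j, g y i j = g y j i) (hF : ContDiffAt ℝ 2 F z)
    (hg : ∀ i j, ContDiffAt ℝ 1 (fun y => g y i j) (F z)) (hgd : IsUnit (g (F z)).det)
    (hh : ∀ a b, ContDiffAt ℝ 1 (fun x => h x a b) z) (hz : IsUnit (h z).det)
    (hp : ∀ i ν, covDir g F (-I) α (fun i => wDir I ν (coordComp F i)) i z = 0) :
    wDir (-I) α (delEnergy g h F) z
      = ∑ γ, ∑ ν, (h z)⁻¹ ν γ * cPair (g (F z)) (fun i => secondForm g h F α γ i z)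
          (fun i => wDir I ν (coordComp F i) z) := by
  have hw : ∀ c γ i, DifferentiableAt ℝ (wDir c γ (coordComp F i)) z := fun c γ i =>
    (wDir_contDiffAt (l := 1) (coordComp_contDiffAt hF i) (by norm_num)).differentiableAt
      one_ne_zero
  have hF1 : DifferentiableAt ℝ F z := hF.differentiableAt two_ne_zero
  have hg1 := fun i j => (hg i j).differentiableAt one_ne_zero
  unfold delEnergy
  rw [wDir_contract_left hh hz fun γ ν => cPair_differentiableAt hF1 hg1 (hw (-I) γ) (hw I ν)]
  refine Finset.sum_congr rfl fun γ _ => Finset.sum_congr rfl fun ν _ => ?_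
  rw [wDir_cPair hs hgd hg1 hF1 (hw (-I) γ) (hw I ν)]
  simp only [hp, cPair_zero_right, add_zero, secondForm]
  rw [cPair_sub_sum_left]

theorem covDir_secondForm (hs : ∀ y i j, g y i j = g y j i) (hF : ContDiffAt ℝ 3 F z)
    (hg : ∀ i j, ContDiffAt ℝ 3 (fun y => g y i j) (F z)) (hgd : IsUnit (g (F z)).det)
    (hh : ∀ a b, ContDiffAt ℝ 2 (fun x => h x a b) z) (hz : IsUnit (h z).det)
    (hp : ∀ i γ, covDir g F I β (fun i => wDir (-I) γ (coordComp F i)) i =ᶠ[𝓝 z] fun _ => 0)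
    (γ : Fin m) (i : Fin n) :
    covDir g F I β (secondForm g h F α γ) i z
      = cCurv g (F z) (fun i => wDir I β (coordComp F i) z)
          (fun i => wDir (-I) α (coordComp F i) z) (fun i => wDir (-I) γ (coordComp F i) z) i
        + ∑ μ, (∑ δ, (h z)⁻¹ δ μ * chernCoord h α β γ δ z) * wDir (-I) μ (coordComp F i) z := by
  have hΓ : ∀ i j k, ContDiffAt ℝ 2 (christoffel g i j k) (F z) := fun i j k =>
    christoffel_contDiffAt hg (by norm_num) hgd i j k
  have hw : ∀ γ i, ContDiffAt ℝ 2 (wDir (-I) γ (coordComp F i)) z := fun γ i =>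
    wDir_contDiffAt (coordComp_contDiffAt hF i) (by norm_num)
  have hF2 : ContDiffAt ℝ 2 F z := hF.of_le (by norm_num)
  have hc : ∀ i, DifferentiableAt ℝ
      (covDir g F (-I) α (fun i => wDir (-I) γ (coordComp F i)) i) z := fun i =>
    (covDir_contDiffAt (l := 1) hF2 (by norm_num) (fun i j k => (hΓ i j k).of_le one_le_two)
      (hw γ) i).differentiableAt one_ne_zero
  have hl : ∀ μ, DifferentiableAt ℝ (chernLeft h (-I) α γ μ) z := fun μ => by
    unfold chernLeft
    exact DifferentiableAt.fun_sum fun δ _ =>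
      ((contDiffAt_matrix_inv_apply hh hz δ μ).differentiableAt two_ne_zero).fun_mul
        ((wDir_contDiffAt (l := 1) (hh γ δ) (by norm_num)).differentiableAt one_ne_zero)
  have h1 := covDir_comm (c := I) (d := -I) (α := β) (β := α) hs hF2
    (fun i j k => (hΓ i j k).differentiableAt two_ne_zero) (hw γ) i
  rw [covDir_congr (fun i => hp i γ), covDir_zero, sub_zero] at h1
  unfold secondForm
  rw [covDir_sub_sum hc hl fun μ i => (hw μ i).differentiableAt two_ne_zero, h1]
  simp only [wDir_chernLeft hh hz, fun μ => (hp i μ).eq_of_nhds, mul_zero, Finset.sum_const_zero,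
    neg_mul, Finset.sum_neg_distrib]
  ring

/-- The complex Hessian of the energy density of a pluri-harmonic map. -/
theorem wDir_wDir_delEnergy (hs : ∀ y i j, g y i j = g y j i)
    (hg : ∀ᶠ y in 𝓝 (F z), ∀ i j, ContDiffAt ℝ 3 (fun y => g y i j) y)
    (hgd : ∀ᶠ y in 𝓝 (F z), IsUnit (g y).det)
    (hF : ∀ᶠ x in 𝓝 z, ContDiffAt ℝ 3 F x)
    (hh : ∀ᶠ x in 𝓝 z, ∀ a b, ContDiffAt ℝ 2 (fun x => h x a b) x)
    (hz : ∀ᶠ x in 𝓝 z, IsUnit (h x).det)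
    (hp : ∀ᶠ x in 𝓝 z, ∀ i α β,
      covDir g F (-I) α (fun i => wDir I β (coordComp F i)) i x = 0) :
    wDir (-I) α (wDir I β (delEnergy g h F)) z
      = ∑ γ, ∑ ν, (h z)⁻¹ ν γ * (
          cPair (g (F z)) (fun i => secondForm g h F α γ i z)
            (fun i => secondFormBar g h F β ν i z)
          + ∑ μ, (∑ δ, (h z)⁻¹ δ μ * chernCoord h α β γ δ z)
            * cPair (g (F z)) (fun i => wDir (-I) μ (coordComp F i) z)
              (fun i => wDir I ν (coordComp F i) z)
          - cPair (g (F z)) (cCurv g (F z) (fun i => wDir (-I) α (coordComp F i) z)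
              (fun i => wDir I ν (coordComp F i) z) (fun i => wDir (-I) γ (coordComp F i) z))
              (fun i => wDir I β (coordComp F i) z)) := by
  have hF0 := hF.self_of_nhds
  have hg0 := hg.self_of_nhds
  have hgd0 := hgd.self_of_nhds
  have hh0 := hh.self_of_nhds
  have hz0 := hz.self_of_nhds
  have hF2 : ContDiffAt ℝ 2 F z := hF0.of_le (by norm_num)
  have hF1 : DifferentiableAt ℝ F z := hF0.differentiableAt three_ne_zero
  have hh1 : ∀ a b, ContDiffAt ℝ 1 (fun x => h x a b) z := fun a b => (hh0 a b).of_le one_le_two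
  have hg1 := fun i j => (hg0 i j).differentiableAt three_ne_zero
  have hw2 : ∀ c γ i, ContDiffAt ℝ 2 (wDir c γ (coordComp F i)) z := fun c γ i =>
    wDir_contDiffAt (coordComp_contDiffAt hF0 i) (by norm_num)
  have hw : ∀ c γ i, DifferentiableAt ℝ (wDir c γ (coordComp F i)) z := fun c γ i =>
    (hw2 c γ i).differentiableAt two_ne_zero
  have hΓ : ∀ i j k, ContDiffAt ℝ 2 (christoffel g i j k) (F z) := fun i j k =>
    christoffel_contDiffAt hg0 (by norm_num) hgd0 i j k
  have hinv : ∀ a b, ContDiffAt ℝ 2 (fun x => (h x)⁻¹ a b) z :=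
    contDiffAt_matrix_inv_apply hh0 hz0
  have hp' : ∀ β i γ, covDir g F I β (fun i => wDir (-I) γ (coordComp F i)) i
      =ᶠ[𝓝 z] fun _ => 0 := by
    intro β i γ
    filter_upwards [hp, hF] with x hx hFx
    rw [covDir_wDir_comm hs (hFx.of_le (by norm_num)), hx]
  have hu : ContDiffAt ℝ 2 (delEnergy g h F) z := by
    unfold delEnergy cPair
    exact ContDiffAt.sum fun γ _ => ContDiffAt.sum fun ν _ => (hinv ν γ).mul <|
      ContDiffAt.sum fun i _ => ContDiffAt.sum fun j _ =>
        ((comp_ofReal_contDiffAt hF2 ((hg0 i j).of_le (by norm_num))).mul (hw2 (-I) γ i)).mul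
          (hw2 I ν j)
  have h1 : wDir (-I) α (delEnergy g h F) =ᶠ[𝓝 z] fun x =>
      ∑ γ, ∑ ν, (h x)⁻¹ ν γ * cPair (g (F x)) (fun i => secondForm g h F α γ i x)
          (fun i => wDir I ν (coordComp F i) x) := by
    filter_upwards [hp, hF, hh, hz, hF0.continuousAt.eventually hg,
      hF0.continuousAt.eventually hgd] with x hpx hFx hhx hzx hgx hgdx
    exact wDir_delEnergy hs (hFx.of_le (by norm_num))
      (fun i j => (hgx i j).of_le (by norm_num)) hgdx (fun a b => (hhx a b).of_le one_le_two) hzx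
      fun i ν => hpx i α ν
  have hS : ∀ γ i, DifferentiableAt ℝ (secondForm g h F α γ i) z := by
    intro γ i
    unfold secondForm chernLeft
    exact ((covDir_contDiffAt (l := 1) hF2 (by norm_num)
      (fun i j k => (hΓ i j k).of_le one_le_two) (hw2 (-I) γ) i).differentiableAt
        one_ne_zero).fun_sub <| DifferentiableAt.fun_sum fun μ _ =>
      (DifferentiableAt.fun_sum fun δ _ => ((hinv δ μ).differentiableAt two_ne_zero).fun_mul
        ((wDir_contDiffAt (l := 1) (hh0 γ δ) (by norm_num)).differentiableAt one_ne_zero)).fun_mul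
        (hw (-I) μ i)
  have hflat : ∀ ν γ l, cCurv g (F z) (fun i => wDir I β (coordComp F i) z)
      (fun i => wDir I ν (coordComp F i) z) (fun i => wDir (-I) γ (coordComp F i) z) l = 0 := by
    intro ν γ l
    rw [← covDir_comm (s := fun i => wDir (-I) γ (coordComp F i)) hs hF2
      (fun i j k => (hΓ i j k).differentiableAt two_ne_zero) (hw2 (-I) γ) l,
      covDir_congr (fun i => hp' ν i γ), covDir_congr (fun i => hp' β i γ), covDir_zero,
      covDir_zero, sub_zero]
  rw [wDir_comm hu, wDir_congr h1,
    wDir_contract_right hh1 hz0 fun γ ν => cPair_differentiableAt hF1 hg1 (hS γ) (hw I ν)]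
  refine Finset.sum_congr rfl fun γ _ => Finset.sum_congr rfl fun ν _ => ?_
  congr 1
  rw [wDir_cPair hs hgd0 hg1 hF1 (hS γ) (hw I ν), add_sub_assoc]
  have e1 : cPair (g (F z)) (fun i => secondForm g h F α γ i z)
        (fun i => covDir g F I β (fun i => wDir I ν (coordComp F i)) i z)
        - ∑ μ, chernRight h I β ν μ z * cPair (g (F z)) (fun i => secondForm g h F α γ i z)
          (fun i => wDir I μ (coordComp F i) z)
      = cPair (g (F z)) (fun i => secondForm g h F α γ i z)
        (fun i => secondFormBar g h F β ν i z) :=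
    (cPair_sub_sum_right ..).symm
  have e2 : cPair (g (F z)) (fun i => covDir g F I β (secondForm g h F α γ) i z)
        (fun i => wDir I ν (coordComp F i) z)
      = cPair (g (F z)) (cCurv g (F z) (fun i => wDir I β (coordComp F i) z)
          (fun i => wDir (-I) α (coordComp F i) z) (fun i => wDir (-I) γ (coordComp F i) z))
          (fun i => wDir I ν (coordComp F i) z)
        + ∑ μ, (∑ δ, (h z)⁻¹ δ μ * chernCoord h α β γ δ z)
            * cPair (g (F z)) (fun i => wDir (-I) μ (coordComp F i) z)
              (fun i => wDir I ν (coordComp F i) z) := by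
    have := cPair_sub_sum_left (g (F z)) (cCurv g (F z) (fun i => wDir I β (coordComp F i) z)
        (fun i => wDir (-I) α (coordComp F i) z) (fun i => wDir (-I) γ (coordComp F i) z))
      (fun μ => -∑ δ, (h z)⁻¹ δ μ * chernCoord h α β γ δ z)
      (fun μ i => wDir (-I) μ (coordComp F i) z) (fun i => wDir I ν (coordComp F i) z)
    simp only [neg_mul, Finset.sum_neg_distrib, sub_neg_eq_add] at this
    rw [← this]
    congr 1
    funext i
    exact covDir_secondForm hs hF0 hg0 hgd0 hh0 hz0 (hp' β) γ i
  rw [e1, e2, cPair_cCurv_of_flat hs (fun i j => (hg0 i j).of_le (by norm_num)) hgd0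
    (hflat ν α)]
  ring

end SecondFundamentalForm

section ContractionSums

variable {m n : ℕ}

theorem sum_contract_chern (H : Fin m → Fin m → ℂ) (K : Fin m → Fin m → Fin m → Fin m → ℂ)
    (Q : Fin m → Fin m → ℂ) :
    ∑ α, ∑ β, H α β * ∑ γ, ∑ ν, H γ ν * ∑ μ, (∑ δ, H μ δ * K α β γ δ) * Q μ ν
      = ∑ γ, ∑ δ, ∑ μ, ∑ ν, (∑ α, ∑ β, H α β * K α β γ δ) * H γ ν * H μ δ * Q μ ν := by
  have e : ∀ T : Fin m → Fin m → Fin m → Fin m → Fin m → Fin m → ℂ,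
      ∑ α, ∑ β, ∑ γ, ∑ ν, ∑ μ, ∑ δ, T α β γ ν μ δ
        = ∑ γ, ∑ δ, ∑ μ, ∑ ν, ∑ α, ∑ β, T α β γ ν μ δ := by
    intro T
    refine (sum_pull_third _).trans (Finset.sum_congr rfl fun γ _ => ?_)
    rw [Finset.sum_congr rfl fun α _ => Finset.sum_congr rfl fun β _ => sum_pull_third _]
    refine (sum_pull_third _).trans (Finset.sum_congr rfl fun δ _ => ?_)
    rw [Finset.sum_congr rfl fun α _ => Finset.sum_congr rfl fun β _ => Finset.sum_comm]
    exact (sum_pull_third _).trans (Finset.sum_congr rfl fun μ _ => sum_pull_third _)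
  simp only [Finset.mul_sum, Finset.sum_mul]
  rw [e]
  exact Finset.sum_congr rfl fun _ _ => Finset.sum_congr rfl fun _ _ =>
    Finset.sum_congr rfl fun _ _ => Finset.sum_congr rfl fun _ _ =>
    Finset.sum_congr rfl fun _ _ => Finset.sum_congr rfl fun _ _ => by ring

theorem sum_contract_riemann (H : Fin m → Fin m → ℂ) (R : Fin n → Fin n → Fin n → Fin n → ℂ)
    (a b : Fin m → Fin n → ℂ) :
    ∑ α, ∑ β, H α β * ∑ γ, ∑ ν, H γ ν *
        ∑ i, ∑ j, ∑ k, ∑ l, R i j k l * a α i * b ν j * a γ k * b β l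
      = ∑ i, ∑ j, ∑ k, ∑ l, R i l k j * (∑ α, ∑ β, H α β * a α i * b β j)
        * (∑ γ, ∑ δ, H γ δ * a γ k * b δ l) := by
  have e : ∀ i j k l, R i l k j * (∑ α, ∑ β, H α β * a α i * b β j)
        * (∑ γ, ∑ δ, H γ δ * a γ k * b δ l)
      = ∑ α, ∑ β, ∑ γ, ∑ ν, H α β * (H γ ν * (R i l k j * a α i * b ν l * a γ k * b β j)) := by
    intro i j k l
    rw [mul_assoc, Finset.sum_mul, Finset.mul_sum]
    refine Finset.sum_congr rfl fun α _ => ?_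
    rw [Finset.sum_mul, Finset.mul_sum]
    refine Finset.sum_congr rfl fun β _ => ?_
    simp only [Finset.mul_sum]
    exact Finset.sum_congr rfl fun γ _ => Finset.sum_congr rfl fun ν _ => by ring
  simp only [e]
  have hp : ∀ T : Fin m → Fin m → Fin m → Fin m → Fin n → ℂ,
      ∑ α, ∑ β, ∑ γ, ∑ ν, ∑ i, T α β γ ν i = ∑ i, ∑ α, ∑ β, ∑ γ, ∑ ν, T α β γ ν i := by
    intro T
    rw [Finset.sum_congr rfl fun α _ => sum_pull_fourth _, Finset.sum_comm]
  simp only [Finset.mul_sum]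
  rw [hp]
  refine Finset.sum_congr rfl fun i _ => ?_
  rw [hp, sum_pull_third (κ₁ := Fin n) (κ₂ := Fin n) (κ₃ := Fin n)]
  refine Finset.sum_congr rfl fun l _ => ?_
  rw [hp, Finset.sum_congr rfl fun k _ => hp _, Finset.sum_comm]

end ContractionSums

section Assembly

open Filter Topology

variable {m n : ℕ}

theorem conj_wDir_coordComp (F : EuclideanSpace ℂ (Fin m) → EuclideanSpace ℝ (Fin n)) (α : Fin m)
    (i : Fin n) (z : EuclideanSpace ℂ (Fin m)) :
    (starRingEnd ℂ) (wDir (-I) α (coordComp F i) z) = wDir I α (coordComp F i) z := by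
  have h := wDir_conj (c := I) (α := α) (F := coordComp F i) (z := z)
  rw [conj_I] at h
  rw [← h]
  simp only [coordComp, Complex.conj_ofReal]
  rfl

theorem conj_inv_apply {A : Matrix (Fin m) (Fin m) ℂ}
    (hA : ∀ a b, A a b = (starRingEnd ℂ) (A b a)) (a b : Fin m) :
    (starRingEnd ℂ) (A⁻¹ a b) = A⁻¹ b a := by
  have h : A.conjTranspose = A := by
    ext a b
    rw [Matrix.conjTranspose_apply, hA a b]
    rfl
  have h2 := congrFun (congrFun (Matrix.conjTranspose_nonsing_inv A) b) a
  rwa [h, Matrix.conjTranspose_apply] at h2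

theorem conj_secondForm {g : EuclideanSpace ℝ (Fin n) → Matrix (Fin n) (Fin n) ℝ}
    {h : EuclideanSpace ℂ (Fin m) → Matrix (Fin m) (Fin m) ℂ}
    {F : EuclideanSpace ℂ (Fin m) → EuclideanSpace ℝ (Fin n)} {z : EuclideanSpace ℂ (Fin m)}
    (hh : ∀ z a b, h z a b = (starRingEnd ℂ) (h z b a)) (β ν : Fin m) (i : Fin n) :
    (starRingEnd ℂ) (secondForm g h F β ν i z) = secondFormBar g h F β ν i z := by
  have h1 : (starRingEnd ℂ) (wDir (-I) β (wDir (-I) ν (coordComp F i)) z)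
      = wDir I β (wDir I ν (coordComp F i)) z := by
    have h2 := wDir_conj (c := I) (α := β) (F := wDir (-I) ν (coordComp F i)) (z := z)
    rw [conj_I] at h2
    rw [← h2]
    simp only [conj_wDir_coordComp]
  have h3 : ∀ μ δ, (starRingEnd ℂ) (wDir (-I) β (fun x => h x μ δ) z)
      = wDir I β (fun x => h x δ μ) z := by
    intro μ δ
    have h2 := wDir_conj (c := I) (α := β) (F := fun x => h x μ δ) (z := z)
    rw [conj_I] at h2
    rw [← h2]
    simp only [← hh]
  simp only [secondForm, secondFormBar, covDir, chernLeft, chernRight, map_sub, map_add, map_sum,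
    map_mul, h1, h3, conj_wDir_coordComp, Complex.conj_ofReal, conj_inv_apply (hh z)]

variable {M N : Type*} [TopologicalSpace M] [ChartedSpace (EuclideanSpace ℂ (Fin m)) M]
  [TopologicalSpace N] [ChartedSpace (EuclideanSpace ℝ (Fin n)) N]

theorem delfNormSq_eq_delEnergy (hD : HermitianData m M) (gD : RiemannData n N) (f : M → N)
    (p : M) : delfNormSq hD gD f p = delEnergy (gD.g (f p)) (hD.h p) (chartRep f p) := by
  funext z
  simp only [delfNormSq, delEnergy, cPair, Finset.mul_sum]
  refine Finset.sum_congr rfl fun γ _ => Finset.sum_congr rfl fun ν _ =>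
    Finset.sum_congr rfl fun i _ => Finset.sum_congr rfl fun j _ => ?_
  have : (starRingEnd ℂ) (wDeriv ν (mapComp f p j) z) = wDir I ν (coordComp (chartRep f p) j) z := by
    rw [wDeriv_eq_wDir, ← conj_wDir_coordComp]
    rfl
  rw [this, wDeriv_eq_wDir, HermitianData.up]
  simp only [mul_assoc]
  rfl

theorem delFdelf_eq_secondForm (hD : HermitianData m M) (gD : RiemannData n N) (f : M → N)
    (p : M) (i : Fin n) (γ α : Fin m) (z : EuclideanSpace ℂ (Fin m)) :
    delFdelf hD gD f p i γ α z
      = secondForm (gD.g (f p)) (hD.h p) (chartRep f p) α γ i z := by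
  simp only [delFdelf, secondForm, covDir, chernLeft, HermitianData.chernChristoffel,
    HermitianData.up, wDeriv_eq_wDir]
  rw [sub_add_eq_add_sub]
  rfl

theorem chern_eq_chernCoord (hD : HermitianData m M) (p : M) (α β γ δ : Fin m)
    (z : EuclideanSpace ℂ (Fin m)) :
    hD.chern p α β γ δ z = chernCoord (hD.h p) α β γ δ z := by
  simp only [HermitianData.chern, chernCoord, HermitianData.up, wDeriv_eq_wDir,
    wDerivBar_eq_wDir]

theorem eventually_covDir_eq_zero (hD : HermitianData m M) (gD : RiemannData n N) {f : M → N}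
    (hf : IsSmoothMap (m := m) (n := n) f) (hpluri : IsPluriHarmonic (m := m) gD f) (p : M) :
    ∀ᶠ x in 𝓝 (basePt (m := m) p), ∀ i α β, covDir (gD.g (f p)) (chartRep f p) (-I) α
      (fun i => wDir I β (coordComp (chartRep f p) i)) i x = 0 := by
  have hF : ContDiffAt ℝ 2 (chartRep (m := m) (n := n) f p) (basePt p) :=
    (contDiffAt_chartRep_basePt hf p).of_le (WithTop.coe_le_coe.2 (le_top : (2 : ℕ∞) ≤ ⊤))
  have ht : ∀ᶠ x in 𝓝 (basePt (m := m) p), x ∈ (chartAt (EuclideanSpace ℂ (Fin m)) p).target :=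
    (chartAt (EuclideanSpace ℂ (Fin m)) p).open_target.mem_nhds (mem_chart_target _ p)
  have hfs : ∀ᶠ x in 𝓝 (basePt (m := m) p), f ((chartAt (EuclideanSpace ℂ (Fin m)) p).symm x)
      ∈ (chartAt (EuclideanSpace ℝ (Fin n)) (f p)).source := by
    have hc : ContinuousAt (f ∘ (chartAt (EuclideanSpace ℂ (Fin m)) p).symm)
        (basePt (m := m) p) :=
      hf.continuous.continuousAt.comp
        ((chartAt (EuclideanSpace ℂ (Fin m)) p).continuousAt_symm (mem_chart_target _ p))
    refine hc ((chartAt (EuclideanSpace ℝ (Fin n)) (f p)).open_source.mem_nhds ?_)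
    simp only [Function.comp, basePt, (chartAt (EuclideanSpace ℂ (Fin m)) p).left_inv
      (mem_chart_source _ p)]
    exact mem_chart_source _ (f p)
  filter_upwards [ht, hfs, hF.eventually (by simp)] with x hx hfx hFx i α β
  have h := pluriTensor_eq_zero_of_mem hD gD hf hpluri p hx hfx hFx i α β
  rw [← h, covDir_wDir_comm (gD.symm (f p)) hFx]
  simp only [covDir, pluriTensor, wDeriv_eq_wDir, wDerivBar_eq_wDir]
  rw [wDir_comm (coordComp_contDiffAt hFx i)]
  rfl

end Assembly

/-- Proposition 3.2, Laplacian form of the Chern-Lu identity.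
For a pluri-harmonic map `f : (M,h) → (N,g)` and `u = |∂f|²`,
`Δ_h u = |∂_F ∂f|² + (h^{α β̄} R^M_{α β̄ γ δ̄}) h^{γ ν̄} h^{μ δ̄} g_{ij} f^i_μ f^j_ν̄
  − R^N_{iℓkj} (h^{α β̄} f^i_α f^j_β̄)(h^{γ δ̄} f^k_γ f^ℓ_δ̄)`,
where `Δ_h u = h^{α β̄} ∂²u/∂z^α∂z̄^β`. -/
theorem chernLu_laplacian_of_pluriharmonic
    (hD : HermitianData m M) (gD : RiemannData n N)
    (f : M → N) (hf : IsSmoothMap (m := m) (n := n) f) (hpluri : IsPluriHarmonic (m := m) gD f) :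
    ∀ p : M,
      (∑ α, ∑ β, hD.up p (basePt p) α β *
        wDeriv α (fun z => wDerivBar β (delfNormSq hD gD f p) z) (basePt p))
      = (∑ α, ∑ β, ∑ γ, ∑ ν, ∑ i, ∑ j,
          hD.up p (basePt p) α β * hD.up p (basePt p) γ ν *
          (gD.g (f p) (chartRep f p (basePt (m := m) p)) i j : ℂ) *
          delFdelf hD gD f p i γ α (basePt p) *
          (starRingEnd ℂ) (delFdelf hD gD f p j ν β (basePt p)))
        + (∑ γ, ∑ δ, ∑ μ, ∑ ν, ∑ i, ∑ j,
            (∑ α, ∑ β, hD.up p (basePt p) α β * hD.chern p α β γ δ (basePt p)) *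
            hD.up p (basePt p) γ ν * hD.up p (basePt p) μ δ *
            (gD.g (f p) (chartRep f p (basePt (m := m) p)) i j : ℂ) *
            wDeriv μ (mapComp f p i) (basePt p) *
            wDerivBar ν (mapComp f p j) (basePt p))
        - (∑ i, ∑ j, ∑ k, ∑ l,
            (riemannLo (gD.g (f p)) i l k j (chartRep f p (basePt (m := m) p)) : ℂ) *
            (∑ α, ∑ β, hD.up p (basePt p) α β *
              wDeriv α (mapComp f p i) (basePt p) *
              wDerivBar β (mapComp f p j) (basePt p)) *
            (∑ γ, ∑ δ, hD.up p (basePt p) γ δ *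
              wDeriv γ (mapComp f p k) (basePt p) *
              wDerivBar δ (mapComp f p l) (basePt p))) := by
  intro p
  set z : EuclideanSpace ℂ (Fin m) := basePt p with hzdef
  set F := chartRep (m := m) (n := n) f p with hFdef
  set h := hD.h p with hhdef
  set g := gD.g (f p) with hgdef
  have hzt : z ∈ (chartAt (EuclideanSpace ℂ (Fin m)) p).target := mem_chart_target _ p
  have hyt : F z ∈ (chartAt (EuclideanSpace ℝ (Fin n)) (f p)).target := by
    have : F z = chartAt (EuclideanSpace ℝ (Fin n)) (f p) (f p) := by
      simp [F, z, chartRep, basePt]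
    rw [this]
    exact mem_chart_target _ (f p)
  have hMopen := (chartAt (EuclideanSpace ℂ (Fin m)) p).open_target
  have hNopen := (chartAt (EuclideanSpace ℝ (Fin n)) (f p)).open_target
  have hF : ContDiffAt ℝ 3 F z :=
    (contDiffAt_chartRep_basePt hf p).of_le (WithTop.coe_le_coe.2 (le_top : (3 : ℕ∞) ≤ ⊤))
  have hHess := fun α β => wDir_wDir_delEnergy (g := g) (h := h) (F := F) (z := z) (α := α)
    (β := β) (gD.symm (f p))
    (by
      filter_upwards [hNopen.mem_nhds hyt] with y hy i j
      exact ((gD.smooth (f p) i j).contDiffAt (hNopen.mem_nhds hy)).of_le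
        (WithTop.coe_le_coe.2 (le_top : (3 : ℕ∞) ≤ ⊤)))
    (by
      filter_upwards [hNopen.mem_nhds hyt] with y hy
      exact isUnit_det_of_real_posdef (gD.posdef (f p) y hy))
    (hF.eventually (by simp))
    (by
      filter_upwards [hMopen.mem_nhds hzt] with x hx a b
      exact ((hD.smooth p a b).contDiffAt (hMopen.mem_nhds hx)).of_le
        (WithTop.coe_le_coe.2 (le_top : (2 : ℕ∞) ≤ ⊤)))
    (by
      filter_upwards [hMopen.mem_nhds hzt] with x hx
      exact isUnit_det_of_hermitian_posdef (hD.posdef p x hx))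
    (eventually_covDir_eq_zero hD gD hf hpluri p)
  have hL : ∀ α β, wDeriv α (fun z => wDerivBar β (delfNormSq hD gD f p) z) z
      = wDir (-I) α (wDir I β (delEnergy g h F)) z := by
    intro α β
    rw [wDeriv_eq_wDir, wDerivBar_eq_wDir, delfNormSq_eq_delEnergy]
  have ha : ∀ α i, wDeriv α (mapComp f p i) z = wDir (-I) α (coordComp F i) z := by
    intro α i
    rw [wDeriv_eq_wDir]
    rfl
  have hb : ∀ α i, wDerivBar α (mapComp f p i) z = wDir I α (coordComp F i) z := fun _ _ => rfl
  have hup : ∀ α β, hD.up p z α β = (h z)⁻¹ β α := fun _ _ => rfl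
  simp only [hL, hHess, ha, hb, hup, delFdelf_eq_secondForm, conj_secondForm (hD.hermitian p),
    chern_eq_chernCoord, mul_add, mul_sub, Finset.sum_add_distrib, Finset.sum_sub_distrib]
  have hM := sum_contract_chern (fun α β => (h z)⁻¹ β α) (fun α β γ δ => chernCoord h α β γ δ z)
    (fun μ ν => cPair (g (F z)) (fun i => wDir (-I) μ (coordComp F i) z)
      (fun i => wDir I ν (coordComp F i) z))
  have hN := sum_contract_riemann (fun α β => (h z)⁻¹ β α)
    (fun i j k l => (riemannLo g i j k l (F z) : ℂ))
    (fun α i => wDir (-I) α (coordComp F i) z) (fun α i => wDir I α (coordComp F i) z)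
  simp only [cPair_cCurv]
  refine congrArg₂ _ (congrArg₂ _ ?_ ?_) hN
  · simp only [cPair, Finset.mul_sum]
    refine Finset.sum_congr rfl fun α _ => Finset.sum_congr rfl fun β _ =>
      Finset.sum_congr rfl fun γ _ => Finset.sum_congr rfl fun ν _ =>
      Finset.sum_congr rfl fun i _ => Finset.sum_congr rfl fun j _ => ?_
    ring
  · refine hM.trans ?_
    refine Finset.sum_congr rfl fun γ _ => Finset.sum_congr rfl fun δ _ =>
      Finset.sum_congr rfl fun μ _ => Finset.sum_congr rfl fun ν _ => ?_
    simp only [cPair, Finset.mul_sum (s := (Finset.univ : Finset (Fin n)))]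
    exact Finset.sum_congr rfl fun i _ => Finset.sum_congr rfl fun j _ => by ring
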